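/- arXiv:1402.1002 — 13 statements merged into one kernel-verified Lean document; each statement's English description precedes it below -/
import Mathlib

section
/- Let G be a finite group such that any two subgroups of G of the same order lie in the same orbit of the natural action of the automorphism group Aut(G) on the set of all subgroups of G (equivalently, the number of orbits of this action equals the number of divisors d of |G| for which G has a subgroup of order d). Then the transiso graph Γ_d(G) is complete for each divisor d of |G|. -/
/-- `S` is a normalized right transversal (NRT) of `H` in `G`: `1 ∈ S` and every `g ∈ G`
is uniquely `h * s` with `h ∈ H`, `s ∈ S`. -/
def IsNRT {G : Type*} [Group G] (H : Subgroup G) (S : Set G) : Prop :=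
  (1 : G) ∈ S ∧ ∀ g : G, ∃! s, s ∈ S ∧ ∃ h ∈ H, g = h * s

/-- `φ` is an isomorphism of NRTs from `S₁` (an NRT of `H₁`) onto `S₂` (an NRT of `H₂`):
it is a bijection from `S₁` to `S₂` carrying the induced operation of `S₁` to that of `S₂`,
where `z = x ∘ y` in `S` means `z ∈ S` and `x * y ∈ H * z`. -/
def IsNRTIso {G : Type*} [Group G] (H₁ H₂ : Subgroup G) (S₁ S₂ : Set G) (φ : G → G) : Prop :=
  Set.BijOn φ S₁ S₂ ∧
    ∀ x ∈ S₁, ∀ y ∈ S₁, ∀ z ∈ S₁, (∃ h ∈ H₁, x * y = h * z) →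
      ∃ h ∈ H₂, φ x * φ y = h * φ z

/-- Two subgroups are adjacent in the transiso graph if they admit isomorphic NRTs. -/
def TransisoAdj {G : Type*} [Group G] (H₁ H₂ : Subgroup G) : Prop :=
  ∃ S₁ S₂ : Set G, IsNRT H₁ S₁ ∧ IsNRT H₂ S₂ ∧ ∃ φ : G → G, IsNRTIso H₁ H₂ S₁ S₂ φ

/-- The transiso graph `Γ_d(G)` is complete: any two distinct subgroups of order `d`
are adjacent. -/
def TransisoComplete (G : Type*) [Group G] (d : ℕ) : Prop :=
  ∀ H₁ H₂ : Subgroup G, Nat.card H₁ = d → Nat.card H₂ = d → H₁ ≠ H₂ →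
    TransisoAdj H₁ H₂

theorem exists_isNRT {G : Type*} [Group G] (H : Subgroup G) : ∃ S : Set G, IsNRT H S := by
  obtain ⟨S, hS, h1⟩ := H.exists_isComplement_right 1
  refine ⟨S, h1, fun g => ?_⟩
  obtain ⟨⟨a, s⟩, hg, hu⟩ := Subgroup.isComplement_iff_existsUnique.mp hS g
  refine ⟨s, ⟨s.2, a, a.2, hg.symm⟩, ?_⟩
  rintro t ⟨ht, b, hb, hbt⟩
  have := hu (⟨b, hb⟩, ⟨t, ht⟩) hbt.symm
  exact congrArg (fun x => (x.2 : G)) this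

theorem IsNRT.map {G : Type*} [Group G] {H : Subgroup G} {S : Set G} (hS : IsNRT H S)
    (f : G ≃* G) : IsNRT (H.map f.toMonoidHom) (f '' S) := by
  refine ⟨⟨1, hS.1, map_one f⟩, fun g => ?_⟩
  obtain ⟨s, ⟨hs, a, ha, hg⟩, hu⟩ := hS.2 (f.symm g)
  refine ⟨f s, ⟨⟨s, hs, rfl⟩, f a, ⟨a, ha, rfl⟩, ?_⟩, ?_⟩
  · rw [← map_mul, ← hg, f.apply_symm_apply]
  · rintro _ ⟨⟨t, ht, rfl⟩, _, ⟨b, hb, rfl⟩, hbt⟩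
    refine congrArg f (hu t ⟨ht, b, hb, ?_⟩)
    rw [hbt]
    exact f.injective (by simp)

theorem isNRTIso_map {G : Type*} [Group G] (H : Subgroup G) (S : Set G) (f : G ≃* G) :
    IsNRTIso H (H.map f.toMonoidHom) S (f '' S) f := by
  refine ⟨f.injective.injOn.bijOn_image, ?_⟩
  rintro x - y - z - ⟨a, ha, hxy⟩
  exact ⟨f a, ⟨a, ha, rfl⟩, by rw [← map_mul, hxy, map_mul]⟩

theorem stmt_1 {G : Type*} [Group G] [Finite G]
    (h : ∀ H₁ H₂ : Subgroup G, Nat.card H₁ = Nat.card H₂ →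
      ∃ f : G ≃* G, H₁.map f.toMonoidHom = H₂) :
    ∀ d : ℕ, d ∣ Nat.card G → TransisoComplete G d := by
  rintro d - H₁ H₂ h₁ h₂ -
  obtain ⟨f, rfl⟩ := h H₁ H₂ (h₁.trans h₂.symm)
  obtain ⟨S, hS⟩ := exists_isNRT H₁
  exact ⟨S, f '' S, hS, hS.map f, f, isNRTIso_map H₁ S f⟩
end

section
/- Let G be a finite group and let H₁ and H₂ be subgroups of G whose normal core in G is trivial. Suppose S₁ is an NRT of H₁ in G and S₂ is an NRT of H₂ in G such that S₁ generates G, S₂ generates G, and φ : S₁ → S₂ is an isomorphism of NRTs. Then there exists an automorphism f of G with f(s) = φ(s) for all s ∈ S₁ and f(H₁) = H₂. -/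
namespace IsNRT

variable {G : Type*} [Group G] {H : Subgroup G} {S : Set G}

theorem exists_mul_inv_mem (hS : IsNRT H S) (g : G) : ∃ s ∈ S, g * s⁻¹ ∈ H := by
  obtain ⟨s, ⟨hs, h, hh, e⟩, -⟩ := hS.2 g
  exact ⟨s, hs, by simpa [e] using hh⟩

theorem eq_of_mul_inv_mem (hS : IsNRT H S) {g s t : G} (hs : s ∈ S) (ht : t ∈ S)
    (hgs : g * s⁻¹ ∈ H) (hgt : g * t⁻¹ ∈ H) : s = t :=
  (hS.2 g).unique ⟨hs, _, hgs, by group⟩ ⟨ht, _, hgt, by group⟩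

theorem mul_inv_mem_iff (hS : IsNRT H S) {s t : G} (hs : s ∈ S) (ht : t ∈ S) :
    s * t⁻¹ ∈ H ↔ s = t :=
  ⟨fun h => hS.eq_of_mul_inv_mem (g := s) hs ht (by simp) h, fun h => by simp [h]⟩

/-- With a trivial core, an element all of whose conjugates by a transversal lie in `H` is
trivial. -/
theorem eq_one_of_conj_mem (hS : IsNRT H S) (hH : H.normalCore = ⊥) {k : G}
    (hk : ∀ s ∈ S, s * k * s⁻¹ ∈ H) : k = 1 := by
  rw [← Subgroup.mem_bot, ← hH]
  intro g
  obtain ⟨s, hs, hgs⟩ := hS.exists_mul_inv_mem g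
  have := H.mul_mem (H.mul_mem hgs (hk s hs)) (H.inv_mem hgs)
  convert this using 1
  group

end IsNRT

section Intertwiner

variable {G : Type*} [Group G] {H₁ H₂ : Subgroup G} {S₁ S₂ : Set G} {φ : G → G}

/-- The pairs `(g, k)` such that the bijection `φ` intertwines right translation by `g` on the
right cosets of `H₁` with right translation by `k` on the right cosets of `H₂`. -/
def intertwiner (hS₁ : IsNRT H₁ S₁) (hS₂ : IsNRT H₂ S₂) (hφ : Set.BijOn φ S₁ S₂) :
    Subgroup (G × G) where
  carrier := {p | ∀ x ∈ S₁, ∀ z ∈ S₁, x * p.1 * z⁻¹ ∈ H₁ ↔ φ x * p.2 * (φ z)⁻¹ ∈ H₂}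
  one_mem' x hx z hz := by
    simp only [Prod.fst_one, Prod.snd_one, mul_one]
    rw [hS₁.mul_inv_mem_iff hx hz, hS₂.mul_inv_mem_iff (hφ.mapsTo hx) (hφ.mapsTo hz),
      hφ.injOn.eq_iff hx hz]
  mul_mem' {p q} hp hq x hx z hz := by
    obtain ⟨y, hy, hxy⟩ := hS₁.exists_mul_inv_mem (x * p.1)
    have e₁ : x * (p * q).1 * z⁻¹ = x * p.1 * y⁻¹ * (y * q.1 * z⁻¹) := by
      simp [mul_assoc]
    have e₂ : φ x * (p * q).2 * (φ z)⁻¹ = φ x * p.2 * (φ y)⁻¹ * (φ y * q.2 * (φ z)⁻¹) := by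
      simp [mul_assoc]
    rw [e₁, e₂, H₁.mul_mem_cancel_left hxy, H₂.mul_mem_cancel_left ((hp x hx y hy).1 hxy)]
    exact hq y hy z hz
  inv_mem' {p} hp x hx z hz := by
    rw [← H₁.inv_mem_iff, ← H₂.inv_mem_iff]
    simpa [mul_assoc] using hp z hz x hx

variable {hS₁ : IsNRT H₁ S₁} {hS₂ : IsNRT H₂ S₂}

theorem mem_intertwiner_of_mem (hφ : IsNRTIso H₁ H₂ S₁ S₂ φ) {s : G} (hs : s ∈ S₁) :
    (s, φ s) ∈ intertwiner hS₁ hS₂ hφ.1 := by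
  have key : ∀ x ∈ S₁, ∀ z ∈ S₁, x * s * z⁻¹ ∈ H₁ → φ x * φ s * (φ z)⁻¹ ∈ H₂ := by
    intro x hx z hz h
    obtain ⟨k, hk, e⟩ := hφ.2 x hx s hs z hz ⟨_, h, by group⟩
    simpa [e] using hk
  refine fun x hx z hz => ⟨key x hx z hz, fun h => ?_⟩
  obtain ⟨y, hy, hxy⟩ := hS₁.exists_mul_inv_mem (x * s)
  have e := hφ.1.injOn hz hy (hS₂.eq_of_mul_inv_mem (hφ.1.mapsTo hz) (hφ.1.mapsTo hy) h
    (key x hx y hy hxy))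
  exact e ▸ hxy

theorem intertwiner_fst_eq_one_iff (h₁ : H₁.normalCore = ⊥) (h₂ : H₂.normalCore = ⊥)
    {hφ : Set.BijOn φ S₁ S₂} {p : G × G} (hp : p ∈ intertwiner hS₁ hS₂ hφ) :
    p.1 = 1 ↔ p.2 = 1 := by
  constructor
  · intro h
    refine hS₂.eq_one_of_conj_mem h₂ fun s hs => ?_
    obtain ⟨x, hx, rfl⟩ := hφ.surjOn hs
    exact (hp x hx x hx).1 (by simp [h])
  · intro h
    exact hS₁.eq_one_of_conj_mem h₁ fun x hx => (hp x hx x hx).2 (by simp [h])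

theorem map_fst_intertwiner (hgen : Subgroup.closure S₁ = ⊤) (hφ : IsNRTIso H₁ H₂ S₁ S₂ φ) :
    (intertwiner hS₁ hS₂ hφ.1).map (MonoidHom.fst G G) = ⊤ := by
  rw [eq_top_iff, ← hgen, Subgroup.closure_le]
  exact fun s hs => ⟨(s, φ s), mem_intertwiner_of_mem hφ hs, rfl⟩

theorem map_snd_intertwiner (hgen : Subgroup.closure S₂ = ⊤) (hφ : IsNRTIso H₁ H₂ S₁ S₂ φ) :
    (intertwiner hS₁ hS₂ hφ.1).map (MonoidHom.snd G G) = ⊤ := by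
  rw [eq_top_iff, ← hgen, Subgroup.closure_le]
  intro t ht
  obtain ⟨s, hs, rfl⟩ := hφ.1.surjOn ht
  exact ⟨(s, φ s), mem_intertwiner_of_mem hφ hs, rfl⟩

end Intertwiner

theorem IsNRTIso.map_one {G : Type*} [Group G] {H₁ H₂ : Subgroup G} {S₁ S₂ : Set G} {φ : G → G}
    (hS₁ : IsNRT H₁ S₁) (hS₂ : IsNRT H₂ S₂) (hφ : IsNRTIso H₁ H₂ S₁ S₂ φ) : φ 1 = 1 := by
  obtain ⟨h, hh, e⟩ := hφ.2 1 hS₁.1 1 hS₁.1 1 hS₁.1 ⟨1, H₁.one_mem, rfl⟩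
  exact (hS₂.mul_inv_mem_iff (hφ.1.mapsTo hS₁.1) hS₂.1).1 (by simpa [mul_right_cancel e] using hh)

theorem stmt_2 {G : Type*} [Group G] [Finite G] (H₁ H₂ : Subgroup G)
    (h₁ : H₁.normalCore = ⊥) (h₂ : H₂.normalCore = ⊥)
    (S₁ S₂ : Set G) (hS₁ : IsNRT H₁ S₁) (hS₂ : IsNRT H₂ S₂)
    (hgen₁ : Subgroup.closure S₁ = ⊤) (hgen₂ : Subgroup.closure S₂ = ⊤)
    (φ : G → G) (hφ : IsNRTIso H₁ H₂ S₁ S₂ φ) :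
    ∃ f : G ≃* G, (∀ s ∈ S₁, f s = φ s) ∧ H₁.map f.toMonoidHom = H₂ := by
  let K := intertwiner hS₁ hS₂ hφ.1
  let p₁ : K →* G := (MonoidHom.fst G G).comp K.subtype
  let p₂ : K →* G := (MonoidHom.snd G G).comp K.subtype
  have hp (k : K) : p₁ k = 1 ↔ p₂ k = 1 := intertwiner_fst_eq_one_iff h₁ h₂ k.2
  have b₁ : Function.Bijective p₁ := by
    refine ⟨(injective_iff_map_eq_one p₁).2 fun k hk => Subtype.ext (Prod.ext hk ((hp k).1 hk)),
      fun g => ?_⟩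
    obtain ⟨k, hk, rfl⟩ := (map_fst_intertwiner hgen₁ hφ).ge (Subgroup.mem_top g)
    exact ⟨⟨k, hk⟩, rfl⟩
  have b₂ : Function.Bijective p₂ := by
    refine ⟨(injective_iff_map_eq_one p₂).2 fun k hk => Subtype.ext (Prod.ext ((hp k).2 hk) hk),
      fun g => ?_⟩
    obtain ⟨k, hk, rfl⟩ := (map_snd_intertwiner hgen₂ hφ).ge (Subgroup.mem_top g)
    exact ⟨⟨k, hk⟩, rfl⟩
  let e₁ := MulEquiv.ofBijective p₁ b₁
  let e₂ := MulEquiv.ofBijective p₂ b₂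
  have hf (k : K) : e₂ (e₁.symm k.1.1) = k.1.2 :=
    congrArg e₂ (e₁.symm_apply_apply k)
  have hmem (k : K) : k.1.1 ∈ H₁ ↔ k.1.2 ∈ H₂ := by
    simpa [hφ.map_one hS₁ hS₂] using k.2 1 hS₁.1 1 hS₁.1
  refine ⟨e₁.symm.trans e₂, fun s hs => hf ⟨(s, φ s), mem_intertwiner_of_mem hφ hs⟩, ?_⟩
  ext g
  obtain ⟨k, rfl⟩ := b₂.2 g
  constructor
  · rintro ⟨x, hx, e⟩
    obtain ⟨l, rfl⟩ := b₁.2 x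
    have e' : p₂ l = p₂ k := (hf l).symm.trans e
    exact e' ▸ (hmem l).1 hx
  · exact fun h => ⟨k.1.1, (hmem k).2 h, hf k⟩
end

section
/- Let G be a finite abelian group. Then the transiso graph Γ_d(G) is complete for every divisor d of |G| if and only if every Sylow subgroup of G is either cyclic or elementary abelian (i.e., for every prime q dividing |G|, a Sylow q-subgroup of G is either cyclic or all of its elements x satisfy x^q = 1). -/
section TransisoQuotient

variable {G : Type*} [CommGroup G]

theorem IsNRT.exists_rep {H : Subgroup G} {S : Set G} (hS : IsNRT H S) :
    ∃ r : G → G, (∀ g, r g ∈ S) ∧ (∀ g, ∃ h ∈ H, g = h * r g) ∧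
      ∀ g s, s ∈ S → (∃ h ∈ H, g = h * s) → s = r g := by
  choose r hr hr' using hS.2
  exact ⟨r, fun g => (hr g).1, fun g => (hr g).2, fun g s hs h => hr' g s ⟨hs, h⟩⟩

/-- In a commutative group, an isomorphism of transversals induces one of quotient groups. -/
theorem TransisoAdj.nonempty_quotient_mulEquiv {H₁ H₂ : Subgroup G} (h : TransisoAdj H₁ H₂) :
    Nonempty (G ⧸ H₁ ≃* G ⧸ H₂) := by
  obtain ⟨S₁, S₂, hS₁, hS₂, φ, hφ, hmul⟩ := h
  obtain ⟨r, hrS, hrH, hru⟩ := hS₁.exists_rep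
  obtain ⟨t, -, htH, htu⟩ := hS₂.exists_rep
  have hr1 : ∀ g ∈ H₁, r g = 1 := fun g hg =>
    (hru g 1 hS₁.1 ⟨g, hg, by simp⟩).symm
  have ht1 : ∀ g ∈ H₂, g ∈ S₂ → g = 1 := fun g hg hgS => by
    rw [htu g g hgS ⟨1, H₂.one_mem, by simp⟩, ← htu g 1 hS₂.1 ⟨g, hg, by simp⟩]
  let ψ : G →* G ⧸ H₂ := MonoidHom.mk' (fun g => (φ (r g) : G ⧸ H₂)) (by
    intro a b
    obtain ⟨ha, ha', hae⟩ := hrH a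
    obtain ⟨hb, hb', hbe⟩ := hrH b
    obtain ⟨c, hc, hce⟩ := hrH (a * b)
    obtain ⟨d, hd, hde⟩ := hmul (r a) (hrS a) (r b) (hrS b) (r (a * b)) (hrS _)
      ⟨(ha * hb)⁻¹ * c, H₁.mul_mem (H₁.inv_mem (H₁.mul_mem ha' hb')) hc, by
        rw [mul_assoc, ← hce, eq_inv_mul_iff_mul_eq, mul_mul_mul_comm, ← hae, ← hbe]⟩
    rw [← QuotientGroup.mk_mul, hde, QuotientGroup.mk_mul, (QuotientGroup.eq_one_iff d).2 hd,
      one_mul])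
  have hψ (g : G) : ψ g = (φ (r g) : G ⧸ H₂) := rfl
  have hφ1 : φ 1 ∈ H₂ := by
    have := ψ.map_one
    rwa [hψ, hr1 1 H₁.one_mem, QuotientGroup.eq_one_iff] at this
  have hker : ψ.ker = H₁ := by
    ext g
    rw [MonoidHom.mem_ker, hψ, QuotientGroup.eq_one_iff]
    constructor
    · intro hg
      have h1 : r g = 1 := hφ.injOn (hrS g) hS₁.1
        ((ht1 _ hg (hφ.mapsTo (hrS g))).trans (ht1 _ hφ1 (hφ.mapsTo hS₁.1)).symm)
      obtain ⟨c, hc, hce⟩ := hrH g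
      rw [hce, h1, mul_one]
      exact hc
    · intro hg
      rwa [hr1 g hg]
  have hsurj : Function.Surjective ψ := by
    intro x
    obtain ⟨g, rfl⟩ := QuotientGroup.mk_surjective x
    obtain ⟨s, hs, hst⟩ := (hS₂.2 g).exists
    obtain ⟨u, hu, rfl⟩ := hφ.surjOn hs
    obtain ⟨c, hc, rfl⟩ := hst
    refine ⟨u, ?_⟩
    rw [hψ, ← hru u u hu ⟨1, H₁.one_mem, by simp⟩, QuotientGroup.mk_mul,
      (QuotientGroup.eq_one_iff c).2 hc, one_mul]
  exact ⟨(QuotientGroup.quotientMulEquivOfEq hker.symm).trans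
    (QuotientGroup.quotientKerEquivOfSurjective ψ hsurj)⟩

theorem exists_normalized_section (H : Subgroup G) :
    ∃ σ : G ⧸ H → G, σ 1 = 1 ∧ ∀ q, (σ q : G ⧸ H) = q := by
  classical
  refine ⟨fun q => if q = 1 then 1 else q.out, by simp, fun q => ?_⟩
  by_cases hq : q = 1 <;> simp [hq]

theorem isNRT_range {H : Subgroup G} {σ : G ⧸ H → G} (h1 : σ 1 = 1)
    (hσ : ∀ q, (σ q : G ⧸ H) = q) : IsNRT H (Set.range σ) := by
  refine ⟨⟨1, h1⟩, fun g => ⟨σ g, ⟨⟨_, rfl⟩, g * (σ g)⁻¹, ?_, by simp⟩, ?_⟩⟩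
  · rw [← QuotientGroup.eq_one_iff, QuotientGroup.mk_mul, QuotientGroup.mk_inv, hσ,
      mul_inv_cancel]
  · rintro _ ⟨⟨q, rfl⟩, h, hh, rfl⟩
    rw [QuotientGroup.mk_mul, (QuotientGroup.eq_one_iff h).2 hh, hσ, one_mul]

theorem transisoAdj_of_quotient_mulEquiv {H₁ H₂ : Subgroup G} (e : G ⧸ H₁ ≃* G ⧸ H₂) :
    TransisoAdj H₁ H₂ := by
  obtain ⟨σ, hσ1, hσ⟩ := exists_normalized_section H₁
  obtain ⟨τ, hτ1, hτ⟩ := exists_normalized_section H₂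
  have hτi : Function.Injective τ := fun a b h => by rw [← hτ a, h, hτ]
  refine ⟨_, _, isNRT_range hσ1 hσ, isNRT_range hτ1 hτ, fun g => τ (e g), ⟨?_, ?_, ?_⟩, ?_⟩
  · exact fun g _ => ⟨_, rfl⟩
  · rintro _ ⟨a, rfl⟩ _ ⟨b, rfl⟩ h
    have h' := e.injective (hτi h)
    rw [hσ, hσ] at h'
    rw [h']
  · rintro _ ⟨q, rfl⟩
    exact ⟨σ (e.symm q), ⟨_, rfl⟩, by simp [hσ]⟩
  · rintro x - y - z - ⟨h, hh, hxy⟩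
    refine ⟨τ (e x) * τ (e y) * (τ (e z))⁻¹, ?_, by simp⟩
    rw [← QuotientGroup.eq_one_iff, QuotientGroup.mk_mul, QuotientGroup.mk_mul,
      QuotientGroup.mk_inv, hτ, hτ, hτ, ← map_mul, ← QuotientGroup.mk_mul, hxy,
      QuotientGroup.mk_mul, (QuotientGroup.eq_one_iff h).2 hh, one_mul, mul_inv_cancel]

theorem transisoAdj_iff {H₁ H₂ : Subgroup G} :
    TransisoAdj H₁ H₂ ↔ Nonempty (G ⧸ H₁ ≃* G ⧸ H₂) :=
  ⟨TransisoAdj.nonempty_quotient_mulEquiv, fun ⟨e⟩ => transisoAdj_of_quotient_mulEquiv e⟩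

end TransisoQuotient

section Sylow

theorem nonempty_linearEquiv_of_natCard_eq {K V W : Type*} [Field K] [Finite K] [AddCommGroup V]
    [AddCommGroup W] [Module K V] [Module K W] [Module.Finite K V] [Module.Finite K W]
    (hcard : Nat.card V = Nat.card W) : Nonempty (V ≃ₗ[K] W) := by
  rw [Module.natCard_eq_pow_finrank (K := K) (V := V),
    Module.natCard_eq_pow_finrank (K := K) (V := W)] at hcard
  exact ⟨LinearEquiv.ofFinrankEq V W (Nat.pow_right_injective Finite.one_lt_card hcard)⟩

theorem nonempty_mulEquiv_of_pow_eq_one {A B : Type*} [CommGroup A] [CommGroup B] [Finite A]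
    [Finite B] {p : ℕ} [hp : Fact p.Prime] (hA : ∀ x : A, x ^ p = 1) (hB : ∀ x : B, x ^ p = 1)
    (hcard : Nat.card A = Nat.card B) : Nonempty (A ≃* B) := by
  let mA : Module (ZMod p) (Additive A) := AddCommGroup.zmodModule hA
  let mB : Module (ZMod p) (Additive B) := AddCommGroup.zmodModule hB
  have fA : Module.Finite (ZMod p) (Additive A) := Module.Finite.of_finite
  have fB : Module.Finite (ZMod p) (Additive B) := Module.Finite.of_finite
  obtain ⟨e⟩ := @nonempty_linearEquiv_of_natCard_eq (ZMod p) (Additive A) (Additive B)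
    _ _ _ _ mA mB fA fB hcard
  exact ⟨MulEquiv.toAdditive.symm e.toAddEquiv⟩

theorem nonempty_pi_sylow_mulEquiv {A : Type*} [CommGroup A] [Finite A] {s : Finset ℕ}
    (hs : s = (Nat.card A).primeFactors) :
    Nonempty ((∀ p : s, ∀ P : Sylow p A, P) ≃* A) := by
  subst hs
  exact ⟨Sylow.directProductOfNormal fun P => inferInstance⟩

theorem nonempty_mulEquiv_of_sylow {A B : Type*} [CommGroup A] [CommGroup B] [Finite A]
    [Finite B] (hcard : Nat.card A = Nat.card B)
    (h : ∀ (q : ℕ) (_ : Fact q.Prime), q ∣ Nat.card A → ∀ (P : Sylow q A) (Q : Sylow q B),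
      Nonempty (P ≃* Q)) : Nonempty (A ≃* B) := by
  obtain ⟨eA⟩ := nonempty_pi_sylow_mulEquiv (A := A) rfl
  obtain ⟨eB⟩ := nonempty_pi_sylow_mulEquiv (A := B) (congrArg _ hcard)
  have key (p : (Nat.card A).primeFactors) :
      Nonempty ((∀ P : Sylow p A, P) ≃* ∀ P : Sylow p B, P) := by
    have hp : Fact (p : ℕ).Prime := ⟨Nat.prime_of_mem_primeFactors p.2⟩
    let := Sylow.unique_of_normal (default : Sylow p A) inferInstance
    let := Sylow.unique_of_normal (default : Sylow p B) inferInstance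
    obtain ⟨e⟩ := h p hp (Nat.dvd_of_mem_primeFactors p.2) default default
    exact ⟨(MulEquiv.piUnique fun P : Sylow p A => P).trans
      (e.trans (MulEquiv.piUnique fun P : Sylow p B => P).symm)⟩
  exact ⟨(eA.symm.trans (MulEquiv.piCongrRight fun p => (key p).some)).trans eB⟩

/-- Being cyclic or of exponent dividing `q` passes from a Sylow subgroup to its image in a
quotient. -/
theorem sylow_map_surjective {G A : Type*} [Group G] [Group A] [Finite G]
    {f : G →* A} (hf : Function.Surjective f) {q : ℕ} [Fact q.Prime] (Q : Sylow q G) :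
    (IsCyclic Q → IsCyclic (Q.mapSurjective hf)) ∧
      ((∀ x : Q, x ^ q = 1) → ∀ x : Q.mapSurjective hf, x ^ q = 1) := by
  have hs : Function.Surjective (f.subgroupMap (Q : Subgroup G)) := f.subgroupMap_surjective _
  constructor
  · intro _
    exact isCyclic_of_surjective (f.subgroupMap (Q : Subgroup G)) hs
  · intro h x
    obtain ⟨y, hy⟩ := hs x
    have := congrArg (f.subgroupMap (Q : Subgroup G)) (h y)
    rw [map_pow, hy, map_one] at this
    exact this

theorem nonempty_quotient_mulEquiv_of_sylow {G : Type*} [CommGroup G] [Finite G]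
    (h : ∀ (q : ℕ) (_ : Fact q.Prime), q ∣ Nat.card G → ∀ Q : Sylow q G,
      IsCyclic Q ∨ ∀ x : Q, x ^ q = 1) {H₁ H₂ : Subgroup G}
    (hcard : Nat.card H₁ = Nat.card H₂) : Nonempty (G ⧸ H₁ ≃* G ⧸ H₂) := by
  have hcard' : Nat.card (G ⧸ H₁) = Nat.card (G ⧸ H₂) := by
    have h1 := H₁.card_eq_card_quotient_mul_card_subgroup
    rw [H₂.card_eq_card_quotient_mul_card_subgroup, hcard] at h1
    exact (Nat.eq_of_mul_eq_mul_right Nat.card_pos h1).symm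
  refine nonempty_mulEquiv_of_sylow hcard' fun q hq hdvd P₁ P₂ => ?_
  have hP : Nat.card P₁ = Nat.card P₂ := by
    rw [P₁.card_eq_multiplicity, P₂.card_eq_multiplicity, hcard']
  let Q : Sylow q G := default
  let := Sylow.unique_of_normal P₁ inferInstance
  let := Sylow.unique_of_normal P₂ inferInstance
  have s₁ := sylow_map_surjective (QuotientGroup.mk'_surjective H₁) Q
  have s₂ := sylow_map_surjective (QuotientGroup.mk'_surjective H₂) Q
  rw [Subsingleton.elim (Q.mapSurjective _) P₁] at s₁
  rw [Subsingleton.elim (Q.mapSurjective _) P₂] at s₂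
  rcases h q hq (hdvd.trans H₁.card_quotient_dvd_card) Q with hc | he
  · have := s₁.1 hc
    have := s₂.1 hc
    exact ⟨mulEquivOfCyclicCardEq hP⟩
  · exact nonempty_mulEquiv_of_pow_eq_one (s₁.2 he) (s₂.2 he) hP

end Sylow

section Converse

theorem exists_primePow_coordinates (G : Type*) [CommGroup G] [Finite G] :
    ∃ (ι : Type) (_ : Fintype ι) (p k : ι → ℕ), (∀ i, (p i).Prime) ∧
      Nonempty (G ≃* Multiplicative (∀ i, ZMod (p i ^ k i))) := by
  classical
  obtain ⟨ι, _, p, hp, k, ⟨e⟩⟩ := AddCommGroup.equiv_directSum_zmod_of_finite (Additive G)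
  exact ⟨ι, inferInstance, p, k, hp,
    ⟨AddEquiv.toMultiplicativeRight (e.trans (DirectSum.addEquivProd _))⟩⟩

theorem not_surjective_cyclic_and_elementary {G : Type*} [CommGroup G] [Finite G]
    (h : ∀ d : ℕ, d ∣ Nat.card G → TransisoComplete G d) {q : ℕ} (hq : q.Prime)
    (f₁ : G →* Multiplicative (ZMod (q ^ 2))) (f₂ : G →* Multiplicative (ZMod q × ZMod q))
    (hf₁ : Function.Surjective f₁) (hf₂ : Function.Surjective f₂) : False := by
  have c₁ : f₁.ker.index = q ^ 2 := by
    rw [Subgroup.index_ker, MonoidHom.range_eq_top.2 hf₁, Subgroup.card_top]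
    exact Nat.card_zmod _
  have c₂ : f₂.ker.index = q ^ 2 := by
    rw [Subgroup.index_ker, MonoidHom.range_eq_top.2 hf₂, Subgroup.card_top]
    change Nat.card (ZMod q × ZMod q) = _
    rw [Nat.card_prod, Nat.card_zmod, sq]
  have hc : Nat.card f₂.ker = Nat.card f₁.ker := by
    have h1 := f₁.ker.card_mul_index
    rw [← f₂.ker.card_mul_index, c₁, c₂] at h1
    exact (Nat.eq_of_mul_eq_mul_right (pow_pos hq.pos 2) h1).symm
  have hE : Nonempty (G ⧸ f₁.ker ≃* G ⧸ f₂.ker) := by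
    by_cases he : f₁.ker = f₂.ker
    · exact ⟨QuotientGroup.quotientMulEquivOfEq he⟩
    · exact transisoAdj_iff.1
        (h _ f₁.ker.card_subgroup_dvd_card f₁.ker f₂.ker rfl hc he)
  obtain ⟨e⟩ := hE
  let E : Multiplicative (ZMod (q ^ 2)) ≃* Multiplicative (ZMod q × ZMod q) :=
    ((QuotientGroup.quotientKerEquivOfSurjective f₁ hf₁).symm.trans e).trans
      (QuotientGroup.quotientKerEquivOfSurjective f₂ hf₂)
  have hpow (x : Multiplicative (ZMod q × ZMod q)) : x ^ q = 1 := by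
    change q • x.toAdd = 0
    ext <;> simp
  have h1 : (Multiplicative.ofAdd (1 : ZMod (q ^ 2))) ^ q = 1 :=
    E.injective (by rw [map_pow, hpow, map_one])
  have h2 : ((q : ℕ) : ZMod (q ^ 2)) = 0 := by
    have : q • (1 : ZMod (q ^ 2)) = 0 := h1
    simpa using this
  rw [ZMod.natCast_eq_zero_iff] at h2
  have := Nat.le_of_dvd hq.pos h2
  nlinarith [hq.two_le]

theorem sylow_of_transisoComplete {G : Type*} [CommGroup G] [Finite G]
    (h : ∀ d : ℕ, d ∣ Nat.card G → TransisoComplete G d) (q : ℕ) (hq : Fact q.Prime)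
    (Q : Sylow q G) : IsCyclic Q ∨ ∀ x : Q, x ^ q = 1 := by
  classical
  obtain ⟨ι, _, p, k, hp, ⟨e⟩⟩ := exists_primePow_coordinates G
  let π (i : ι) : G →* Multiplicative (ZMod (p i ^ k i)) :=
    (AddMonoidHom.toMultiplicative (Pi.evalAddMonoidHom _ i)).comp e.toMonoidHom
  have hπ (z : ∀ i, ZMod (p i ^ k i)) (i : ι) :
      π i (e.symm (Multiplicative.ofAdd z)) = Multiplicative.ofAdd (z i) := by
    simp [π]
  have hext (x : G) (hx : ∀ i, π i x = 1) : x = 1 := by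
    apply e.injective
    rw [map_one]
    exact funext hx
  have hcard (i : ι) (y : Multiplicative (ZMod (p i ^ k i))) : y ^ (p i ^ k i) = 1 := by
    change (p i ^ k i) • y.toAdd = 0
    simp
  have hne (x : Q) (i : ι) (hi : p i ≠ q) : π i x = 1 := by
    obtain ⟨n, hn⟩ := Q.2 x
    have h1 : π i x ^ (q ^ n) = 1 := by
      rw [← map_pow, ← Subgroup.coe_pow, hn, Subgroup.coe_one, map_one]
    have hcop : Nat.Coprime (q ^ n) (p i ^ k i) :=
      Nat.Coprime.pow _ _ ((Nat.coprime_primes hq.out (hp i)).2 hi.symm)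
    have := pow_gcd_eq_one.2 ⟨h1, hcard i (π i x)⟩
    rwa [hcop, pow_one] at this
  by_contra hcon
  rw [not_or] at hcon
  obtain ⟨hcyc, hel⟩ := hcon
  have hbig : ∃ i, p i = q ∧ 2 ≤ k i := by
    by_contra! hno
    refine hel fun x => Subtype.ext (hext _ fun i => ?_)
    rw [Subgroup.coe_pow, map_pow]
    by_cases hi : p i = q
    · have hk : k i ≤ 1 := by have := hno i hi; omega
      have hd : p i ^ k i ∣ q := by
        simpa [hi] using pow_dvd_pow q hk
      exact orderOf_dvd_iff_pow_eq_one.1 ((orderOf_dvd_of_pow_eq_one (hcard i _)).trans hd)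
    · rw [hne x i hi, one_pow]
  obtain ⟨i, hi, hki⟩ := hbig
  have htwo : ∃ j, j ≠ i ∧ p j = q ∧ 1 ≤ k j := by
    by_contra! hno
    refine hcyc (isCyclic_of_injective ((π i).comp (Q : Subgroup G).subtype) ?_)
    rw [injective_iff_map_eq_one]
    refine fun x hx => Subtype.ext (hext _ fun j => ?_)
    by_cases hj : p j = q
    · by_cases hji : j = i
      · subst hji; exact hx
      · have hk : k j = 0 := by have := hno j hji hj; omega
        have := hcard j (π j x)
        have h1 : p j ^ k j = 1 := by rw [hk, pow_zero]
        exact (pow_one _).symm.trans ((congrArg (π j x ^ ·) h1).symm.trans this)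
    · exact hne x j hj
  obtain ⟨j, hji, hj, hkj⟩ := htwo
  have d₁ : q ^ 2 ∣ p i ^ k i := by rw [hi]; exact pow_dvd_pow q hki
  have d₂ : q ∣ p i ^ k i := (dvd_pow_self q two_ne_zero).trans d₁
  have d₃ : q ∣ p j ^ k j := by rw [hj]; exact dvd_pow_self q (by omega)
  let f₁ := (AddMonoidHom.toMultiplicative
    (ZMod.castHom d₁ (ZMod (q ^ 2))).toAddMonoidHom).comp (π i)
  let z : (∀ i, ZMod (p i ^ k i)) →+ ZMod q × ZMod q :=
    ((ZMod.castHom d₂ (ZMod q)).toAddMonoidHom.comp (Pi.evalAddMonoidHom _ i)).prod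
      ((ZMod.castHom d₃ (ZMod q)).toAddMonoidHom.comp (Pi.evalAddMonoidHom _ j))
  let f₂ := (AddMonoidHom.toMultiplicative z).comp e.toMonoidHom
  refine not_surjective_cyclic_and_elementary h hq.out f₁ f₂ ?_ ?_
  · intro y
    obtain ⟨w, hw⟩ := ZMod.castHom_surjective d₁ y.toAdd
    refine ⟨e.symm (Multiplicative.ofAdd (Pi.single i w)), ?_⟩
    change Multiplicative.ofAdd (ZMod.castHom d₁ (ZMod (q ^ 2)) (π i _).toAdd) = y
    rw [hπ, toAdd_ofAdd, Pi.single_eq_same, hw, ofAdd_toAdd]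
  · intro y
    obtain ⟨w₁, hw₁⟩ := ZMod.castHom_surjective d₂ y.toAdd.1
    obtain ⟨w₂, hw₂⟩ := ZMod.castHom_surjective d₃ y.toAdd.2
    refine ⟨e.symm (Multiplicative.ofAdd (Pi.single i w₁ + Pi.single j w₂)), ?_⟩
    have hz : z (Pi.single i w₁ + Pi.single j w₂) = y.toAdd := by
      refine Prod.ext ?_ ?_
      · change ZMod.castHom d₂ (ZMod q) ((Pi.single i w₁ + Pi.single j w₂ : ∀ l, ZMod (p l ^ k l)) i) = _
        rw [Pi.add_apply, Pi.single_eq_same, Pi.single_eq_of_ne hji.symm, add_zero, hw₁]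
      · change ZMod.castHom d₃ (ZMod q) ((Pi.single i w₁ + Pi.single j w₂ : ∀ l, ZMod (p l ^ k l)) j) = _
        rw [Pi.add_apply, Pi.single_eq_same, Pi.single_eq_of_ne hji, zero_add, hw₂]
    change Multiplicative.ofAdd (z (e (e.symm _)).toAdd) = y
    rw [MulEquiv.apply_symm_apply, toAdd_ofAdd, hz, ofAdd_toAdd]

end Converse

theorem stmt_3 {G : Type*} [Group G] [Finite G] (hcomm : ∀ a b : G, a * b = b * a) :
    (∀ d : ℕ, d ∣ Nat.card G → TransisoComplete G d) ↔
      (∀ (q : ℕ) (_ : Fact q.Prime), q ∣ Nat.card G → ∀ Q : Sylow q G,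
        IsCyclic (Q : Subgroup G) ∨ ∀ x : (Q : Subgroup G), x ^ q = 1) := by
  let _ : CommGroup G := { ‹Group G› with mul_comm := hcomm }
  exact ⟨fun h q hq _ Q => sylow_of_transisoComplete h q hq Q,
    fun h d _ H₁ H₂ h₁ h₂ _ =>
      transisoAdj_iff.2 (nonempty_quotient_mulEquiv_of_sylow h (h₁.trans h₂.symm))⟩
end

section
/- Let p be a prime and G a finite elementary abelian p-group (an abelian group with x^p = 1 for all x ∈ G). Then the transiso graph Γ_d(G) is complete for each divisor d of |G|. -/
theorem isNRT_of_isComplement {G : Type*} [Group G] {H K : Subgroup G}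
    (h : Subgroup.IsComplement' H K) : IsNRT H (K : Set G) := by
  refine ⟨K.one_mem, fun g => ?_⟩
  obtain ⟨⟨a, b⟩, hab, huniq⟩ := h.existsUnique g
  refine ⟨b, ⟨b.2, a, a.2, hab.symm⟩, ?_⟩
  rintro s ⟨hs, t, ht, hg⟩
  have := huniq (⟨t, ht⟩, ⟨s, hs⟩) hg.symm
  exact congrArg (fun x => (x.2 : G)) this

theorem transisoAdj_of_isComplement {G : Type*} [Group G] {H₁ H₂ K₁ K₂ : Subgroup G}
    (h₁ : Subgroup.IsComplement' H₁ K₁) (h₂ : Subgroup.IsComplement' H₂ K₂) (e : K₁ ≃* K₂) :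
    TransisoAdj H₁ H₂ := by
  classical
  obtain ⟨φ, hφ⟩ : ∃ φ : G → G, ∀ x : K₁, φ x = e x :=
    ⟨fun g => if h : g ∈ K₁ then (e ⟨g, h⟩ : G) else 1, fun x => by simp⟩
  refine ⟨K₁, K₂, isNRT_of_isComplement h₁, isNRT_of_isComplement h₂, φ, ⟨?_, ?_, ?_⟩, ?_⟩
  · intro x hx
    rw [hφ ⟨x, hx⟩]
    exact (e ⟨x, hx⟩).2
  · intro x hx y hy hxy
    rw [hφ ⟨x, hx⟩, hφ ⟨y, hy⟩] at hxy
    exact congrArg Subtype.val (e.injective (Subtype.ext hxy))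
  · intro y hy
    exact ⟨e.symm ⟨y, hy⟩, (e.symm ⟨y, hy⟩).2, by rw [hφ, e.apply_symm_apply]⟩
  · rintro x hx y hy z hz ⟨t, ht, hxyz⟩
    have htK : t ∈ K₁ := by
      rw [← mul_inv_eq_iff_eq_mul.mpr hxyz]
      exact K₁.mul_mem (K₁.mul_mem hx hy) (K₁.inv_mem hz)
    obtain rfl : t = 1 := Subgroup.disjoint_def.mp h₁.disjoint ht htK
    refine ⟨1, H₂.one_mem, ?_⟩
    have hmul : (⟨x, hx⟩ * ⟨y, hy⟩ : K₁) = ⟨z, hz⟩ := Subtype.ext (by simpa using hxyz)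
    rw [hφ ⟨x, hx⟩, hφ ⟨y, hy⟩, hφ ⟨z, hz⟩, one_mul, ← hmul, map_mul, Subgroup.coe_mul]

theorem isComplement'_of_isCompl_toZModSubmodule {G : Type*} [CommGroup G] {p : ℕ}
    [Module (ZMod p) (Additive G)] {H : Subgroup G} {C : Submodule (ZMod p) (Additive G)}
    (h : IsCompl (AddSubgroup.toZModSubmodule p H.toAddSubgroup) C) :
    Subgroup.IsComplement' H (AddSubgroup.toSubgroup' C.toAddSubgroup) := by
  refine Subgroup.isComplement'_of_disjoint_and_mul_eq_univ ?_ ?_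
  · rw [Subgroup.disjoint_def]
    intro x hx hxC
    exact Submodule.disjoint_def.mp h.disjoint (Additive.ofMul x) hx hxC
  · refine Set.eq_univ_of_forall fun g => ?_
    obtain ⟨a, ha, b, hb, hab⟩ := Submodule.mem_sup.mp
      (h.sup_eq_top ▸ Submodule.mem_top : Additive.ofMul g ∈ _ ⊔ C)
    exact ⟨a.toMul, ha, b.toMul, hb, hab⟩

theorem transisoAdj_of_card_eq {G : Type*} [CommGroup G] [Finite G] {p : ℕ} [Fact p.Prime]
    (hexp : ∀ x : G, x ^ p = 1) {H₁ H₂ : Subgroup G} (hcard : Nat.card H₁ = Nat.card H₂) :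
    TransisoAdj H₁ H₂ := by
  let _ : Module (ZMod p) (Additive G) := AddCommGroup.zmodModule (n := p) hexp
  let W (H : Subgroup G) : Submodule (ZMod p) (Additive G) :=
    AddSubgroup.toZModSubmodule p H.toAddSubgroup
  obtain ⟨C₁, hC₁⟩ := exists_isCompl (W H₁)
  obtain ⟨C₂, hC₂⟩ := exists_isCompl (W H₂)
  have hW (H : Subgroup G) : Nat.card H = p ^ Module.finrank (ZMod p) (W H) := by
    have := Module.natCard_eq_pow_finrank (K := ZMod p) (V := W H)
    rwa [Nat.card_zmod] at this
  have hfin : Module.finrank (ZMod p) (W H₁) = Module.finrank (ZMod p) (W H₂) :=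
    Nat.pow_right_injective (Fact.out : p.Prime).two_le
      ((hW H₁).symm.trans (hcard.trans (hW H₂)))
  have hdim₁ := Submodule.finrank_add_eq_of_isCompl hC₁
  have hdim₂ := Submodule.finrank_add_eq_of_isCompl hC₂
  have e : C₁ ≃ₗ[ZMod p] C₂ := LinearEquiv.ofFinrankEq _ _ (by omega)
  exact transisoAdj_of_isComplement (isComplement'_of_isCompl_toZModSubmodule hC₁)
    (isComplement'_of_isCompl_toZModSubmodule hC₂)
    { toFun := fun x => e x
      invFun := fun x => e.symm x
      left_inv := e.left_inv
      right_inv := e.right_inv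
      map_mul' := e.map_add }

theorem stmt_4 {G : Type*} [Group G] [Finite G] (p : ℕ) (hp : p.Prime)
    (hcomm : ∀ a b : G, a * b = b * a) (hexp : ∀ x : G, x ^ p = 1) :
    ∀ d : ℕ, d ∣ Nat.card G → TransisoComplete G d := by
  intro d _ H₁ H₂ h₁ h₂ _
  have : Fact p.Prime := ⟨hp⟩
  let _ : CommGroup G := { ‹Group G› with mul_comm := hcomm }
  exact transisoAdj_of_card_eq hexp (h₁.trans h₂.symm)
end

section
/- Let n ≥ 1 and let D_{2n} denote the dihedral group of order 2n. Then the transiso graph Γ_d(D_{2n}) is complete for each divisor d of 2n. -/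
theorem IsNRT.of_isComplement {G : Type*} [Group G] {H : Subgroup G} {S : Set G}
    (h : Subgroup.IsComplement (H : Set G) S) (h1 : (1 : G) ∈ S) : IsNRT H S := by
  refine ⟨h1, fun g => ?_⟩
  obtain ⟨⟨a, s⟩, hg, huniq⟩ := Subgroup.isComplement_iff_existsUnique.mp h g
  refine ⟨s, ⟨s.2, a, a.2, hg.symm⟩, ?_⟩
  rintro t ⟨ht, b, hb, hbt⟩
  exact congrArg (fun x => (x.2 : G)) (huniq (⟨b, hb⟩, ⟨t, ht⟩) hbt.symm)

theorem TransisoAdj.symm {G : Type*} [Group G] {H₁ H₂ : Subgroup G} (h : TransisoAdj H₁ H₂) :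
    TransisoAdj H₂ H₁ := by
  obtain ⟨S₁, S₂, h₁, h₂, φ, hφ, hmul⟩ := h
  have hinv := hφ.invOn_invFunOn
  refine ⟨S₂, S₁, h₂, h₁, Function.invFunOn φ S₁, hφ.symm hinv.symm, ?_⟩
  intro x hx y hy z hz hxyz
  obtain ⟨a, ha, rfl⟩ := hφ.surjOn hx
  obtain ⟨b, hb, rfl⟩ := hφ.surjOn hy
  obtain ⟨c, hc, rfl⟩ := hφ.surjOn hz
  rw [hinv.1 ha, hinv.1 hb, hinv.1 hc]
  obtain ⟨w, ⟨hw, habw⟩, -⟩ := h₁.2 (a * b)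
  have hwc : φ w = φ c := (h₂.2 (φ a * φ b)).unique
    ⟨hφ.mapsTo hw, hmul a ha b hb w hw habw⟩ ⟨hφ.mapsTo hc, hxyz⟩
  rwa [← hφ.injOn hw hc hwc]

/-- A homomorphism that pulls `H₂` back to `H₁` carries any NRT of `H₁` isomorphically onto an
NRT of `H₂`, provided that the two subgroups have the same order. -/
theorem TransisoAdj.of_comap_eq {G : Type*} [Group G] [Finite G] {H₁ H₂ : Subgroup G} (φ : G →* G)
    (hcomap : ∀ g, φ g ∈ H₂ ↔ g ∈ H₁) (hcard : Nat.card H₁ = Nat.card H₂) :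
    TransisoAdj H₁ H₂ := by
  obtain ⟨S, hS, h1⟩ := H₁.exists_isComplement_right 1
  have hNRT := IsNRT.of_isComplement hS h1
  have hcoset : ∀ s ∈ S, ∀ t ∈ S, ∀ h ∈ H₂, φ s = h * φ t → s = t := by
    intro s hs t ht h hh hst
    refine (hNRT.2 s).unique ⟨hs, 1, H₁.one_mem, by simp⟩ ⟨ht, s * t⁻¹, ?_, by simp⟩
    rw [← hcomap, map_mul, map_inv, hst]
    simpa using hh
  have hinj : Set.InjOn φ S := fun s hs t ht hst =>
    hcoset s hs t ht 1 H₂.one_mem (by simpa using hst)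
  have hS₂ : Subgroup.IsComplement (H₂ : Set G) (φ '' S) := by
    refine (Nat.bijective_iff_injective_and_card _).mpr ⟨?_, ?_⟩
    · rintro ⟨⟨a, ha⟩, ⟨_, s, hs, rfl⟩⟩ ⟨⟨b, hb⟩, ⟨_, t, ht, rfl⟩⟩ hst
      have hst : a * φ s = b * φ t := hst
      obtain rfl := hcoset s hs t ht (a⁻¹ * b) (H₂.mul_mem (H₂.inv_mem ha) hb)
        (by rw [mul_assoc, ← hst, inv_mul_cancel_left])
      simpa using hst
    · rw [Nat.card_prod, Nat.card_image_of_injOn hinj, ← Nat.card_eq_of_bijective _ hS,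
        Nat.card_prod]
      exact congrArg (· * _) hcard.symm
  refine ⟨S, φ '' S, hNRT, IsNRT.of_isComplement hS₂ ⟨1, h1, map_one φ⟩, φ,
    hinj.bijOn_image, ?_⟩
  rintro x - y - z - ⟨h, hh, hxy⟩
  exact ⟨φ h, (hcomap h).mpr hh, by rw [← map_mul, hxy, map_mul]⟩

/-- A subgroup of order `m` of a finite cyclic group consists of all elements killed by `m`. -/
theorem AddSubgroup.mem_iff_card_nsmul_eq_zero {A : Type*} [AddGroup A] [Finite A] [IsAddCyclic A]
    (R : AddSubgroup A) (x : A) : x ∈ R ↔ Nat.card R • x = 0 := by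
  classical
  have := Fintype.ofFinite A
  have hsub : (R : Set A).toFinset ⊆ {a : A | Nat.card R • a = 0}.toFinset := by
    intro a ha
    rw [Set.mem_toFinset] at ha ⊢
    exact congrArg Subtype.val (card_nsmul_eq_zero' (x := (⟨a, ha⟩ : R)))
  have heq := Finset.eq_of_subset_of_card_le hsub <| by
    have := IsAddCyclic.card_nsmul_eq_zero_le (α := A) (n := Nat.card R) Nat.card_pos
    rw [← Set.ncard_eq_toFinset_card' (R : Set A)]
    convert this using 1
    · congr 1
      ext; simp
    · exact (Nat.card_coe_set_eq _).symm
  simpa using congrArg (x ∈ ·) heq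

namespace DihedralGroup

variable {n : ℕ}

/-- The endomorphism of the dihedral group with `r j ↦ r (e * j)` and `sr j ↦ sr (e * j + c)`. -/
def affineHom (e c : ZMod n) : DihedralGroup n →* DihedralGroup n :=
  MonoidHom.mk' (fun
    | r j => r (e * j)
    | sr j => sr (e * j + c)) <| by
    rintro (i | i) (j | j) <;> simp <;> ring

@[simp]
theorem affineHom_r (e c j : ZMod n) : affineHom e c (r j) = r (e * j) := rfl

@[simp]
theorem affineHom_sr (e c j : ZMod n) : affineHom e c (sr j) = sr (e * j + c) := rfl

/-- The exponents of the rotations in a subgroup of the dihedral group. -/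
def rotations (H : Subgroup (DihedralGroup n)) : AddSubgroup (ZMod n) where
  carrier := {j | r j ∈ H}
  zero_mem' := H.one_mem
  add_mem' ha hb := by simpa using H.mul_mem ha hb
  neg_mem' ha := by simpa using H.inv_mem ha

theorem mem_rotations {H : Subgroup (DihedralGroup n)} {j : ZMod n} :
    j ∈ rotations H ↔ r j ∈ H := Iff.rfl

theorem sr_mem_iff {H : Subgroup (DihedralGroup n)} {i : ZMod n} (hi : sr i ∈ H) (j : ZMod n) :
    sr j ∈ H ↔ j - i ∈ rotations H := by
  rw [mem_rotations, ← sr_mul_sr, H.mul_mem_cancel_left hi]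

theorem card_of_forall_sr_notMem {H : Subgroup (DihedralGroup n)} (h : ∀ i, sr i ∉ H) :
    Nat.card H = Nat.card (rotations H) := by
  refine (Nat.card_eq_of_bijective
    (fun j : rotations H => (⟨r j, j.2⟩ : H)) ⟨fun a b hab => ?_, ?_⟩).symm
  · exact Subtype.ext (r.inj (congrArg Subtype.val hab))
  · rintro ⟨j | j, hj⟩
    · exact ⟨⟨j, hj⟩, rfl⟩
    · exact absurd hj (h j)

theorem card_of_sr_mem [NeZero n] {H : Subgroup (DihedralGroup n)} {i : ZMod n} (hi : sr i ∈ H) :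
    Nat.card H = 2 * Nat.card (rotations H) := by
  have hbij : Function.Bijective (Sum.elim (fun j : rotations H => (⟨r j, j.2⟩ : H))
      (fun j : rotations H => ⟨sr (j + i), (sr_mem_iff hi _).mpr (by simp)⟩)) := by
    constructor
    · rintro (a | a) (b | b) hab <;> simp [← SetLike.coe_eq_coe] at hab
      · rw [Subtype.ext hab]
      · rw [Subtype.ext hab]
    · rintro ⟨j | j, hj⟩
      · exact ⟨Sum.inl ⟨j, hj⟩, rfl⟩
      · exact ⟨Sum.inr ⟨j - i, (sr_mem_iff hi j).mp hj⟩, by simp⟩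
  rw [← Nat.card_eq_of_bijective _ hbij, Nat.card_sum, two_mul]

theorem transisoAdj_of_sr_mem [NeZero n] {H₁ H₂ : Subgroup (DihedralGroup n)}
    (hcard : Nat.card H₁ = Nat.card H₂) {i₁ i₂ : ZMod n} (h₁ : sr i₁ ∈ H₁) (h₂ : sr i₂ ∈ H₂) :
    TransisoAdj H₁ H₂ := by
  have hrot : ∀ j, j ∈ rotations H₂ ↔ j ∈ rotations H₁ := by
    have := card_of_sr_mem h₁
    have := card_of_sr_mem h₂
    have : Nat.card (rotations H₁) = Nat.card (rotations H₂) := by omega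
    intro j
    rw [AddSubgroup.mem_iff_card_nsmul_eq_zero, AddSubgroup.mem_iff_card_nsmul_eq_zero, this]
  refine .of_comap_eq (affineHom 1 (i₂ - i₁)) ?_ hcard
  rintro (j | j)
  · simpa [mem_rotations] using hrot j
  · rw [affineHom_sr, sr_mem_iff h₁, sr_mem_iff h₂, hrot]
    ring_nf

theorem transisoAdj_of_forall_sr_notMem_of_sr_mem [NeZero n] {H₁ H₂ : Subgroup (DihedralGroup n)}
    (hcard : Nat.card H₁ = Nat.card H₂) (h₁ : ∀ i, sr i ∉ H₁) {i : ZMod n} (h₂ : sr i ∈ H₂) :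
    TransisoAdj H₁ H₂ := by
  have hrot : Nat.card (rotations H₁) = 2 * Nat.card (rotations H₂) := by
    rw [← card_of_forall_sr_notMem h₁, ← card_of_sr_mem h₂, hcard]
  refine .of_comap_eq (affineHom 2 (i + 1)) ?_ hcard
  rintro (j | j)
  · rw [affineHom_r, ← mem_rotations, ← mem_rotations, AddSubgroup.mem_iff_card_nsmul_eq_zero,
      AddSubgroup.mem_iff_card_nsmul_eq_zero, hrot]
    simp only [nsmul_eq_mul]
    push_cast
    ring_nf
  · refine iff_of_false ?_ (h₁ j)
    rw [affineHom_sr, sr_mem_iff h₂, AddSubgroup.mem_iff_card_nsmul_eq_zero]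
    obtain ⟨k, rfl⟩ := ZMod.intCast_surjective j
    have hdvd : 2 * Nat.card (rotations H₂) ∣ n := by
      simpa [hrot] using (rotations H₁).card_addSubgroup_dvd_card
    have hpos : 0 < Nat.card (rotations H₂) := Nat.card_pos
    generalize Nat.card (rotations H₂) = m at *
    intro h
    have hn : (n : ℤ) ∣ m * (2 * k + 1) := by
      rw [← ZMod.intCast_zmod_eq_zero_iff_dvd]
      push_cast
      rw [← h, nsmul_eq_mul]
      ring
    have hm : (m : ℤ) * 2 ∣ m * (2 * k + 1) :=
      (by exact_mod_cast mul_comm 2 m ▸ hdvd : (m : ℤ) * 2 ∣ n).trans hn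
    have := Int.dvd_of_mul_dvd_mul_left (by positivity) hm
    omega

end DihedralGroup

open DihedralGroup in
theorem stmt_5 (n : ℕ) (hn : 1 ≤ n) :
    ∀ d : ℕ, d ∣ 2 * n → TransisoComplete (DihedralGroup n) d := by
  have : NeZero n := ⟨by omega⟩
  intro d _ H₁ H₂ hd₁ hd₂ _
  have hcard : Nat.card H₁ = Nat.card H₂ := hd₁.trans hd₂.symm
  by_cases h₁ : ∃ i, sr i ∈ H₁ <;> by_cases h₂ : ∃ i, sr i ∈ H₂
  · exact transisoAdj_of_sr_mem hcard h₁.choose_spec h₂.choose_spec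
  · exact (transisoAdj_of_forall_sr_notMem_of_sr_mem hcard.symm (not_exists.mp h₂)
      h₁.choose_spec).symm
  · exact transisoAdj_of_forall_sr_notMem_of_sr_mem hcard (not_exists.mp h₁) h₂.choose_spec
  · rw [not_exists] at h₁ h₂
    refine .of_comap_eq (MonoidHom.id _) ?_ hcard
    rintro (j | j)
    · rw [MonoidHom.id_apply, ← mem_rotations, ← mem_rotations,
        AddSubgroup.mem_iff_card_nsmul_eq_zero, AddSubgroup.mem_iff_card_nsmul_eq_zero,
        ← card_of_forall_sr_notMem h₁, ← card_of_forall_sr_notMem h₂, hcard]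
    · exact iff_of_false (h₂ j) (h₁ j)
end

section
/- Let p be an odd prime and let G be a non-abelian group of order p³ of exponent p (i.e., g^p = 1 for all g ∈ G). Then the transiso graph Γ_d(G) is complete for every divisor d of p³. -/
/-- Some NRT of `H` is, with its induced operation, a copy of the group `N`; here `f`
enumerates the NRT. -/
def HasNRTModel {G : Type*} [Group G] (H : Subgroup G) (N : Type*) [Group N] : Prop :=
  ∃ f : N → G, f 1 = 1 ∧ (∀ a b, ∃ h ∈ H, f a * f b = h * f (a * b)) ∧
    ∀ g : G, ∃! n, ∃ h ∈ H, g = h * f n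

theorem isNRT_range_s6 {G N : Type*} [Group G] [Group N] {H : Subgroup G} {f : N → G}
    (h1 : f 1 = 1) (hu : ∀ g : G, ∃! n, ∃ h ∈ H, g = h * f n) : IsNRT H (Set.range f) := by
  refine ⟨⟨1, h1⟩, fun g => ?_⟩
  obtain ⟨n, hn, hn'⟩ := hu g
  refine ⟨f n, ⟨⟨n, rfl⟩, hn⟩, ?_⟩
  rintro _ ⟨⟨m, rfl⟩, hm⟩
  rw [hn' m hm]

theorem injective_of_existsUnique_mul {G N : Type*} [Group G] {H : Subgroup G}
    {f : N → G} (hu : ∀ g : G, ∃! n, ∃ h ∈ H, g = h * f n) : Function.Injective f := by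
  intro a b hab
  exact (hu (f a)).unique ⟨1, H.one_mem, by simp⟩ ⟨1, H.one_mem, by simp [hab]⟩

theorem HasNRTModel.transisoAdj {G N : Type*} [Group G] [Group N] {H₁ H₂ : Subgroup G}
    (m₁ : HasNRTModel H₁ N) (m₂ : HasNRTModel H₂ N) : TransisoAdj H₁ H₂ := by
  obtain ⟨f₁, h11, hm1, hu1⟩ := m₁
  obtain ⟨f₂, h12, hm2, hu2⟩ := m₂
  have i1 := injective_of_existsUnique_mul hu1
  have i2 := injective_of_existsUnique_mul hu2
  have hinv : ∀ n, Function.invFun f₁ (f₁ n) = n := Function.leftInverse_invFun i1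
  refine ⟨Set.range f₁, Set.range f₂, isNRT_range_s6 h11 hu1, isNRT_range_s6 h12 hu2,
    fun g => f₂ (Function.invFun f₁ g), ⟨?_, ?_, ?_⟩, ?_⟩
  · rintro _ ⟨n, rfl⟩
    exact ⟨_, rfl⟩
  · rintro _ ⟨n, rfl⟩ _ ⟨m, rfl⟩ h
    simp only [hinv] at h
    rw [i2 h]
  · rintro _ ⟨n, rfl⟩
    exact ⟨f₁ n, ⟨n, rfl⟩, by simp only [hinv]⟩
  · rintro _ ⟨a, rfl⟩ _ ⟨b, rfl⟩ _ ⟨c, rfl⟩ h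
    simp only [hinv]
    rw [(hu1 (f₁ a * f₁ b)).unique h (hm1 a b)]
    exact hm2 a b

theorem HasNRTModel.congr {G M N : Type*} [Group G] [Group M] [Group N] {H : Subgroup G}
    (m : HasNRTModel H M) (e : N ≃* M) : HasNRTModel H N := by
  obtain ⟨f, h1, hm, hu⟩ := m
  refine ⟨f ∘ e, by simp [h1], fun a b => by simpa using hm (e a) (e b), fun g => ?_⟩
  obtain ⟨n, hn, hn'⟩ := hu g
  refine ⟨e.symm n, by simpa using hn, fun k hk => ?_⟩
  rw [← hn' (e k) hk, e.symm_apply_apply]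

theorem hasNRTModel_quotient {G : Type*} [Group G] (H : Subgroup G) [H.Normal] :
    HasNRTModel H (G ⧸ H) := by
  classical
  let f : G ⧸ H → G := fun q => if q = 1 then 1 else q.out
  have hf : ∀ q, (f q : G ⧸ H) = q := by
    intro q
    by_cases h : q = 1 <;> simp [f, h]
  have key : ∀ (g : G) (q : G ⧸ H), (∃ h ∈ H, g = h * f q) ↔ q = g := by
    intro g q
    constructor
    · rintro ⟨h, hh, rfl⟩
      rw [QuotientGroup.mk_mul, (QuotientGroup.eq_one_iff h).2 hh, hf, one_mul]
    · rintro rfl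
      refine ⟨g * (f g)⁻¹, ?_, by group⟩
      rw [← QuotientGroup.eq_one_iff, QuotientGroup.mk_mul, QuotientGroup.mk_inv, hf,
        mul_inv_cancel]
  refine ⟨f, by simp [f], fun a b => ?_, fun g => ⟨g, (key g g).2 rfl, fun q => (key g q).1⟩⟩
  rw [key, QuotientGroup.mk_mul, hf, hf]

theorem Subgroup.IsComplement'.hasNRTModel {G : Type*} [Group G] {H K : Subgroup G}
    (hc : H.IsComplement' K) : HasNRTModel H K := by
  refine ⟨fun k => k, rfl, fun a b => ⟨1, H.one_mem, by simp⟩, fun g => ?_⟩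
  obtain ⟨⟨h, k⟩, hk, hu⟩ := hc.existsUnique g
  refine ⟨k, ⟨h, h.2, hk.symm⟩, ?_⟩
  rintro k' ⟨h', hh', e⟩
  exact congrArg Prod.snd (hu (⟨h', hh'⟩, k') e.symm)

theorem nonempty_mulEquiv_of_pow_prime_eq_one {A : Type*} [Group A] {p k : ℕ} (hp : p.Prime)
    (hcomm : ∀ a b : A, a * b = b * a) (hexp : ∀ a : A, a ^ p = 1)
    (hcard : Nat.card A = p ^ k) :
    Nonempty (Multiplicative (Fin k → ZMod p) ≃* A) := by
  let : CommGroup A := { (inferInstance : Group A) with mul_comm := hcomm }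
  have := Fact.mk hp
  let : Module (ZMod p) (Additive A) :=
    AddCommGroup.zmodModule (n := p) (fun a => congrArg Additive.ofMul (hexp a.toMul))
  have : Finite A := Nat.finite_of_card_ne_zero (by rw [hcard]; exact pow_ne_zero _ hp.ne_zero)
  have : Module.Finite (ZMod p) (Additive A) := Module.Finite.of_finite
  have h := Module.natCard_eq_pow_finrank (K := ZMod p) (V := Additive A)
  have hr : Module.finrank (ZMod p) (Additive A) = k := by
    rw [Nat.card_zmod, show Nat.card (Additive A) = p ^ k from hcard] at h
    exact (Nat.pow_right_injective hp.two_le h).symm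
  have e : (Fin k → ZMod p) ≃ₗ[ZMod p] Additive A :=
    LinearEquiv.ofFinrankEq _ _ (by simp [hr])
  exact ⟨AddEquiv.toMultiplicativeLeft e.toAddEquiv⟩

theorem Group.commute_of_card_eq_prime_sq {A : Type*} [Group A] {p : ℕ} (hp : p.Prime)
    (hcard : Nat.card A = p ^ 2) (a b : A) : a * b = b * a := by
  have := Fact.mk hp
  exact (IsPGroup.isMulCommutative_of_card_eq_prime_sq hcard).is_comm.comm a b

theorem Subgroup.card_centralizer_singleton_of_card_eq_prime_cube {G : Type*} [Group G] {p : ℕ}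
    (hp : p.Prime) (hcard : Nat.card G = p ^ 3) {x : G} (hx : x ∉ Subgroup.center G) :
    Nat.card (Subgroup.centralizer {x}) = p ^ 2 := by
  have := Fact.mk hp
  have : Finite G := Nat.finite_of_card_ne_zero (by rw [hcard]; exact pow_ne_zero _ hp.ne_zero)
  have hG : IsPGroup p G := IsPGroup.of_card hcard
  have : Nontrivial G := ⟨x, 1, fun h => hx (h ▸ one_mem _)⟩
  have hZ := hG.center_nontrivial
  have hlt : Subgroup.center G < Subgroup.centralizer {x} :=
    lt_of_le_of_ne (Subgroup.center_le_centralizer _) fun h =>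
      hx (h ▸ Subgroup.mem_centralizer_singleton_iff.2 rfl)
  have hne : Subgroup.centralizer {x} ≠ ⊤ := fun h => hx <| by
    rw [Subgroup.mem_center_iff]
    intro g
    exact Subgroup.mem_centralizer_singleton_iff.1 (h ▸ Subgroup.mem_top g)
  obtain ⟨i, hi, hci⟩ := (Nat.dvd_prime_pow hp).1
    (hcard ▸ Subgroup.card_subgroup_dvd_card (Subgroup.centralizer {x}))
  obtain ⟨j, hj, hcj⟩ := (Nat.dvd_prime_pow hp).1
    (hcard ▸ Subgroup.card_subgroup_dvd_card (Subgroup.center G))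
  have hj0 : j ≠ 0 := by
    rintro rfl
    exact Finite.one_lt_card.ne' hcj
  have hji : j < i := by
    rw [← Nat.pow_lt_pow_iff_right hp.one_lt, ← hcj, ← hci]
    exact Set.ncard_lt_ncard hlt
  have hi3 : i ≠ 3 := by
    rintro rfl
    exact hne (Subgroup.eq_top_of_card_eq _ (hci.trans hcard.symm))
  rw [hci, show i = 2 by omega]

theorem hasNRTModel_of_normal {G : Type*} [Group G] {p j k : ℕ} (hp : p.Prime)
    (hcard : Nat.card G = p ^ (k + j)) (hexp : ∀ g : G, g ^ p = 1) (hk : k ≤ 2)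
    (H : Subgroup G) [H.Normal] (hH : Nat.card H = p ^ j) :
    HasNRTModel H (Multiplicative (Fin k → ZMod p)) := by
  have hq : Nat.card (G ⧸ H) = p ^ k := by
    have h := H.card_eq_card_quotient_mul_card_subgroup
    rw [hcard, hH, pow_add] at h
    exact (Nat.eq_of_mul_eq_mul_right (pow_pos hp.pos _) h).symm
  have hcomm : ∀ a b : G ⧸ H, a * b = b * a := by
    have := Fact.mk hp
    interval_cases k
    · have := (Nat.card_eq_one_iff_unique.1 (hq.trans (pow_zero p))).1
      exact fun a b => Subsingleton.elim _ _
    · have := isCyclic_of_prime_card (hq.trans (pow_one p))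
      exact fun a b => (IsCyclic.isMulCommutative (α := G ⧸ H)).is_comm.comm a b
    · exact Group.commute_of_card_eq_prime_sq hp hq
  have hexp' : ∀ a : G ⧸ H, a ^ p = 1 := by
    intro a
    obtain ⟨g, rfl⟩ := QuotientGroup.mk_surjective a
    rw [← QuotientGroup.mk_pow, hexp, QuotientGroup.mk_one]
  obtain ⟨e⟩ := nonempty_mulEquiv_of_pow_prime_eq_one hp hcomm hexp' hq
  exact (hasNRTModel_quotient H).congr e

theorem hasNRTModel_of_card_eq_prime {G : Type*} [Group G] {p : ℕ} (hp : p.Prime)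
    (hcard : Nat.card G = p ^ 3) (hexp : ∀ g : G, g ^ p = 1)
    (H : Subgroup G) (hH : Nat.card H = p) :
    HasNRTModel H (Multiplicative (Fin 2 → ZMod p)) := by
  have : Finite G := Nat.finite_of_card_ne_zero (by rw [hcard]; exact pow_ne_zero _ hp.ne_zero)
  by_cases hc : H ≤ Subgroup.center G
  · have : H.Normal := ⟨fun n hn g => by
      rw [Subgroup.mem_center_iff.1 (hc hn) g, mul_inv_cancel_right]; exact hn⟩
    exact hasNRTModel_of_normal (j := 1) hp hcard hexp le_rfl H (hH.trans (pow_one p).symm)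
  · obtain ⟨h, hh, hhc⟩ := SetLike.not_le_iff_exists.1 hc
    rw [Subgroup.mem_center_iff] at hhc
    push Not at hhc
    obtain ⟨x, hx⟩ := hhc
    have hxc : x ∉ Subgroup.center G := fun hxc => hx (Subgroup.mem_center_iff.1 hxc h).symm
    have hK := Subgroup.card_centralizer_singleton_of_card_eq_prime_cube hp hcard hxc
    have hdisj : Disjoint H (Subgroup.centralizer {x}) := by
      rw [disjoint_iff]
      rcases (Nat.dvd_prime hp).1 (hH ▸ Subgroup.card_dvd_of_le
        (inf_le_left : H ⊓ Subgroup.centralizer {x} ≤ H)) with h1 | h1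
      · exact Subgroup.card_eq_one.1 h1
      · have he := Subgroup.eq_of_le_of_card_ge
          (inf_le_left : H ⊓ Subgroup.centralizer {x} ≤ H) (by rw [h1, hH])
        exact absurd (Subgroup.mem_centralizer_singleton_iff.1 (inf_eq_left.1 he hh)).symm hx
    obtain ⟨e⟩ := nonempty_mulEquiv_of_pow_prime_eq_one hp
      (Group.commute_of_card_eq_prime_sq hp hK)
      (fun a => Subtype.ext (hexp a)) hK
    refine (Subgroup.isComplement'_of_card_mul_and_disjoint ?_ hdisj).hasNRTModel.congr e
    rw [hH, hK, hcard]
    ring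

theorem stmt_6 {G : Type*} [Group G] (p : ℕ) (hp : p.Prime) (hodd : Odd p)
    (hcard : Nat.card G = p ^ 3) (hna : ¬ ∀ a b : G, a * b = b * a)
    (hexp : ∀ g : G, g ^ p = 1) :
    ∀ d : ℕ, d ∣ p ^ 3 → TransisoComplete G d := by
  have : Finite G := Nat.finite_of_card_ne_zero (by rw [hcard]; exact pow_ne_zero _ hp.ne_zero)
  intro d hd H₁ H₂ h₁ h₂ hne
  obtain ⟨j, hj, rfl⟩ := (Nat.dvd_prime_pow hp).1 hd
  interval_cases j
  · exact absurd ((Subgroup.card_eq_one.1 h₁).trans (Subgroup.card_eq_one.1 h₂).symm) hne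
  · rw [pow_one] at h₁ h₂
    exact (hasNRTModel_of_card_eq_prime hp hcard hexp H₁ h₁).transisoAdj
      (hasNRTModel_of_card_eq_prime hp hcard hexp H₂ h₂)
  · have key : ∀ H : Subgroup G, Nat.card H = p ^ 2 →
        HasNRTModel H (Multiplicative (Fin 1 → ZMod p)) := by
      intro H hH
      have hi : H.index = p := by
        have h := H.card_mul_index
        rw [hcard, hH, pow_succ p 2] at h
        exact Nat.eq_of_mul_eq_mul_left (pow_pos hp.pos _) h
      have : H.Normal := Subgroup.normal_of_index_eq_minFac_card (by
        rw [hi, hcard, hp.pow_minFac (by norm_num)])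
      exact hasNRTModel_of_normal (j := 2) hp hcard hexp (by norm_num) H hH
    exact (key H₁ h₁).transisoAdj (key H₂ h₂)
  · exact absurd ((Subgroup.eq_top_of_card_eq _ (h₁.trans hcard.symm)).trans
      (Subgroup.eq_top_of_card_eq _ (h₂.trans hcard.symm)).symm) hne
end

section
/- Let p be a prime and G a non-abelian finite p-group such that for every subgroup H of G of index greater than p, every NRT of H in G generates G. If the transiso graph Γ_d(G) is complete for each divisor d of |G|, then G is isomorphic to the quaternion group Q₈ of order 8. -/
theorem exists_isNRT_subset {G : Type*} [Group G] (H M : Subgroup G)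
    (hHM : ∀ g : G, ∃ h ∈ H, ∃ m ∈ M, g = h * m) : ∃ S : Set G, S ⊆ M ∧ IsNRT H S := by
  have hrep : ∀ q : Quotient (QuotientGroup.rightRel H), ∃ m ∈ M,
      (Quotient.mk _ m : Quotient (QuotientGroup.rightRel H)) = q ∧
        (q = Quotient.mk _ 1 → m = 1) := by
    intro q
    by_cases hq : q = Quotient.mk _ 1
    · exact ⟨1, M.one_mem, hq.symm, fun _ => rfl⟩
    · induction q using Quotient.inductionOn with
      | h g =>
        obtain ⟨h, hh, m, hm, rfl⟩ := hHM g
        refine ⟨m, hm, Quotient.sound ?_, fun h => absurd h hq⟩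
        change QuotientGroup.rightRel H m (h * m)
        rw [QuotientGroup.rightRel_apply]
        simpa using hh
  choose f hfM hf hf1 using hrep
  refine ⟨Set.range f, ?_, ⟨_, hf1 _ rfl⟩, fun g => ⟨f (Quotient.mk _ g), ⟨⟨_, rfl⟩, ?_⟩, ?_⟩⟩
  · rintro _ ⟨q, rfl⟩
    exact hfM q
  · have h := Quotient.exact (hf (Quotient.mk _ g))
    change QuotientGroup.rightRel H _ g at h
    rw [QuotientGroup.rightRel_apply] at h
    exact ⟨_, h, by group⟩
  · rintro _ ⟨⟨q, rfl⟩, h, hh, hg⟩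
    congr 1
    rw [← hf q]
    apply Quotient.sound
    change QuotientGroup.rightRel H _ g
    rw [QuotientGroup.rightRel_apply, hg]
    simpa using hh

theorem exists_eq_zpow_mul_of_index_prime {G : Type*} [Group G] {M : Subgroup G} [M.Normal]
    (hM : M.index.Prime) {x : G} (hx : x ∉ M) (g : G) : ∃ k : ℤ, ∃ m ∈ M, g = x ^ k * m := by
  have : Fact M.index.Prime := ⟨hM⟩
  have hx1 : (x : G ⧸ M) ≠ 1 := by rwa [Ne, QuotientGroup.eq_one_iff]
  obtain ⟨k, hk⟩ := mem_zpowers_of_prime_card (G := G ⧸ M) (p := M.index) rfl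
    (g := (x : G ⧸ M)) (g' := (g : G ⧸ M)) hx1
  refine ⟨k, (x ^ k)⁻¹ * g, ?_, by group⟩
  rw [← QuotientGroup.eq]
  simpa using hk

theorem index_zpowers_le {G : Type*} [Group G] {p : ℕ} (hp : p.Prime)
    (hgen : ∀ H : Subgroup G, H.index > p → ∀ S : Set G, IsNRT H S →
      Subgroup.closure S = ⊤)
    {M : Subgroup G} [M.Normal] (hM : M.index = p) {x : G} (hx : x ∉ M) :
    (Subgroup.zpowers x).index ≤ p := by
  by_contra! hlt
  obtain ⟨S, hSM, hS⟩ := exists_isNRT_subset (Subgroup.zpowers x) M fun g => by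
    obtain ⟨k, m, hm, rfl⟩ := exists_eq_zpow_mul_of_index_prime (hM ▸ hp) hx g
    exact ⟨_, ⟨k, rfl⟩, m, hm, rfl⟩
  have hle := hgen _ hlt S hS ▸ (Subgroup.closure_le M).2 hSM
  exact hx (hle (Subgroup.mem_top x))

theorem mul_comm_of_zpowers_eq_top {G : Type*} [Group G] {x : G}
    (hx : Subgroup.zpowers x = ⊤) (a b : G) : a * b = b * a := by
  obtain ⟨i, rfl⟩ : a ∈ Subgroup.zpowers x := hx ▸ Subgroup.mem_top a
  obtain ⟨j, rfl⟩ : b ∈ Subgroup.zpowers x := hx ▸ Subgroup.mem_top b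
  exact (Commute.refl x).zpow_zpow i j

theorem index_zpowers_eq {G : Type*} [Group G] [Finite G] {p : ℕ} (hp : p.Prime)
    (hpG : IsPGroup p G) (hna : ¬ ∀ a b : G, a * b = b * a)
    (hgen : ∀ H : Subgroup G, H.index > p → ∀ S : Set G, IsNRT H S →
      Subgroup.closure S = ⊤)
    {M : Subgroup G} [M.Normal] (hM : M.index = p) {x : G} (hx : x ∉ M) :
    (Subgroup.zpowers x).index = p := by
  have : Fact p.Prime := ⟨hp⟩
  have hle := index_zpowers_le hp hgen hM hx
  obtain ⟨n, hn⟩ := hpG.index (Subgroup.zpowers x)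
  have hn0 : n ≠ 0 := by
    rintro rfl
    exact hna (mul_comm_of_zpowers_eq_top (Subgroup.index_eq_one.1 (by simpa using hn)))
  have hpn : p ≤ p ^ n := Nat.le_self_pow hn0 p
  omega

theorem normal_of_isPGroup_of_index_eq {G : Type*} [Group G] [Finite G] {p : ℕ} (hp : p.Prime)
    (hpG : IsPGroup p G) {M : Subgroup G} (hM : M.index = p) : M.Normal := by
  have : Fact p.Prime := ⟨hp⟩
  obtain ⟨n, hn⟩ := IsPGroup.iff_card.1 hpG
  have hn0 : n ≠ 0 := by
    rintro rfl
    have := M.index_dvd_card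
    rw [hn, hM, pow_zero, Nat.dvd_one] at this
    exact hp.one_lt.ne' this
  refine Subgroup.normal_of_index_eq_minFac_card ?_
  rw [hn, hM, hp.pow_minFac hn0]

theorem pow_mul_eq_of_commute {G : Type*} [Group G] {x y z : G} (hyx : y * x = z * x * y)
    (hy : Commute z y) (n : ℕ) : y ^ n * x = z ^ n * x * y ^ n := by
  induction n with
  | zero => simp
  | succ n ih =>
    calc y ^ (n + 1) * x = y * (y ^ n * x) := by rw [pow_succ', mul_assoc]
      _ = y * z ^ n * x * y ^ n := by rw [ih]; group
      _ = z ^ n * (y * x) * y ^ n := by rw [← (hy.pow_left n).eq]; group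
      _ = z ^ (n + 1) * x * y ^ (n + 1) := by rw [hyx]; group

theorem mul_pow_eq_of_commute {G : Type*} [Group G] {x y z : G} (hyx : y * x = z * x * y)
    (hx : Commute z x) (hy : Commute z y) (n : ℕ) :
    (x * y) ^ n = z ^ n.choose 2 * x ^ n * y ^ n := by
  induction n with
  | zero => simp
  | succ n ih =>
    have hc : (n + 1).choose 2 = n.choose 2 + n := by
      rw [Nat.choose_succ_succ' n 1, Nat.choose_one_right, add_comm]
    calc (x * y) ^ (n + 1) = z ^ n.choose 2 * x ^ n * (y ^ n * x) * y := by
          rw [pow_succ, ih]; group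
      _ = z ^ n.choose 2 * (x ^ n * z ^ n) * x * y ^ n * y := by
          rw [pow_mul_eq_of_commute hyx hy]; group
      _ = z ^ (n + 1).choose 2 * x ^ (n + 1) * y ^ (n + 1) := by
          rw [← (hx.pow_pow n n).eq, hc, pow_add, pow_succ x, pow_succ y]
          simp only [mul_assoc]

/-- Two cyclic subgroups of index `p` give an element outside the first one of order at most
`p`, or at most `4` when `p = 2`. -/
theorem exists_pow_eq_one_notMem {G : Type*} [Group G] {p : ℕ} (hp : p.Prime) {a b : G}
    (hA : (Subgroup.zpowers a).index = p) (hB : (Subgroup.zpowers b).index = p)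
    [hnA : (Subgroup.zpowers a).Normal] [hnB : (Subgroup.zpowers b).Normal]
    (hab : a ∉ Subgroup.zpowers b) (hba : b ∉ Subgroup.zpowers a) :
    ∃ d ∉ Subgroup.zpowers a, (p ≠ 2 → d ^ p = 1) ∧ (p = 2 → d ^ 4 = 1) := by
  have hcomm : ∀ {c u v : G}, u ∈ Subgroup.zpowers c → v ∈ Subgroup.zpowers c → Commute u v := by
    rintro c _ _ ⟨i, rfl⟩ ⟨j, rfl⟩
    exact (Commute.refl c).zpow_zpow i j
  have hpB : ∀ g, g ^ p ∈ Subgroup.zpowers b := fun g => hB ▸ Subgroup.pow_index_mem _ g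
  obtain ⟨m, hm⟩ : b ^ p ∈ Subgroup.zpowers a := hA ▸ Subgroup.pow_index_mem _ b
  have hm : a ^ m = b ^ p := hm
  have hpm : (p : ℤ) ∣ m := by
    by_contra hdvd
    have hcop : IsCoprime (p : ℤ) m :=
      (Nat.prime_iff_prime_int.1 hp).coprime_iff_not_dvd.2 hdvd
    obtain ⟨u, v, huv⟩ := hcop
    apply hab
    have : a = (a ^ p) ^ u * (a ^ m) ^ v := by
      rw [← zpow_natCast, ← zpow_mul, ← zpow_mul, ← zpow_add, mul_comm (p : ℤ), mul_comm m, huv,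
        zpow_one]
    rw [this, hm]
    exact mul_mem (zpow_mem (hpB a) u) (zpow_mem (hpB b) v)
  obtain ⟨k, rfl⟩ := hpm
  have hyA : a ^ (-k) ∈ Subgroup.zpowers a := ⟨-k, rfl⟩
  have hbB := Subgroup.mem_zpowers b
  set y := a ^ (-k) with hy
  have hby : b ^ p * y ^ p = 1 := by
    rw [← hm, hy, ← zpow_natCast, ← zpow_mul, ← zpow_add]
    simp [mul_comm]
  set z := y * b * y⁻¹ * b⁻¹ with hz
  have hzA : z ∈ Subgroup.zpowers a := by
    have := mul_mem hyA (hnA.conj_mem _ (inv_mem hyA) b)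
    simpa [hz, mul_assoc] using this
  have hzB : z ∈ Subgroup.zpowers b := mul_mem (hnB.conj_mem _ hbB y) (inv_mem hbB)
  have hyb : y * b = z * b * y := by rw [hz]; group
  have hzp : z ^ p = 1 := by
    have h := pow_mul_eq_of_commute hyb (hcomm hzA hyA) p
    rw [(hcomm (hpB y) hbB).eq, mul_assoc] at h
    exact right_eq_mul.1 h
  have hd := mul_pow_eq_of_commute hyb (hcomm hzB hbB) (hcomm hzA hyA) p
  rw [mul_assoc, hby, mul_one] at hd
  refine ⟨b * y, fun h => hba (by simpa using mul_mem h (inv_mem hyA)), fun hp2 => ?_, ?_⟩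
  · have hdvd : p ∣ p.choose 2 :=
      hp.dvd_choose_self two_ne_zero (lt_of_le_of_ne hp.two_le (Ne.symm hp2))
    rw [hd]
    exact orderOf_dvd_iff_pow_eq_one.1 ((orderOf_dvd_of_pow_eq_one hzp).trans hdvd)
  · rintro rfl
    rw [show 4 = 2 * 2 from rfl, pow_mul, hd]
    simpa using hzp

/-- A group of order `8` satisfying the defining relations of the quaternion group. -/
theorem nonempty_mulEquiv_quaternionGroup {G : Type*} [Group G] [Finite G] (hG : Nat.card G = 8)
    {a b : G} (ha : orderOf a = 4) (hb : b ^ 2 = a ^ 2) (hab : a * b = b * a⁻¹)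
    (hba : b ∉ Subgroup.zpowers a) : Nonempty (G ≃* QuaternionGroup 2) := by
  have ha4 : a ^ 4 = 1 := ha ▸ pow_orderOf_eq_one a
  let φ : ZMod (2 * 2) →+ Additive G := ZMod.lift 4
    ⟨zmultiplesHom (Additive G) (Additive.ofMul a), by
      change a ^ (4 : ℤ) = 1
      exact_mod_cast ha4⟩
  let e : ZMod (2 * 2) → G := fun i => (φ i).toMul
  have he_int : ∀ i : ℤ, e i = a ^ i := fun i => by
    exact congrArg Additive.toMul (ZMod.lift_coe 4 _ i)
  have he : ∀ i : ZMod (2 * 2), ∃ k : ℤ, (k : ZMod (2 * 2)) = i ∧ e i = a ^ k := fun i => by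
    obtain ⟨k, rfl⟩ := ZMod.intCast_surjective i
    exact ⟨k, rfl, he_int k⟩
  have he_add : ∀ i j, e (i + j) = e i * e j := fun i j => congrArg Additive.toMul (φ.map_add i j)
  have he_sub : ∀ i j, e (i - j) = (e j)⁻¹ * e i := fun i j => by
    rw [eq_inv_mul_iff_mul_eq, ← he_add, add_sub_cancel]
  have he_two : e ((2 : ℕ) : ZMod (2 * 2)) = b ^ 2 := by
    have := he_int 2
    rw [hb]
    exact_mod_cast this
  have heb : ∀ i, e i * b = b * (e i)⁻¹ := fun i => by
    obtain ⟨k, -, hk⟩ := he i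
    have hconj : b⁻¹ * a * b⁻¹⁻¹ = a⁻¹ := by rw [inv_inv, mul_assoc, hab]; group
    have := conj_zpow (i := k) (a := b⁻¹) (b := a)
    rw [hconj] at this
    rw [hk, ← inv_zpow, this]
    group
  have he_comm : ∀ i j, e i * e j = e j * e i := fun i j => by rw [← he_add, ← he_add, add_comm]
  have he_one : ∀ i, e i = 1 → i = 0 := fun i hi => by
    obtain ⟨k, rfl, hk⟩ := he i
    rw [hk, ← orderOf_dvd_iff_zpow_eq_one, ha] at hi
    exact (ZMod.intCast_zmod_eq_zero_iff_dvd k 4).2 hi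
  let f : QuaternionGroup 2 → G := fun q => match q with
    | .a i => e i
    | .xa i => b * e i
  have hf_mul : ∀ q r, f (q * r) = f q * f r := by
    rintro (i | i) (j | j)
    · exact he_add i j
    · change b * e (j - i) = e i * (b * e j)
      rw [he_sub, ← mul_assoc, ← mul_assoc, heb]
    · change b * e (i + j) = b * e i * e j
      rw [he_add, mul_assoc]
    · change e (((2 : ℕ) : ZMod (2 * 2)) + j - i) = b * e i * (b * e j)
      rw [add_sub_assoc, he_add, he_sub, he_two, mul_assoc b, ← mul_assoc (e i), heb, sq]
      simp only [mul_assoc]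
  let F : QuaternionGroup 2 →* G := MonoidHom.mk' f hf_mul
  have hF : Function.Injective F := by
    rw [injective_iff_map_eq_one]
    rintro (i | i) h
    · change e i = 1 at h
      rw [he_one i h]
      rfl
    · change b * e i = 1 at h
      obtain ⟨k, -, hk⟩ := he i
      refine absurd ?_ hba
      rw [eq_inv_of_mul_eq_one_left h, hk]
      exact inv_mem ⟨k, rfl⟩
  refine ⟨(MulEquiv.ofBijective F ((Nat.bijective_iff_injective_and_card F).2 ⟨hF, ?_⟩)).symm⟩
  rw [hG, Nat.card_eq_fintype_card, QuaternionGroup.card]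

theorem eq_of_mem_zpowers_of_orderOf_eq_four {G : Type*} [Group G] {a g : G} (ha : orderOf a = 4)
    (hg : g ∈ Subgroup.zpowers a) : g = 1 ∨ g = a ∨ g = a ^ 2 ∨ g = a⁻¹ := by
  have ha4 : a ^ (4 : ℤ) = 1 := by exact_mod_cast ha ▸ pow_orderOf_eq_one a
  obtain ⟨k, rfl⟩ := hg
  change a ^ k = 1 ∨ a ^ k = a ∨ a ^ k = a ^ 2 ∨ a ^ k = a⁻¹
  have key : ∀ r : ℤ, k % 4 = r → a ^ k = a ^ r := fun r hr => by
    rw [← Int.mul_ediv_add_emod k 4, hr, zpow_add, zpow_mul, ha4, one_zpow, one_mul]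
  have h1 : a ^ (3 : ℤ) = a⁻¹ := by
    rw [show (3 : ℤ) = 4 + -1 by norm_num, zpow_add, ha4, one_mul, zpow_neg_one]
  have : k % 4 = 0 ∨ k % 4 = 1 ∨ k % 4 = 2 ∨ k % 4 = 3 := by omega
  rcases this with h | h | h | h
  · exact Or.inl (by simpa using key _ h)
  · exact Or.inr (Or.inl (by simpa using key _ h))
  · exact Or.inr (Or.inr (Or.inl (by exact_mod_cast key _ h)))
  · exact Or.inr (Or.inr (Or.inr ((key _ h).trans h1)))

theorem stmt_7 {G : Type*} [Group G] [Finite G] (p : ℕ) (hp : p.Prime)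
    (hpG : IsPGroup p G) (hna : ¬ ∀ a b : G, a * b = b * a)
    (hgen : ∀ H : Subgroup G, H.index > p → ∀ S : Set G, IsNRT H S →
      Subgroup.closure S = ⊤)
    (hcomp : ∀ d : ℕ, d ∣ Nat.card G → TransisoComplete G d) :
    Nonempty (G ≃* QuaternionGroup 2) := by
  have : Fact p.Prime := ⟨hp⟩
  obtain ⟨n, hn⟩ := IsPGroup.iff_card.1 hpG
  have hp0 := hp.pos
  have hn3 : 3 ≤ n := by
    by_contra! hlt
    interval_cases n
    · have := (Nat.card_eq_one_iff_unique.1 (by simpa using hn)).1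
      exact hna fun a b => Subsingleton.elim _ _
    · have : IsCyclic G := isCyclic_of_prime_card (p := p) (by simpa using hn)
      exact hna (IsCyclic.isMulCommutative (α := G)).is_comm.comm
    · exact hna (IsPGroup.isMulCommutative_of_card_eq_prime_sq hn).is_comm.comm
  obtain ⟨M, hMcard⟩ := Sylow.exists_subgroup_card_pow_prime (G := G) p (n := n - 1)
    (hn ▸ pow_dvd_pow p (Nat.sub_le n 1))
  have hM : M.index = p := by
    have h := M.card_mul_index
    rw [hMcard, hn] at h
    refine Nat.eq_of_mul_eq_mul_left (pow_pos hp0 (n - 1)) (h.trans ?_)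
    rw [← pow_succ]
    congr 1
    omega
  have hMnormal := normal_of_isPGroup_of_index_eq hp hpG hM
  have exists_notMem : ∀ {K : Subgroup G}, K.index = p → ∃ x, x ∉ K := fun {K} hK => by
    by_contra! hall
    rw [(Subgroup.eq_top_iff' K).2 hall, Subgroup.index_top] at hK
    exact hp.one_lt.ne hK
  obtain ⟨b, hbM⟩ := exists_notMem hM
  have hB := index_zpowers_eq hp hpG hna hgen hM hbM
  have hnB := normal_of_isPGroup_of_index_eq hp hpG hB
  obtain ⟨a, hab⟩ := exists_notMem hB
  have hA := index_zpowers_eq hp hpG hna hgen hB hab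
  have hnA := normal_of_isPGroup_of_index_eq hp hpG hA
  have card_eq : ∀ x : G, (Subgroup.zpowers x).index = p → orderOf x * p = Nat.card G :=
    fun x hx => by rw [← hx, ← Nat.card_zpowers, Subgroup.card_mul_index]
  have hba : b ∉ Subgroup.zpowers a := fun h => by
    have hle : Subgroup.zpowers b ≤ Subgroup.zpowers a := Subgroup.zpowers_le.2 h
    have hcard : orderOf a = orderOf b :=
      Nat.eq_of_mul_eq_mul_right hp0 ((card_eq a hA).trans (card_eq b hB).symm)
    have heq := Subgroup.eq_of_le_of_card_ge hle
      (by rw [Nat.card_zpowers, Nat.card_zpowers, hcard])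
    exact hab (heq ▸ Subgroup.mem_zpowers a)
  obtain ⟨d, hdA, hd, hd2⟩ := exists_pow_eq_one_notMem hp hA hB hab hba
  have hdcard := card_eq d (index_zpowers_eq hp hpG hna hgen hA hdA)
  have hcard3 : p ^ 3 ≤ Nat.card G := hn ▸ Nat.pow_le_pow_right hp0 hn3
  obtain rfl : p = 2 := by
    by_contra hp2
    have hle := Nat.le_of_dvd hp0 (orderOf_dvd_of_pow_eq_one (hd hp2))
    have hmul := Nat.mul_le_mul_right p hle
    have hlt := Nat.pow_lt_pow_right hp.one_lt (show 2 < 3 by norm_num)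
    rw [sq] at hlt
    omega
  have hG : Nat.card G = 8 := by
    have := Nat.le_of_dvd (by norm_num) (orderOf_dvd_of_pow_eq_one (hd2 rfl))
    omega
  have ha4 : orderOf a = 4 := by have := card_eq a hA; omega
  have hb4 : orderOf b = 4 := by have := card_eq b hB; omega
  have sq_ne_one : ∀ {x : G}, orderOf x = 4 → x ^ 2 ≠ 1 := fun {x} hx h => by
    have := Nat.le_of_dvd (by norm_num) (orderOf_dvd_of_pow_eq_one h)
    omega
  have sq_sq_eq_one : ∀ {x : G}, orderOf x = 4 → (x ^ 2) ^ 2 = 1 := fun {x} hx => by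
    rw [← pow_mul, ← orderOf_dvd_iff_pow_eq_one, hx]
  have hab_ne : a * b ≠ b * a := fun h => by
    refine hna fun g₁ g₂ => ?_
    obtain ⟨k₁, _, ⟨l₁, rfl⟩, rfl⟩ := exists_eq_zpow_mul_of_index_prime (hA ▸ hp) hba g₁
    obtain ⟨k₂, _, ⟨l₂, rfl⟩, rfl⟩ := exists_eq_zpow_mul_of_index_prime (hA ▸ hp) hba g₂
    have h : Commute a b := h
    exact (((Commute.refl b).zpow_zpow k₁ k₂).mul_right (h.symm.zpow_zpow k₁ l₂)).mul_left
      ((h.zpow_zpow l₁ k₂).mul_right ((Commute.refl a).zpow_zpow l₁ l₂))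
  have hb2 : b ^ 2 = a ^ 2 := by
    have hmem : b ^ 2 ∈ Subgroup.zpowers a := by
      have := Subgroup.pow_index_mem (Subgroup.zpowers a) b
      rwa [hA] at this
    rcases eq_of_mem_zpowers_of_orderOf_eq_four ha4 hmem with h | h | h | h
    · exact absurd h (sq_ne_one hb4)
    · exact absurd (h ▸ sq_sq_eq_one hb4) (sq_ne_one ha4)
    · exact h
    · have := h ▸ sq_sq_eq_one hb4
      rw [inv_pow, inv_eq_one] at this
      exact absurd this (sq_ne_one ha4)
  refine nonempty_mulEquiv_quaternionGroup hG ha4 hb2 ?_ hba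
  have hmem := hnA.conj_mem a (Subgroup.mem_zpowers a) b⁻¹
  rw [inv_inv] at hmem
  have hconj : a * b = b * (b⁻¹ * a * b) := by group
  rcases eq_of_mem_zpowers_of_orderOf_eq_four ha4 hmem with h | h | h | h
  · rw [h, mul_one, mul_eq_right] at hconj
    exact absurd (by rw [hconj, one_pow]) (sq_ne_one ha4)
  · rw [h] at hconj
    exact absurd hconj hab_ne
  · have hsq : (b⁻¹ * a * b) ^ 2 = b⁻¹ * a ^ 2 * b := by simp only [sq]; group
    rw [h, sq_sq_eq_one ha4, ← hb2] at hsq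
    refine absurd ?_ (sq_ne_one hb4)
    rw [hsq]
    group
  · rwa [h] at hconj
end

section
/- Let p be an odd prime and G a finite p-group having a subgroup of order p not contained in the center Z(G). Then the transiso graph Γ_p(G) is complete if and only if for every non-normal subgroup H of G of order p there exists a normal subgroup K of G such that G is the internal semidirect product H ⋉ K (i.e., K ⊴ G, H ∩ K = {1} and HK = G) and K is isomorphic to the quotient G/L for every normal subgroup L of G of order p. -/
open Subgroup

theorem isNRT_iff_isComplement {G : Type*} [Group G] {H : Subgroup G} {S : Set G} :
    IsNRT H S ↔ 1 ∈ S ∧ IsComplement (H : Set G) S := by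
  have key : ∀ g s : G, (∃ h ∈ H, g = h * s) ↔ g * s⁻¹ ∈ (H : Set G) := fun g s =>
    ⟨by rintro ⟨h, hh, rfl⟩; simpa using hh, fun h => ⟨_, h, by simp⟩⟩
  unfold IsNRT
  rw [isComplement_iff_existsUnique_mul_inv_mem]
  refine and_congr_right fun _ => forall_congr' fun g => ?_
  simp only [key]
  constructor
  · rintro ⟨s, ⟨hs, h⟩, hu⟩
    exact ⟨⟨s, hs⟩, h, fun t ht => Subtype.ext (hu t ⟨t.2, ht⟩)⟩
  · rintro ⟨s, h, hu⟩
    exact ⟨s, ⟨s.2, h⟩, fun t ht => congrArg Subtype.val (hu ⟨t, ht.1⟩ ht.2)⟩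

/-- Some NRT of `H`, with its induced operation, is isomorphic to the group `Q`. -/
def HasGroupNRT {G : Type*} [Group G] (H : Subgroup G) (Q : Type*) [Group Q] : Prop :=
  ∃ S : Set G, IsNRT H S ∧ ∃ f : G → Q, Set.BijOn f S Set.univ ∧
    ∀ x ∈ S, ∀ y ∈ S, ∀ z ∈ S, (∃ h ∈ H, x * y = h * z) → f x * f y = f z

section

variable {G : Type*} [Group G] {H H₁ H₂ L : Subgroup G} {Q R : Type*} [Group Q] [Group R]

theorem HasGroupNRT.congr (h : HasGroupNRT H Q) (e : Q ≃* R) : HasGroupNRT H R := by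
  obtain ⟨S, hS, f, hf, hm⟩ := h
  refine ⟨S, hS, e ∘ f, (e.bijective.bijOn_univ).comp hf, fun x hx y hy z hz hxy => ?_⟩
  simp [← hm x hx y hy z hz hxy]

theorem IsNRT.bijOn_mk [L.Normal] {S : Set G} (hS : IsNRT L S) :
    Set.BijOn (QuotientGroup.mk : G → G ⧸ L) S Set.univ := by
  refine ⟨fun _ _ => trivial, fun s hs t ht hst => ?_, fun q _ => ?_⟩
  · refine (hS.2 s).unique ⟨hs, 1, L.one_mem, by simp⟩ ⟨ht, s * t⁻¹, ?_, by simp⟩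
    rwa [← div_eq_mul_inv, ← QuotientGroup.eq_iff_div_mem]
  · obtain ⟨g, rfl⟩ := QuotientGroup.mk_surjective q
    obtain ⟨s, ⟨hs, h, hh, rfl⟩, -⟩ := hS.2 g
    refine ⟨s, hs, ?_⟩
    simp [QuotientGroup.mk_mul, (QuotientGroup.eq_one_iff h).2 hh]

theorem TransisoAdj.hasGroupNRT_quotient [L.Normal] (h : TransisoAdj H L) :
    HasGroupNRT H (G ⧸ L) := by
  obtain ⟨S, T, hS, hT, φ, hφ, hm⟩ := h
  refine ⟨S, hS, QuotientGroup.mk ∘ φ, hT.bijOn_mk.comp hφ, fun x hx y hy z hz hxy => ?_⟩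
  obtain ⟨l, hl, e⟩ := hm x hx y hy z hz hxy
  simp only [Function.comp_apply, ← QuotientGroup.mk_mul, e]
  simp [QuotientGroup.mk_mul, (QuotientGroup.eq_one_iff l).2 hl]

theorem HasGroupNRT.transisoAdj (h₁ : HasGroupNRT H₁ Q) (h₂ : HasGroupNRT H₂ Q) :
    TransisoAdj H₁ H₂ := by
  obtain ⟨S, hS, f, hf, hfm⟩ := h₁
  obtain ⟨T, hT, g, hg, hgm⟩ := h₂
  have hinv := hg.invOn_invFunOn
  have hg' := hg.symm hinv.symm
  refine ⟨S, T, hS, hT, Function.invFunOn g T ∘ f, hg'.comp hf, fun x hx y hy z hz hxy => ?_⟩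
  have mem : ∀ x, Function.invFunOn g T x ∈ T := fun x => hg'.mapsTo trivial
  have right : ∀ x, g (Function.invFunOn g T x) = x := fun x => hinv.2 trivial
  obtain ⟨w, ⟨hw, h, hh, e⟩, -⟩ :=
    hT.2 ((Function.invFunOn g T ∘ f) x * (Function.invFunOn g T ∘ f) y)
  refine ⟨h, hh, e.trans ?_⟩
  have := hgm _ (mem (f x)) _ (mem (f y)) w hw ⟨h, hh, e⟩
  rw [right, right, hfm x hx y hy z hz hxy] at this
  rw [Function.comp_apply, hg.injOn (mem _) hw ((right _).trans this)]

theorem hasGroupNRT_quotient (L : Subgroup G) [L.Normal] : HasGroupNRT L (G ⧸ L) := by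
  obtain ⟨S, hS, h1⟩ := L.exists_isComplement_right 1
  have hS := isNRT_iff_isComplement.2 ⟨h1, hS⟩
  refine ⟨S, hS, _, hS.bijOn_mk, ?_⟩
  rintro x - y - z - ⟨l, hl, e⟩
  rw [← QuotientGroup.mk_mul, e]
  simp [QuotientGroup.mk_mul, (QuotientGroup.eq_one_iff l).2 hl]

theorem HasGroupNRT.nonempty_mulEquiv_quotient [L.Normal] (h : HasGroupNRT L Q) :
    Nonempty (Q ≃* G ⧸ L) := by
  obtain ⟨S, hS, f, hf, hm⟩ := h
  have hb : Set.BijOn (QuotientGroup.mk : G → G ⧸ L) S Set.univ := hS.bijOn_mk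
  have hinv := hf.invOn_invFunOn
  have hf' := hf.symm hinv.symm
  have mem : ∀ x, Function.invFunOn f S x ∈ S := fun x => hf'.mapsTo trivial
  have right : ∀ x, f (Function.invFunOn f S x) = x := fun x => hinv.2 trivial
  refine ⟨MulEquiv.mk' (Equiv.ofBijective _ (Set.bijOn_univ.1 (hb.comp hf'))) fun a b => ?_⟩
  obtain ⟨w, ⟨hw, l, hl, e⟩, -⟩ := hS.2 (Function.invFunOn f S a * Function.invFunOn f S b)
  have := hm _ (mem a) _ (mem b) w hw ⟨l, hl, e⟩
  rw [right, right] at this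
  simp only [Equiv.ofBijective_apply, Function.comp_apply]
  rw [hf.injOn (mem _) hw ((right _).trans this), ← QuotientGroup.mk_mul, e]
  simp [QuotientGroup.mk_mul, (QuotientGroup.eq_one_iff l).2 hl]

theorem hasGroupNRT_of_isComplement' {K : Subgroup G} (h : IsComplement' H K) :
    HasGroupNRT H K := by
  classical
  have hK : IsNRT H (K : Set G) := isNRT_iff_isComplement.2 ⟨K.one_mem, h⟩
  have hval : ∀ x (hx : x ∈ K), (if hx : x ∈ K then (⟨x, hx⟩ : K) else 1) = ⟨x, hx⟩ :=
    fun x hx => dif_pos hx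
  refine ⟨K, hK, fun x => if hx : x ∈ K then ⟨x, hx⟩ else 1, ⟨fun _ _ => trivial, ?_, ?_⟩, ?_⟩
  · intro x hx y hy e
    simpa [hval x hx, hval y hy] using e
  · rintro ⟨x, hx⟩ -
    exact ⟨x, hx, hval x hx⟩
  · rintro x hx y hy z hz hxy
    simp only [hval x hx, hval y hy, hval z hz, MulMemClass.mk_mul_mk, Subtype.mk.injEq]
    exact (hK.2 (x * y)).unique ⟨K.mul_mem hx hy, 1, H.one_mem, by simp⟩ ⟨hz, hxy⟩

/-- If the induced operation on an NRT of `H` is that of a group, and no nontrivial element of `H`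
has all its conjugates in `H`, then the NRT is a subgroup complementing `H`. -/
theorem HasGroupNRT.exists_isComplement' [Finite G] (h : HasGroupNRT H Q)
    (hcore : ∀ c : G, (∀ g : G, g * c * g⁻¹ ∈ H) → c = 1) :
    ∃ K : Subgroup G, IsComplement' H K ∧ Nonempty (K ≃* Q) := by
  obtain ⟨S, hS, f, hf, hm⟩ := h
  have hmul : ∀ y ∈ S, ∀ z ∈ S, y * z ∈ S := by
    intro y hy z hz
    obtain ⟨w, ⟨hw, c, hc, ec⟩, -⟩ := hS.2 (y * z)
    suffices c = 1 by rw [ec, this, one_mul]; exact hw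
    refine hcore c fun g => ?_
    obtain ⟨x, ⟨hx, k, hk, rfl⟩, -⟩ := hS.2 g
    obtain ⟨u, ⟨hu, a, ha, ea⟩, -⟩ := hS.2 (x * y)
    obtain ⟨v, ⟨hv, b, hb, eb⟩, -⟩ := hS.2 (u * z)
    obtain ⟨v', ⟨hv', d, hd, ed⟩, -⟩ := hS.2 (x * w)
    have hvv : v' = v := by
      refine hf.injOn hv' hv ?_
      rw [← hm x hx w hw v' hv' ⟨d, hd, ed⟩, ← hm u hu z hz v hv ⟨b, hb, eb⟩,
        ← hm x hx y hy u hu ⟨a, ha, ea⟩, ← hm y hy z hz w hw ⟨c, hc, ec⟩, mul_assoc]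
    subst hvv
    have e : x * c * x⁻¹ = a * b * d⁻¹ := by
      have e1 : x * c * w = a * b * v' := by
        rw [mul_assoc, ← ec, ← mul_assoc, ea, mul_assoc, eb, mul_assoc]
      have e2 : v' = d⁻¹ * (x * w) := by rw [ed]; group
      rw [e2] at e1
      have e3 : x * c = a * b * d⁻¹ * x :=
        mul_right_cancel (b := w) (by rw [e1]; simp only [mul_assoc])
      rw [e3]; group
    have : k * x * c * (k * x)⁻¹ = k * (a * b * d⁻¹) * k⁻¹ := by rw [← e]; group
    rw [this]
    exact H.mul_mem (H.mul_mem hk (H.mul_mem (H.mul_mem ha hb) (H.inv_mem hd))) (H.inv_mem hk)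
  let M : Submonoid G := ⟨⟨S, fun {a b} ha hb => hmul a ha b hb⟩, hS.1⟩
  let K : Subgroup G := { M with
    inv_mem' := fun {x} hx => by
      have : x⁻¹ ∈ Submonoid.powers x :=
        mem_powers_iff_mem_zpowers.2 (inv_mem (mem_zpowers x))
      exact (Submonoid.powers_le.2 hx : _ ≤ M) this }
  refine ⟨K, (isNRT_iff_isComplement.1 hS).2, ⟨MulEquiv.mk' (hf.equiv.trans
    (Equiv.Set.univ Q)) fun a b => ?_⟩⟩
  exact (hm a a.2 b b.2 _ (K.mul_mem a.2 b.2) ⟨1, H.one_mem, by simp⟩).symm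

theorem eq_one_of_forall_conj_mem {p : ℕ} (hp : p.Prime) (hH : Nat.card H = p)
    (hn : ¬ H.Normal) {c : G} (hc : ∀ g : G, g * c * g⁻¹ ∈ H) : c = 1 := by
  have := Fact.mk hp
  by_contra hne
  have hcH : c ∈ H := by simpa using hc 1
  refine hn ⟨fun x hx g => ?_⟩
  have hx' : (⟨x, hx⟩ : H) ∈ zpowers (⟨c, hcH⟩ : H) :=
    mem_zpowers_of_prime_card hH (by simpa [Subtype.ext_iff] using hne)
  obtain ⟨n, e⟩ := mem_zpowers_iff.1 hx'
  have e : c ^ n = x := by simpa [Subtype.ext_iff] using e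
  rw [← e, ← conj_zpow]
  exact H.zpow_mem (hc g) n

theorem IsPGroup.le_center_of_normal_of_card_eq [Finite G] {p : ℕ} (hp : p.Prime)
    (hG : IsPGroup p G) [H.Normal] (hH : Nat.card H = p) : H ≤ center G := by
  have := Fact.mk hp
  have hG' : IsPGroup p (ConjAct G) := hG.of_equiv ConjAct.toConjAct
  obtain ⟨c, hc, hne⟩ := hG'.exists_fixed_point_of_prime_dvd_card_of_fixed_point H
    (dvd_of_eq hH.symm) (a := 1) (fun g => smul_one g)
  have hcc : (c : G) ∈ center G := mem_center_iff.2 fun g => by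
    have := congrArg Subtype.val (hc (ConjAct.toConjAct g))
    rw [ConjAct.Subgroup.val_conj_smul, ConjAct.toConjAct_smul] at this
    exact mul_inv_eq_iff_eq_mul.1 this
  intro x hx
  obtain ⟨n, e⟩ := mem_zpowers_iff.1 (mem_zpowers_of_prime_card hH hne.symm (g' := ⟨x, hx⟩))
  have e : (c : G) ^ n = x := by simpa [Subtype.ext_iff] using e
  exact e ▸ (center G).zpow_mem hcc n

theorem IsPGroup.normal_of_index_eq [Finite G] {p : ℕ} (hp : p.Prime)
    (hG : IsPGroup p G) (hH : H.index = p) : H.Normal := by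
  have := Fact.mk hp
  obtain ⟨n, hn⟩ := IsPGroup.iff_card.1 hG
  refine normal_of_index_eq_minFac_card ?_
  have hn0 : n ≠ 0 := by
    rintro rfl
    have := H.index_dvd_card
    rw [hn, hH, pow_zero, Nat.dvd_one] at this
    exact hp.ne_one this
  rw [hn, hp.pow_minFac hn0, hH]

theorem IsPGroup.exists_normal_card_eq [Finite G] [Nontrivial G] {p : ℕ} (hp : p.Prime)
    (hG : IsPGroup p G) : ∃ L : Subgroup G, L.Normal ∧ Nat.card L = p := by
  have := Fact.mk hp
  have := hG.center_nontrivial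
  have hdvd : p ∣ Nat.card (center G) :=
    (hG.to_subgroup (center G)).card_eq_or_dvd.resolve_left Finite.one_lt_card.ne'
  obtain ⟨c, hc⟩ := exists_prime_orderOf_dvd_card' p hdvd
  refine ⟨zpowers (c : G), ⟨fun x hx g => ?_⟩, ?_⟩
  · rwa [mem_center_iff.1 (zpowers_le.2 c.2 hx) g, mul_inv_cancel_right]
  · rw [Nat.card_zpowers, orderOf_coe, hc]

end

theorem stmt_8 {G : Type*} [Group G] [Finite G] (p : ℕ) (hp : p.Prime) (hodd : Odd p)
    (hpG : IsPGroup p G)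
    (hnc : ∃ H : Subgroup G, Nat.card H = p ∧ ¬ H ≤ Subgroup.center G) :
    TransisoComplete G p ↔
      ∀ H : Subgroup G, Nat.card H = p → ¬ H.Normal →
        ∃ K : Subgroup G, K.Normal ∧ H ⊓ K = ⊥ ∧
          (∀ g : G, ∃ h ∈ H, ∃ k ∈ K, g = h * k) ∧
          (∀ (L : Subgroup G) [L.Normal], Nat.card L = p →
            Nonempty (K ≃* G ⧸ L)) := by
  obtain ⟨H₀, hH₀, hH₀c⟩ := hnc
  have hH₀n : ¬ H₀.Normal := fun _ => hH₀c (hpG.le_center_of_normal_of_card_eq hp hH₀)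
  have : Nontrivial G := by
    by_contra hG
    rw [not_nontrivial_iff_subsingleton] at hG
    exact hH₀c fun x _ => Subsingleton.elim 1 x ▸ one_mem _
  obtain ⟨L₀, hL₀n, hL₀⟩ := hpG.exists_normal_card_eq hp
  constructor
  · intro hcomp H hH hHn
    have hHL : H ≠ L₀ := fun h => hHn (h ▸ hL₀n)
    obtain ⟨K, hK, ⟨e⟩⟩ := (hcomp H L₀ hH hL₀ hHL).hasGroupNRT_quotient.exists_isComplement'
      fun c hc => eq_one_of_forall_conj_mem hp hH hHn hc
    refine ⟨K, hpG.normal_of_index_eq hp (hK.index_eq_card.trans hH), hK.disjoint.eq_bot,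
      fun g => ?_, fun L _ hL => ?_⟩
    · obtain ⟨⟨h, k⟩, rfl⟩ := hK.2 g
      exact ⟨h, h.2, k, k.2, rfl⟩
    · have hLL : HasGroupNRT L (G ⧸ L₀) := by
        by_cases h : L = L₀
        · subst h
          exact hasGroupNRT_quotient L
        · exact (hcomp L L₀ hL hL₀ h).hasGroupNRT_quotient
      obtain ⟨e'⟩ := hLL.nonempty_mulEquiv_quotient
      exact ⟨e.trans e'⟩
  · intro hcompl
    obtain ⟨K₀, -, -, -, hK₀⟩ := hcompl H₀ hH₀ hH₀n
    obtain ⟨e₀⟩ := hK₀ L₀ hL₀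
    have key : ∀ H : Subgroup G, Nat.card H = p → HasGroupNRT H (G ⧸ L₀) := by
      intro H hH
      by_cases hn : H.Normal
      · obtain ⟨e⟩ := hK₀ H hH
        exact (hasGroupNRT_quotient H).congr (e.symm.trans e₀)
      · obtain ⟨K, -, hdisj, hmul, hK⟩ := hcompl H hH hn
        obtain ⟨e⟩ := hK L₀ hL₀
        refine (hasGroupNRT_of_isComplement' (isComplement'_of_disjoint_and_mul_eq_univ
          (disjoint_iff.2 hdisj) (Set.eq_univ_of_forall fun g => ?_))).congr e
        obtain ⟨h, hh, k, hk, rfl⟩ := hmul g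
        exact Set.mul_mem_mul hh hk
    exact fun H₁ H₂ h₁ h₂ _ => (key H₁ h₁).transisoAdj (key H₂ h₂)
end

section
/- Let p be an odd prime and G a finite p-group of order p^n having a subgroup of order p not contained in the center Z(G), whose Frattini subgroup Φ(G) has order p, and such that the transiso graph Γ_p(G) is complete. Then for every non-normal subgroup H of G of order p there exists a normal subgroup K of G such that G is the internal semidirect product H ⋉ K and K is elementary abelian of order p^{n−1} (i.e., K is abelian with x^p = 1 for all x ∈ K). -/
open Subgroup
open scoped commutatorElement

theorem TransisoAdj.exists_quotient_map {G : Type*} [Group G] {H N : Subgroup G} [N.Normal]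
    (h : TransisoAdj H N) :
    ∃ S : Set G, IsNRT H S ∧ ∃ f : G → G ⧸ N, Set.InjOn f S ∧
      ∀ x ∈ S, ∀ y ∈ S, ∀ z ∈ S, (∃ h ∈ H, x * y = h * z) → f x * f y = f z := by
  obtain ⟨S, T, hS, hT, φ, hφ, hmul⟩ := h
  refine ⟨S, hS, fun g => QuotientGroup.mk (φ g), ?_, ?_⟩
  · intro x hx y hy hxy
    rw [QuotientGroup.eq_iff_div_mem] at hxy
    refine hφ.injOn hx hy ((hT.2 (φ x)).unique ⟨hφ.mapsTo hx, 1, N.one_mem, (one_mul _).symm⟩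
      ⟨hφ.mapsTo hy, φ x / φ y, hxy, ?_⟩)
    simp
  · intro x hx y hy z hz hxy
    obtain ⟨k, hk, hxy⟩ := hmul x hx y hy z hz hxy
    rw [← QuotientGroup.mk_mul, hxy, QuotientGroup.mk_mul, (QuotientGroup.eq_one_iff k).2 hk,
      one_mul]

/-- If the operation of a transversal of a core-free subgroup embeds into a group,
the transversal is closed under the multiplication of the ambient group. -/
theorem IsNRT.mul_mem {G Q : Type*} [Group G] [Group Q] {H : Subgroup G} {S : Set G}
    (hS : IsNRT H S) (hH : H.normalCore = ⊥) {f : G → Q} (hinj : Set.InjOn f S)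
    (hf : ∀ x ∈ S, ∀ y ∈ S, ∀ z ∈ S, (∃ h ∈ H, x * y = h * z) → f x * f y = f z)
    {x y : G} (hx : x ∈ S) (hy : y ∈ S) : x * y ∈ S := by
  obtain ⟨z, ⟨hz, h, hh, hxy⟩, -⟩ := hS.2 (x * y)
  have conj_mem : ∀ t ∈ S, t * h * t⁻¹ ∈ H := by
    intro t ht
    obtain ⟨u, ⟨hu, a, ha, hau⟩, -⟩ := hS.2 (t * z)
    obtain ⟨v, ⟨hv, b, hb, hbv⟩, -⟩ := hS.2 (t * x)
    obtain ⟨w, ⟨hw, c, hc, hcw⟩, -⟩ := hS.2 (v * y)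
    have huw : u = w := by
      apply hinj hu hw
      rw [← hf t ht z hz u hu ⟨a, ha, hau⟩, ← hf x hx y hy z hz ⟨h, hh, hxy⟩,
        ← hf v hv y hy w hw ⟨c, hc, hcw⟩, ← hf t ht x hx v hv ⟨b, hb, hbv⟩, mul_assoc]
    have key : t * h * t⁻¹ = b * c * a⁻¹ := by
      have h1 : t * h * z = b * c * a⁻¹ * (t * z) := by
        calc t * h * z = t * x * y := by rw [mul_assoc, ← hxy, mul_assoc]
          _ = b * c * w := by rw [hbv, mul_assoc, hcw, mul_assoc]
          _ = b * c * a⁻¹ * (t * z) := by rw [hau, huw]; group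
      rw [← mul_assoc] at h1
      rw [mul_right_cancel h1]
      group
    rw [key]
    exact H.mul_mem (H.mul_mem hb hc) (H.inv_mem ha)
  have hcore : h ∈ H.normalCore := by
    intro g
    obtain ⟨t, ⟨ht, k, hk, rfl⟩, -⟩ := hS.2 g
    have := H.mul_mem (H.mul_mem hk (conj_mem t ht)) (H.inv_mem hk)
    convert this using 1
    group
  rw [hH, mem_bot] at hcore
  rwa [hxy, hcore, one_mul]

theorem TransisoAdj.exists_isComplement' {G : Type*} [Group G] [Finite G] {H N : Subgroup G}
    [N.Normal] (h : TransisoAdj H N) (hH : H.normalCore = ⊥) :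
    ∃ K : Subgroup G, IsComplement' H K ∧ ∃ f : K →* G ⧸ N, Function.Injective f := by
  obtain ⟨S, hS, f, hinj, hf⟩ := h.exists_quotient_map
  have hmul : ∀ {x y : G}, x ∈ S → y ∈ S → x * y ∈ S := hS.mul_mem hH hinj hf
  have hpow : ∀ {x : G}, x ∈ S → ∀ k : ℕ, x ^ k ∈ S := by
    intro x hx k
    induction k with
    | zero => simpa using hS.1
    | succ k ih => rw [pow_succ]; exact hmul ih hx
  let K : Subgroup G :=
    { carrier := S
      mul_mem' := hmul
      one_mem' := hS.1
      inv_mem' := fun {x} hx => by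
        have : x⁻¹ = x ^ (Nat.card G - 1) := by
          rw [inv_eq_iff_mul_eq_one, ← pow_succ', Nat.sub_add_cancel Nat.card_pos, pow_card_eq_one']
        change x⁻¹ ∈ S
        rw [this]
        exact hpow hx _ }
  refine ⟨K, isComplement'_of_disjoint_and_mul_eq_univ ?_ ?_, MonoidHom.mk' (fun k => f k) ?_, ?_⟩
  · rw [disjoint_def]
    intro x hxH hxK
    exact (hS.2 x).unique ⟨hxK, 1, H.one_mem, (one_mul x).symm⟩
      ⟨hS.1, x, hxH, (mul_one x).symm⟩
  · refine Set.eq_univ_of_forall fun g => ?_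
    obtain ⟨s, ⟨hs, k, hk, rfl⟩, -⟩ := hS.2 g
    exact Set.mul_mem_mul hk hs
  · intro x y
    exact (hf x x.2 y y.2 _ (hmul x.2 y.2) ⟨1, H.one_mem, (one_mul _).symm⟩).symm
  · intro x y hxy
    exact Subtype.ext (hinj x.2 y.2 hxy)

theorem Subgroup.normalCore_eq_bot_of_prime_card {G : Type*} [Group G] {H : Subgroup G}
    (hp : (Nat.card H).Prime) (hH : ¬ H.Normal) : H.normalCore = ⊥ := by
  have : Fact (Nat.card H).Prime := ⟨hp⟩
  rcases (H.normalCore.subgroupOf H).eq_bot_or_eq_top_of_prime_card with h | h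
  · rw [subgroupOf_eq_bot, disjoint_iff] at h
    rwa [inf_eq_left.2 H.normalCore_le] at h
  · rw [subgroupOf_eq_top] at h
    exact absurd (le_antisymm H.normalCore_le h ▸ H.normalCore_normal) hH

theorem IsPGroup.normal_of_isCoatom {G : Type*} [Group G] [Finite G] {p : ℕ} [Fact p.Prime]
    (hG : IsPGroup p G) {M : Subgroup G} (hM : IsCoatom M) : M.Normal := by
  have := hG.isNilpotent
  have h : ∀ H : Subgroup G, IsCoatom H → H.Normal :=
    ((Group.isNilpotent_of_finite_tfae (G := G)).out 0 2).1 this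
  exact h M hM

theorem IsPGroup.index_of_isCoatom {G : Type*} [Group G] [Finite G] {p : ℕ} [Fact p.Prime]
    (hG : IsPGroup p G) {M : Subgroup G} (hM : IsCoatom M) : M.index = p := by
  have hp : p.Prime := Fact.out
  obtain ⟨m, hm⟩ := hG.index M
  obtain ⟨k, hk⟩ := IsPGroup.iff_card.1 (hG.to_subgroup M)
  have hm0 : m ≠ 0 := by
    rintro rfl
    exact hM.1 (index_eq_one.1 (by simpa using hm))
  have hdvd : p ^ (k + 1) ∣ Nat.card G := by
    rw [← M.card_mul_index, hk, hm, ← pow_add]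
    exact pow_dvd_pow p (by omega)
  obtain ⟨L, hL, hML⟩ := Sylow.exists_subgroup_card_pow_succ hdvd hk
  have hlt : M < L := by
    refine lt_of_le_of_ne hML ?_
    rintro rfl
    have := Nat.pow_right_injective hp.two_le (hk.symm.trans hL)
    omega
  rw [hM.2 L hlt, card_top, ← M.card_mul_index, hk, pow_succ] at hL
  exact Nat.eq_of_mul_eq_mul_left (pow_pos hp.pos k) hL

theorem IsPGroup.commutatorElement_mem_frattini {G : Type*} [Group G] [Finite G] {p : ℕ}
    [Fact p.Prime] (hG : IsPGroup p G) (x y : G) :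
    ⁅x, y⁆ ∈ frattini G := by
  simp only [frattini, Order.radical, mem_iInf]
  intro M hM
  have := hG.normal_of_isCoatom hM
  have : IsCyclic (G ⧸ M) := isCyclic_of_prime_card (p := p) (hG.index_of_isCoatom hM)
  rw [← QuotientGroup.eq_one_iff, ← QuotientGroup.mk'_apply, map_commutatorElement,
    commutatorElement_eq_one_iff_mul_comm]
  exact mul_comm' _ _

theorem IsPGroup.pow_mem_frattini {G : Type*} [Group G] [Finite G] {p : ℕ}
    [Fact p.Prime] (hG : IsPGroup p G) (x : G) : x ^ p ∈ frattini G := by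
  simp only [frattini, Order.radical, mem_iInf]
  intro M hM
  have := hG.normal_of_isCoatom hM
  exact hG.index_of_isCoatom hM ▸ M.pow_index_mem x

theorem stmt_9 {G : Type*} [Group G] [Finite G] (p n : ℕ) (hp : p.Prime) (hodd : Odd p)
    (hpG : IsPGroup p G) (hcard : Nat.card G = p ^ n)
    (hnc : ∃ H : Subgroup G, Nat.card H = p ∧ ¬ H ≤ Subgroup.center G)
    (hΦ : Nat.card (frattini G) = p)
    (hcomp : TransisoComplete G p) :
    ∀ H : Subgroup G, Nat.card H = p → ¬ H.Normal →
      ∃ K : Subgroup G, K.Normal ∧ H ⊓ K = ⊥ ∧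
        (∀ g : G, ∃ h ∈ H, ∃ k ∈ K, g = h * k) ∧
        (∀ x y : K, x * y = y * x) ∧ (∀ x : K, x ^ p = 1) ∧
        Nat.card K = p ^ (n - 1) := by
  intro H hH hnormal
  have : Fact p.Prime := ⟨hp⟩
  have hne : H ≠ frattini G := by
    rintro rfl
    exact hnormal inferInstance
  obtain ⟨K, hHK, f, hf⟩ := (hcomp H (frattini G) hH hΦ hne).exists_isComplement'
    (normalCore_eq_bot_of_prime_card (hH ▸ hp) hnormal)
  have hn : n ≠ 0 := by
    rintro rfl
    have := H.card_subgroup_dvd_card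
    rw [hcard, hH, pow_zero, Nat.dvd_one] at this
    exact hp.one_lt.ne' this
  have hKnormal : K.Normal := by
    apply normal_of_index_eq_minFac_card
    rw [hHK.index_eq_card, hH, hcard, hp.pow_minFac hn]
  refine ⟨K, hKnormal, hHK.disjoint.eq_bot, fun g => ?_, fun x y => hf ?_, fun x => hf ?_, ?_⟩
  · obtain ⟨⟨h, k⟩, hg⟩ := hHK.2 g
    exact ⟨h, h.2, k, k.2, hg.symm⟩
  · rw [map_mul, map_mul, ← commutatorElement_eq_one_iff_mul_comm]
    obtain ⟨a, ha⟩ := QuotientGroup.mk'_surjective (frattini G) (f x)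
    obtain ⟨b, hb⟩ := QuotientGroup.mk'_surjective (frattini G) (f y)
    rw [← ha, ← hb, ← map_commutatorElement]
    exact (QuotientGroup.eq_one_iff _).2 (hpG.commutatorElement_mem_frattini a b)
  · rw [map_pow, map_one]
    obtain ⟨a, ha⟩ := QuotientGroup.mk'_surjective (frattini G) (f x)
    rw [← ha, ← map_pow]
    exact (QuotientGroup.eq_one_iff _).2 (hpG.pow_mem_frattini a)
  · have := hHK.card_mul_card
    rw [hH, hcard, ← mul_pow_sub_one hn] at this
    exact Nat.eq_of_mul_eq_mul_left hp.pos this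
end

section
/- Let p be an odd prime and G a finite p-group having a subgroup of order p not contained in the center Z(G). If the transiso graph Γ_p(G) is complete, then every subgroup of G of order p that is contained in the Frattini subgroup Φ(G) is normal in G. -/
/-- Any two elements of an NRT in the same right coset of `H` are equal. -/
theorem IsNRT.eq_of_mul_eq {G : Type*} [Group G] {H : Subgroup G} {S : Set G} (hS : IsNRT H S)
    {s t a b : G} (hs : s ∈ S) (ht : t ∈ S) (ha : a ∈ H) (hb : b ∈ H) (h : a * s = b * t) :
    s = t :=
  (hS.2 (a * s)).unique ⟨hs, a, ha, rfl⟩ ⟨ht, b, hb, h⟩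

/-- If an NRT of `H` is isomorphic to an NRT of a central subgroup, then the elements of `H`
measuring its failure to be multiplicatively closed have all their conjugates in `H`. -/
theorem IsNRTIso.conj_mem_of_le_center {G : Type*} [Group G] {H Z : Subgroup G} {S T : Set G}
    {φ : G → G} (hS : IsNRT H S) (hT : IsNRT Z T) (hφ : IsNRTIso H Z S T φ)
    (hZ : Z ≤ Subgroup.center G) {x y w h : G} (hx : x ∈ S) (hy : y ∈ S) (hw : w ∈ S)
    (hh : h ∈ H) (hxy : x * y = h * w) (g : G) : g * h * g⁻¹ ∈ H := by
  have comm : ∀ a ∈ Z, ∀ b, b * a = a * b := fun a ha b =>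
    Subgroup.mem_center_iff.mp (hZ ha) b
  obtain ⟨z, ⟨hz, k, hk, rfl⟩, -⟩ := hS.2 g
  obtain ⟨u, ⟨hu, h₁, hh₁, e₁⟩, -⟩ := hS.2 (z * x)
  obtain ⟨v, ⟨hv, h₂, hh₂, e₂⟩, -⟩ := hS.2 (u * y)
  obtain ⟨v', ⟨hv', h₃, hh₃, e₃⟩, -⟩ := hS.2 (z * w)
  obtain ⟨a, ha, ea⟩ := hφ.2 x hx y hy w hw ⟨h, hh, hxy⟩
  obtain ⟨b, hb, eb⟩ := hφ.2 z hz x hx u hu ⟨h₁, hh₁, e₁⟩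
  obtain ⟨c, hc, ec⟩ := hφ.2 u hu y hy v hv ⟨h₂, hh₂, e₂⟩
  obtain ⟨d, hd, ed⟩ := hφ.2 z hz w hw v' hv' ⟨h₃, hh₃, e₃⟩
  have key : (b * c) * φ v = (a * d) * φ v' := by
    calc (b * c) * φ v = φ z * φ x * φ y := by rw [mul_assoc, ← ec, ← mul_assoc, ← eb]
      _ = φ z * a * φ w := by rw [mul_assoc, ea, mul_assoc]
      _ = (a * d) * φ v' := by rw [comm a ha, mul_assoc, ed, mul_assoc]
  have hvv : v = v' := hφ.1.injOn hv hv' <|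
    hT.eq_of_mul_eq (hφ.1.mapsTo hv) (hφ.1.mapsTo hv') (mul_mem hb hc) (mul_mem ha hd) key
  subst hvv
  have hzz : z * h * z⁻¹ = h₁ * h₂ * h₃⁻¹ := by
    have e : z * h * w = h₁ * h₂ * v := by
      rw [mul_assoc, ← hxy, ← mul_assoc, e₁, mul_assoc, e₂, mul_assoc]
    have e' : z⁻¹ = w * v⁻¹ * h₃⁻¹ := by
      rw [eq_mul_inv_iff_mul_eq, eq_mul_inv_iff_mul_eq, mul_assoc, ← e₃, inv_mul_cancel_left]
    rw [e', ← mul_assoc, ← mul_assoc, e, mul_inv_cancel_right]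
  have : k * z * h * (k * z)⁻¹ = k * (z * h * z⁻¹) * k⁻¹ := by group
  rw [this, hzz]
  exact mul_mem (mul_mem hk (mul_mem (mul_mem hh₁ hh₂) (inv_mem hh₃))) (inv_mem hk)

/-- An element of a subgroup of prime order other than `1` generates it. -/
theorem Subgroup.le_of_card_prime_of_mem {G : Type*} [Group G] {p : ℕ} (hp : p.Prime)
    {H L : Subgroup G} (hH : Nat.card H = p) {h : G} (hh : h ∈ H) (h1 : h ≠ 1) (hL : h ∈ L) :
    H ≤ L := by
  have : Fact p.Prime := ⟨hp⟩
  intro x hx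
  obtain ⟨n, hn⟩ := Subgroup.mem_zpowers_iff.mp <|
    mem_zpowers_of_prime_card hH (g := ⟨h, hh⟩) (g' := ⟨x, hx⟩)
      (fun e => h1 (congrArg Subtype.val e))
  have : h ^ n = x := congrArg Subtype.val hn
  exact this ▸ zpow_mem hL n

/-- A subgroup of prime order which is adjacent in the transiso graph to a central subgroup
and which is contained in the Frattini subgroup is normal. -/
theorem TransisoAdj.normal_of_le_frattini {G : Type*} [Group G] [Finite G] {p : ℕ}
    (hp : p.Prime) {H Z : Subgroup G} (hadj : TransisoAdj H Z) (hZ : Z ≤ Subgroup.center G)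
    (hH : Nat.card H = p) (hF : H ≤ frattini G) : H.Normal := by
  by_contra hn
  obtain ⟨S, T, hS, hT, φ, hφ⟩ := hadj
  have hmul : ∀ x ∈ S, ∀ y ∈ S, x * y ∈ S := by
    intro x hx y hy
    obtain ⟨w, ⟨hw, h, hh, e⟩, -⟩ := hS.2 (x * y)
    have h1 : h = 1 := by
      by_contra h1
      have hle : H ≤ H.normalCore := Subgroup.le_of_card_prime_of_mem hp hH hh h1
        (hφ.conj_mem_of_le_center hS hT hZ hx hy hw hh e)
      exact hn (le_antisymm H.normalCore_le hle ▸ H.normalCore_normal)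
    rwa [e, h1, one_mul]
  let M : Submonoid G := ⟨⟨S, fun {a b} ha hb => hmul a ha b hb⟩, hS.1⟩
  let K : Subgroup G :=
    { M with
      inv_mem' := fun {x} hx => by
        have hx' : x⁻¹ ∈ Submonoid.powers x := by
          rw [mem_powers_iff_mem_zpowers]
          exact inv_mem (Subgroup.mem_zpowers x)
        exact (Submonoid.powers_le (P := M)).mpr hx hx' }
  have hHK : ∀ h ∈ H, h ∈ K → h = 1 := fun h hh hK =>
    hS.eq_of_mul_eq hK hS.1 (one_mem H) hh (by simp)
  have hH1 : ∃ h ∈ H, h ≠ 1 :=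
    H.bot_or_exists_ne_one.resolve_left fun e => hp.one_lt.ne (by rw [← hH, e]; simp)
  obtain ⟨h, hh, h1⟩ := hH1
  have hK : IsCoatom K := by
    refine ⟨fun e => h1 (hHK h hh (e ▸ Subgroup.mem_top h)), fun L hKL => ?_⟩
    obtain ⟨g, hgL, hgK⟩ := SetLike.exists_of_lt hKL
    obtain ⟨s, ⟨hs, k, hk, rfl⟩, -⟩ := hS.2 g
    have hkL : k ∈ L := (mul_mem_cancel_right (hKL.le hs)).mp hgL
    have hHL : H ≤ L := Subgroup.le_of_card_prime_of_mem hp hH hk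
      (fun e => hgK (by rw [e, one_mul]; exact hs)) hkL
    refine eq_top_iff.mpr fun g _ => ?_
    obtain ⟨t, ⟨ht, l, hl, rfl⟩, -⟩ := hS.2 g
    exact mul_mem (hHL hl) (hKL.le ht)
  exact h1 (hHK h hh (frattini_le_coatom hK (hF hh)))

/-- A nontrivial finite `p`-group has a central subgroup of order `p`. -/
theorem IsPGroup.exists_le_center_card_eq {G : Type*} [Group G] [Finite G] [Nontrivial G]
    {p : ℕ} (hp : p.Prime) (hG : IsPGroup p G) :
    ∃ Z : Subgroup G, Nat.card Z = p ∧ Z ≤ Subgroup.center G := by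
  have : Fact p.Prime := ⟨hp⟩
  have := hG.center_nontrivial
  obtain ⟨n, hn, hc⟩ := (hG.to_subgroup (Subgroup.center G)).nontrivial_iff_card.mp this
  obtain ⟨z, hz⟩ := exists_prime_orderOf_dvd_card' (G := Subgroup.center G) p
    (hc ▸ dvd_pow_self p hn.ne')
  refine ⟨Subgroup.zpowers (z : G), ?_, ?_⟩
  · rw [Nat.card_zpowers, Subgroup.orderOf_coe, hz]
  · simp

theorem stmt_12 {G : Type*} [Group G] [Finite G] (p : ℕ) (hp : p.Prime) (hodd : Odd p)
    (hpG : IsPGroup p G)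
    (hnc : ∃ H : Subgroup G, Nat.card H = p ∧ ¬ H ≤ Subgroup.center G)
    (hcomp : TransisoComplete G p) :
    ∀ H : Subgroup G, Nat.card H = p → H ≤ frattini G → H.Normal := by
  intro H hH hF
  have hHne : Nontrivial H := Finite.one_lt_card_iff_nontrivial.mp (hH ▸ hp.one_lt)
  have : Nontrivial G := Subtype.val_injective.nontrivial (α := H)
  obtain ⟨Z, hZ, hZc⟩ := hpG.exists_le_center_card_eq hp
  by_cases hHZ : H = Z
  · refine ⟨fun n hn g => ?_⟩
    rwa [Subgroup.mem_center_iff.mp (hZc (hHZ ▸ hn)) g, mul_inv_cancel_right]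
  · exact (hcomp H Z hH hZ hHZ).normal_of_le_frattini hp hZc hH hF
end

section
/- Let p be an odd prime and G a finite p-group having a subgroup of order p not contained in the center Z(G). Suppose the commutator subgroup G′ has order p, G′ is strictly contained in the Frattini subgroup Φ(G), and Φ(G) is not cyclic. Then the transiso graph Γ_p(G) is not complete, i.e., there exist two distinct subgroups of G of order p that admit no pair of isomorphic NRTs. -/
open scoped commutatorElement

/-- A subgroup of prime order is contained in any subgroup meeting it nontrivially. -/
theorem Subgroup.le_of_card_prime {G : Type*} [Group G] {p : ℕ} (hp : p.Prime)
    {H A : Subgroup G} (hH : Nat.card H = p) {h : G} (hh : h ∈ H) (h1 : h ≠ 1) (hA : h ∈ A) :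
    H ≤ A := by
  have := Fact.mk hp
  intro x hx
  have hmem : (⟨x, hx⟩ : H) ∈ Subgroup.zpowers (⟨h, hh⟩ : H) :=
    mem_zpowers_of_prime_card hH (fun e => h1 (congrArg Subtype.val e))
  obtain ⟨k, hk⟩ := Subgroup.mem_zpowers_iff.1 hmem
  have hk' : h ^ k = x := by simpa using congrArg Subtype.val hk
  exact hk' ▸ A.zpow_mem hA k

/-- In a finite `p`-group, a commutator subgroup of order `p` is central. -/
theorem commutator_le_center_of_card_prime {G : Type*} [Group G] [Finite G] {p : ℕ}
    (hp : p.Prime) (hpG : IsPGroup p G) (hcomm : Nat.card (commutator G) = p) :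
    commutator G ≤ Subgroup.center G := by
  have := Fact.mk hp
  have hnil : Group.IsNilpotent G := hpG.isNilpotent
  rw [← Subgroup.commutator_top_right_eq_bot_iff_le_center, Subgroup.eq_bot_iff_forall]
  by_contra! hne
  obtain ⟨c, hc, hc1⟩ := hne
  have hle : commutator G ≤ ⁅commutator G, (⊤ : Subgroup G)⁆ :=
    Subgroup.le_of_card_prime hp hcomm (Subgroup.commutator_le_left _ _ hc) hc1 hc
  have hall : ∀ n, commutator G ≤ (⊤ : Subgroup G).lowerCentralSeries n := by
    intro n
    induction n with
    | zero => exact le_top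
    | succ n ih => exact hle.trans (Subgroup.commutator_mono ih le_rfl)
  obtain ⟨n, hn⟩ := Subgroup.nilpotent_iff_lowerCentralSeries.1 hnil
  have hbot : commutator G = ⊥ := le_bot_iff.1 (hn ▸ hall n)
  rw [hbot, Subgroup.card_bot] at hcomm
  exact hp.one_lt.ne hcomm

/-- The power formula in nilpotency class two. -/
theorem mul_pow_of_central_commutator {G : Type*} [Group G] {x y c : G}
    (hc : c ∈ Subgroup.center G) (h : y * x = c * (x * y)) (n : ℕ) :
    y ^ n * x = c ^ n * (x * y ^ n) ∧ (x * y) ^ n = c ^ (n.choose 2) * (x ^ n * y ^ n) := by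
  have hcn : ∀ (k : ℕ) (g : G), g * c ^ k = c ^ k * g := fun k g =>
    Subgroup.mem_center_iff.1 (Subgroup.pow_mem _ hc k) g
  induction n with
  | zero => simp
  | succ n ih =>
    obtain ⟨h1, h2⟩ := ih
    refine ⟨?_, ?_⟩
    · calc y ^ (n + 1) * x = y ^ n * c ^ 1 * (x * y) := by rw [pow_succ, mul_assoc, h]; group
        _ = c ^ 1 * (y ^ n * x) * y := by rw [hcn]; group
        _ = c ^ (n + 1) * (x * y ^ (n + 1)) := by rw [h1]; group
    · have hch : (n + 1).choose 2 = n.choose 2 + n := by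
        rw [Nat.choose_succ_succ', Nat.choose_one_right, add_comm]
      calc (x * y) ^ (n + 1) = c ^ (n.choose 2) * x ^ n * (y ^ n * x) * y := by
            rw [pow_succ, h2]; group
        _ = c ^ (n.choose 2) * (x ^ n * c ^ n) * x * y ^ n * y := by rw [h1]; group
        _ = c ^ ((n + 1).choose 2) * (x ^ (n + 1) * y ^ (n + 1)) := by
            rw [hcn, hch, pow_add, pow_succ x, pow_succ y]; group

/-- For `p` an odd prime, raising to the power `p` is multiplicative when the commutator subgroup
is central of order `p`. -/
theorem mul_pow_of_card_commutator {G : Type*} [Group G] {p : ℕ} (hp : p.Prime) (hodd : Odd p)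
    (hcomm : Nat.card (commutator G) = p) (hcen : commutator G ≤ Subgroup.center G) (x y : G) :
    (x * y) ^ p = x ^ p * y ^ p := by
  have hc : ⁅y, x⁆ ∈ commutator G :=
    Subgroup.commutator_mem_commutator (Subgroup.mem_top y) (Subgroup.mem_top x)
  have h := (mul_pow_of_central_commutator (x := x) (y := y) (hcen hc)
    (by rw [commutatorElement_def]; group) p).2
  have hcp : ⁅y, x⁆ ^ p = 1 := by
    have := pow_card_eq_one' (x := (⟨_, hc⟩ : commutator G))
    rw [hcomm] at this
    simpa using congrArg Subtype.val this
  have h2 : 2 < p := by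
    have := hp.two_le
    rcases hodd with ⟨k, rfl⟩
    omega
  obtain ⟨k, hk⟩ := hp.dvd_choose_self two_ne_zero h2
  rw [h, hk, pow_mul, hcp, one_pow, one_mul]

/-- The Frattini subgroup lies in every subgroup with elementary abelian quotient. -/
theorem frattini_le_of_pow_mem {G : Type*} [Group G] [Finite G] {p : ℕ} (hp : p.Prime)
    {N : Subgroup G} (hN : commutator G ≤ N) (hpow : ∀ g : G, g ^ p ∈ N) : frattini G ≤ N := by
  intro x hx
  by_contra hxN
  obtain ⟨M, hNM, hM⟩ := Finite.exists_le_maximal (p := fun M : Subgroup G => N ≤ M ∧ x ∉ M)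
    ⟨le_rfl, hxN⟩
  obtain ⟨⟨-, hxM⟩, hmax⟩ := hM
  have hxT : ∀ T : Subgroup G, M < T → x ∈ T := fun T hT => by
    by_contra hxT
    exact hT.not_ge (hmax ⟨hNM.trans hT.le, hxT⟩ hT.le)
  have : M.Normal := Subgroup.Normal.of_commutator_le _ (hN.trans hNM)
  have htop : M ⊔ Subgroup.zpowers x = ⊤ := by
    refine (Subgroup.eq_top_iff' _).2 fun y => ?_
    by_cases hy : y ∈ M
    · exact le_sup_left (a := M) hy
    have hlt : M < M ⊔ Subgroup.zpowers y := lt_of_le_of_ne le_sup_left fun e =>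
      hy (e ▸ le_sup_right (a := M) (Subgroup.mem_zpowers y))
    obtain ⟨m, hm, z, hz, hmz⟩ := Subgroup.mem_sup_of_normal_left.1 (hxT _ hlt)
    obtain ⟨k, rfl⟩ := Subgroup.mem_zpowers_iff.1 hz
    have hyp : y ^ (p : ℤ) ∈ M := by exact_mod_cast hNM (hpow y)
    have hk : IsCoprime (p : ℤ) k := by
      refine (Nat.prime_iff_prime_int.1 hp).coprime_iff_not_dvd.2 ?_
      rintro ⟨l, rfl⟩
      exact hxM (hmz ▸ M.mul_mem hm (by rw [zpow_mul]; exact M.zpow_mem hyp l))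
    obtain ⟨u, v, huv⟩ := hk
    have hyk : y ^ k ∈ M ⊔ Subgroup.zpowers x := by
      rw [show y ^ k = m⁻¹ * x by rw [← hmz]; group]
      exact Subgroup.mul_mem _ (le_sup_left (a := M) (M.inv_mem hm))
        (le_sup_right (a := M) (Subgroup.mem_zpowers x))
    have : y = (y ^ (p : ℤ)) ^ u * (y ^ k) ^ v := by
      rw [← zpow_mul, ← zpow_mul, ← zpow_add, mul_comm _ u, mul_comm k, huv, zpow_one]
    rw [this]
    exact Subgroup.mul_mem _ (Subgroup.zpow_mem _ (le_sup_left (a := M) hyp) u)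
      (Subgroup.zpow_mem _ hyk v)
  have hco : IsCoatom M := ⟨fun e => hxM (e ▸ Subgroup.mem_top x), fun T hT => by
    rw [eq_top_iff, ← htop]
    exact sup_le hT.le (Subgroup.zpowers_le.2 (hxT T hT))⟩
  exact hxM (frattini_le_coatom hco hx)

/-- In an abelian group, if the `p`-torsion has at most `p` elements then the `p ^ k`-torsion has
at most `p ^ k` elements. -/
theorem card_ker_pow_le {A : Type*} [CommGroup A] [Finite A] {p : ℕ}
    (h : Nat.card (powMonoidHom p : A →* A).ker ≤ p) (k : ℕ) :
    Nat.card (powMonoidHom (p ^ k) : A →* A).ker ≤ p ^ k := by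
  induction k with
  | zero =>
    have : (powMonoidHom (p ^ 0) : A →* A).ker = ⊥ := by
      ext x; simp [MonoidHom.mem_ker]
    rw [this, Subgroup.card_bot, pow_zero]
  | succ k ih =>
    let Q := (powMonoidHom (p ^ (k + 1)) : A →* A).ker
    let f : Q →* A := (powMonoidHom p).comp Q.subtype
    have hr : Nat.card f.range ≤ p ^ k := by
      refine le_trans (Subgroup.card_le_of_le ?_) ih
      rintro _ ⟨⟨x, hx⟩, rfl⟩
      have hx' : x ^ p ^ (k + 1) = 1 := hx
      simp only [MonoidHom.mem_ker, f, MonoidHom.comp_apply, powMonoidHom_apply,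
        Subgroup.subtype_apply]
      rw [← pow_mul, ← pow_succ', hx']
    have hk : Nat.card f.ker ≤ p := by
      refine le_trans (Nat.card_le_card_of_injective
        (fun x : f.ker => (⟨x.1.1, x.2⟩ : (powMonoidHom p : A →* A).ker)) ?_) h
      intro x y hxy
      have hxy' := congrArg Subtype.val hxy
      exact Subtype.ext (Subtype.ext hxy')
    calc Nat.card Q = Nat.card f.ker * f.ker.index := (Subgroup.card_mul_index _).symm
      _ = Nat.card f.ker * Nat.card f.range := by rw [Subgroup.index_ker]
      _ ≤ p * p ^ k := Nat.mul_le_mul hk hr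
      _ = p ^ (k + 1) := (pow_succ' p k).symm

/-- A finite abelian `p`-group with at most `p` elements of order dividing `p` is cyclic. -/
theorem IsPGroup.isCyclic_of_card_ker_pow_le {A : Type*} [CommGroup A] [Finite A] {p : ℕ}
    (hp : p.Prime) (hA : IsPGroup p A) (h : Nat.card (powMonoidHom p : A →* A).ker ≤ p) :
    IsCyclic A := by
  classical
  have := Fintype.ofFinite A
  refine isCyclic_of_card_pow_eq_one_le fun n hn => ?_
  obtain ⟨k, m, hm, rfl⟩ := Nat.exists_eq_pow_mul_and_not_dvd hn.ne' p hp.ne_one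
  have hm0 : 0 < m := Nat.pos_of_ne_zero (by rintro rfl; simp at hm)
  refine le_trans ?_ ((card_ker_pow_le h k).trans (Nat.le_mul_of_pos_right _ hm0))
  rw [← SetLike.coe_sort_coe, Nat.card_eq_fintype_card, ← Set.toFinset_card]
  refine Finset.card_le_card fun x hx => ?_
  simp only [Finset.mem_filter, Finset.mem_univ, true_and] at hx
  simp only [Set.mem_toFinset, SetLike.mem_coe, MonoidHom.mem_ker, powMonoidHom_apply]
  have hcop : (orderOf (x ^ p ^ k)).Coprime m :=
    hA.orderOf_coprime ((Nat.Prime.coprime_iff_not_dvd hp).2 hm) _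
  rw [← orderOf_eq_one_iff]
  exact Nat.eq_one_of_dvd_coprimes hcop dvd_rfl (orderOf_dvd_of_pow_eq_one (by rw [← pow_mul, hx]))

/-- If a central subgroup `K` is adjacent to a core-free subgroup `H` in the transiso graph, then
`G ⧸ K` is isomorphic to a complement of `H`, given here as the image of an endomorphism of `G`
with kernel `K`. -/
theorem TransisoAdj.exists_endomorphism {G : Type*} [Group G] {K H : Subgroup G}
    (hadj : TransisoAdj K H) (hK : K ≤ Subgroup.center G)
    (hcore : ∀ h : G, (∀ g : G, g * h * g⁻¹ ∈ H) → h = 1) :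
    ∃ ψ : G →* G, ψ.ker = K ∧ ∀ g, ∃ h ∈ H, ∃ a, g = h * ψ a := by
  obtain ⟨S₁, S₂, ⟨h1S₁, hS₁⟩, ⟨-, hS₂⟩, φ, hφ, hmul⟩ := hadj
  choose r hr hruniq using hS₁
  have hrK : ∀ g, g * (r g)⁻¹ ∈ K := fun g => by
    obtain ⟨k, hk, e⟩ := (hr g).2
    rwa [mul_inv_eq_of_eq_mul e]
  have hr_one : ∀ z ∈ K, r z = 1 := fun z hz =>
    (hruniq z 1 ⟨h1S₁, z, hz, (mul_one z).symm⟩).symm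
  have hcov : ∀ g, ∃ h ∈ H, ∃ a, g = h * φ (r a) := fun g => by
    obtain ⟨s, ⟨hs, h, hh, e⟩, -⟩ := hS₂ g
    obtain ⟨a, ha, rfl⟩ := hφ.surjOn hs
    refine ⟨h, hh, a, ?_⟩
    rw [← hruniq a a ⟨ha, 1, K.one_mem, (one_mul a).symm⟩]
    exact e
  have hψ : ∀ a b, ∃ h ∈ H, φ (r a) * φ (r b) = h * φ (r (a * b)) := fun a b => by
    refine hmul _ (hr a).1 _ (hr b).1 _ (hr _).1 ⟨r a * r b * (r (a * b))⁻¹, ?_, by group⟩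
    have hc := Subgroup.mem_center_iff.1 (hK (K.inv_mem (hrK b))) (r a)
    have e : r a * r b * (r (a * b))⁻¹ =
        (a * (r a)⁻¹)⁻¹ * (b * (r b)⁻¹)⁻¹ * (a * b * (r (a * b))⁻¹) := by
      have e1 : r a * (b * (r b)⁻¹)⁻¹ * b = (b * (r b)⁻¹)⁻¹ * r a * b := by rw [hc]
      have e2 : r a * r b = (b * (r b)⁻¹)⁻¹ * r a * b := by rw [← e1]; group
      have hc' := Subgroup.mem_center_iff.1 (hK (K.inv_mem (hrK b))) (a * (r a)⁻¹)⁻¹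
      rw [e2, hc']
      group
    rw [e]
    exact K.mul_mem (K.mul_mem (K.inv_mem (hrK a)) (K.inv_mem (hrK b))) (hrK _)
  choose f hfH hf using hψ
  have hf1 : ∀ b c, f b c = 1 := fun b c => by
    refine hcore _ fun g => ?_
    obtain ⟨h, hh, a, rfl⟩ := hcov g
    have key : φ (r a) * f b c * (φ (r a))⁻¹ = f a b * f (a * b) c * (f a (b * c))⁻¹ := by
      have e1 : φ (r a) * f b c * φ (r (b * c)) = f a b * f (a * b) c * φ (r (a * b * c)) := by
        rw [mul_assoc, ← hf, ← mul_assoc, hf, mul_assoc, hf, mul_assoc a, ← mul_assoc (f a b)]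
      have e2 := hf a (b * c)
      rw [← mul_assoc a] at e2
      rw [eq_mul_inv_iff_mul_eq, ← mul_left_inj (φ (r (a * b * c))), ← e1, mul_assoc _ (f a _),
        ← e2]
      group
    rw [mul_inv_rev, show h * φ (r a) * f b c * ((φ (r a))⁻¹ * h⁻¹) =
      h * (φ (r a) * f b c * (φ (r a))⁻¹) * h⁻¹ by group, key]
    exact H.mul_mem (H.mul_mem hh (H.mul_mem (H.mul_mem (hfH _ _) (hfH _ _))
      (H.inv_mem (hfH _ _)))) (H.inv_mem hh)
  let ψ : G →* G := MonoidHom.mk' (fun g => φ (r g)) fun a b => by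
    simp only [hf, hf1, one_mul]
  have hψ1 : φ (r 1) = 1 := ψ.map_one
  refine ⟨ψ, le_antisymm (fun z hz => ?_) (fun z hz => ?_), hcov⟩
  · have hz' : φ (r z) = 1 := hz
    have e := hφ.injOn (hr z).1 (hr 1).1 (hz'.trans hψ1.symm)
    have := hrK z
    rwa [e, hr_one 1 K.one_mem, inv_one, mul_one] at this
  · change φ (r z) = 1
    exact (congrArg φ ((hr_one z hz).trans (hr_one 1 K.one_mem).symm)).trans hψ1

theorem stmt_14 {G : Type*} [Group G] [Finite G] (p : ℕ) (hp : p.Prime) (hodd : Odd p)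
    (hpG : IsPGroup p G)
    (hnc : ∃ H : Subgroup G, Nat.card H = p ∧ ¬ H ≤ Subgroup.center G)
    (hcomm : Nat.card (commutator G) = p)
    (hlt : commutator G < frattini G)
    (hncyc : ¬ IsCyclic (frattini G)) :
    ¬ TransisoComplete G p := by
  intro hcomplete
  obtain ⟨H, hH, hHZ⟩ := hnc
  have hcen := commutator_le_center_of_card_prime hp hpG hcomm
  have hc_pow : ∀ c ∈ commutator G, c ^ p = 1 := fun c hc => by
    have := pow_card_eq_one' (x := (⟨c, hc⟩ : commutator G))
    rw [hcomm] at this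
    simpa using congrArg Subtype.val this
  have hh_pow : ∀ h ∈ H, h ^ p = 1 := fun h hh => by
    have := pow_card_eq_one' (x := (⟨h, hh⟩ : H))
    rw [hH] at this
    simpa using congrArg Subtype.val this
  have hpow := mul_pow_of_card_commutator hp hodd hcomm hcen
  let π : G →* G := MonoidHom.mk' (· ^ p) hpow
  let P : Subgroup G := commutator G ⊔ π.range
  have hFP : frattini G ≤ P := frattini_le_of_pow_mem hp le_sup_left fun g =>
    le_sup_right (a := commutator G) ⟨g, rfl⟩
  have hPZ : P ≤ Subgroup.center G := by
    refine sup_le hcen ?_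
    rintro _ ⟨g, rfl⟩
    refine Subgroup.mem_center_iff.2 fun y => ?_
    have hc : ⁅y, g⁆ ∈ commutator G :=
      Subgroup.commutator_mem_commutator (Subgroup.mem_top y) (Subgroup.mem_top g)
    have e : π (⁅y, g⁆ * (g * y)) = π (y * g) := by
      congr 1
      rw [commutatorElement_def]
      group
    have hgc : π ⁅y, g⁆ = 1 := hc_pow _ hc
    have e2 : (y * g * y⁻¹) ^ p = g ^ p := by
      change π (y * g * y⁻¹) = π g
      rw [map_mul, ← e, map_mul, hgc, one_mul, map_mul, map_inv, mul_inv_cancel_right]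
    rw [conj_pow] at e2
    exact mul_inv_eq_iff_eq_mul.1 e2
  obtain ⟨z, hzF, hzp, hzc⟩ : ∃ z ∈ frattini G, z ^ p = 1 ∧ z ∉ commutator G := by
    by_contra! hall
    refine hncyc ?_
    let _ : CommGroup (frattini G) :=
      { (inferInstance : Group (frattini G)) with
        mul_comm := fun a b => Subtype.ext
          (Subgroup.mem_center_iff.1 (hPZ (hFP b.2)) a.1) }
    refine IsPGroup.isCyclic_of_card_ker_pow_le hp (hpG.to_subgroup _) ?_
    refine le_trans (Nat.card_le_card_of_injective
      (fun x => (⟨x.1.1, hall _ x.1.2 (congrArg Subtype.val x.2)⟩ : commutator G)) ?_) hcomm.le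
    intro x y hxy
    have hxy' := congrArg Subtype.val hxy
    exact Subtype.ext (Subtype.ext hxy')
  have hz1 : z ≠ 1 := fun e => hzc (e ▸ Subgroup.one_mem _)
  have hzK : z ∈ Subgroup.zpowers z := Subgroup.mem_zpowers z
  have := Fact.mk hp
  have hK : Nat.card (Subgroup.zpowers z) = p := by
    rw [Nat.card_zpowers, orderOf_eq_prime hzp hz1]
  have hKZ : Subgroup.zpowers z ≤ Subgroup.center G := Subgroup.zpowers_le.2 (hPZ (hFP hzF))
  have hcore : ∀ h : G, (∀ g : G, g * h * g⁻¹ ∈ H) → h = 1 := by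
    intro h hconj
    have hh : h ∈ H := by simpa using hconj 1
    by_contra h1
    refine hHZ (Subgroup.le_of_card_prime hp hH hh h1 (Subgroup.mem_center_iff.2 fun g => ?_))
    rw [← commutatorElement_eq_one_iff_mul_comm]
    by_contra hne
    exact hHZ ((Subgroup.le_of_card_prime hp hH (H.mul_mem (hconj g) (H.inv_mem hh)) hne
      (Subgroup.commutator_mem_commutator (Subgroup.mem_top g) (Subgroup.mem_top h))).trans hcen)
  obtain ⟨ψ, hker, hcov⟩ := (hcomplete (Subgroup.zpowers z) H hK hH
    (fun e => hHZ (e ▸ hKZ))).exists_endomorphism hKZ hcore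
  have hψG : commutator G ≤ (commutator G).map ψ := by
    have hmap : (commutator G).map ψ ≤ commutator G := by
      rw [commutator_def, Subgroup.map_commutator]
      exact Subgroup.commutator_mono le_top le_top
    obtain ⟨c, hc, hc1⟩ : ∃ c ∈ commutator G, c ≠ 1 := by
      by_contra! hbot
      rw [(Subgroup.eq_bot_iff_forall _).2 hbot, Subgroup.card_bot] at hcomm
      exact hp.one_lt.ne hcomm
    have hψc : ψ c ∈ (commutator G).map ψ := Subgroup.mem_map_of_mem ψ hc
    refine Subgroup.le_of_card_prime hp hcomm (hmap hψc) (fun e => hzc ?_) hψc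
    exact Subgroup.le_of_card_prime hp hK (hker ▸ ψ.mem_ker.2 e) hc1 hc hzK
  have hψP : P ≤ P.map ψ := by
    refine sup_le (hψG.trans (Subgroup.map_mono le_sup_left)) ?_
    rintro _ ⟨g, rfl⟩
    obtain ⟨h, hh, a, rfl⟩ := hcov g
    refine ⟨π a, le_sup_right (a := commutator G) ⟨a, rfl⟩, ?_⟩
    have hπh : π h = 1 := hh_pow h hh
    rw [map_mul, hπh, one_mul]
    exact map_pow ψ a p
  have hcard : Nat.card P ≤ Nat.card (P.map ψ) := Subgroup.card_le_of_le hψP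
  have hbij : Function.Bijective (ψ.subgroupMap P) :=
    (ψ.subgroupMap_surjective P).bijective_of_nat_card_le hcard
  have hψz : ψ z = 1 := ψ.mem_ker.1 (hker.symm ▸ hzK)
  have e : (⟨z, hFP hzF⟩ : P) = 1 := hbij.1 (Subtype.ext (by simpa using hψz))
  exact hz1 (congrArg Subtype.val e)
end

section
/- Let p be an odd prime and G a group of order p⁴ having a subgroup of order p not contained in the center Z(G), such that the Frattini subgroup Φ(G) equals the center Z(G) and Z(G) is isomorphic to C_p × C_p. Then the transiso graph Γ_p(G) is not complete, i.e., there exist two distinct subgroups of G of order p that admit no pair of isomorphic NRTs. -/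
open scoped commutatorElement

/-- In a group of order `p ^ 4` with center of order `p ^ 2`, a subgroup that contains the center
and two non-commuting elements is the whole group. -/
theorem eq_top_of_center_le_of_not_commute {G : Type*} [Group G] {p : ℕ} (hp : p.Prime)
    (hcard : Nat.card G = p ^ 4) (hZ : Nat.card (Subgroup.center G) = p ^ 2) {a b : G}
    (hab : ¬ Commute a b) {L : Subgroup G} (hL : Subgroup.center G ≤ L) (ha : a ∈ L)
    (hb : b ∈ L) : L = ⊤ := by
  have : Finite G := Nat.finite_of_card_ne_zero (by rw [hcard]; exact pow_ne_zero _ hp.ne_zero)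
  have key : ∀ A B : Subgroup G, A < B → ∀ k, Nat.card A = p ^ k →
      ∃ l, k < l ∧ Nat.card B = p ^ l := by
    intro A B hAB k hk
    obtain ⟨l, -, hl⟩ := (Nat.dvd_prime_pow hp).1 (hcard ▸ B.card_subgroup_dvd_card)
    refine ⟨l, ?_, hl⟩
    by_contra! hlk
    have hle : Nat.card B ≤ Nat.card A := by
      rw [hk, hl]
      exact Nat.pow_le_pow_right hp.pos hlk
    exact hAB.ne (Subgroup.eq_of_le_of_card_ge hAB.le hle)
  have h₁ : Subgroup.center G < L ⊓ Subgroup.centralizer {a} := by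
    refine lt_of_le_of_ne (le_inf hL (Subgroup.center_le_centralizer _)) fun h => hab ?_
    have haZ : a ∈ Subgroup.center G := by
      rw [h]
      exact ⟨ha, Subgroup.mem_centralizer_singleton_iff.2 rfl⟩
    exact (Subgroup.mem_center_iff.1 haZ b).symm
  have h₂ : L ⊓ Subgroup.centralizer {a} < L := by
    refine lt_of_le_of_ne inf_le_left fun h => hab ?_
    have hbC : b ∈ L ⊓ Subgroup.centralizer {a} := by rwa [h]
    exact (Subgroup.mem_centralizer_singleton_iff.1 hbC.2).symm
  obtain ⟨k, hk, hk'⟩ := key _ _ h₁ 2 hZ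
  obtain ⟨l, hl, hl'⟩ := key _ _ h₂ k hk'
  refine Subgroup.eq_top_of_le_card L ?_
  rw [hcard, hl']
  exact Nat.pow_le_pow_right hp.pos (by omega)

/-- In a group of order `p ^ 4` with center of order `p ^ 2`, a normal subgroup containing one
nontrivial commutator contains them all. -/
theorem commutatorElement_mem_of_not_commute {G : Type*} [Group G] {p : ℕ} (hp : p.Prime)
    (hcard : Nat.card G = p ^ 4) (hZ : Nat.card (Subgroup.center G) = p ^ 2) {a b : G}
    (hab : ¬ Commute a b) {N : Subgroup G} [N.Normal] (hN : ⁅a, b⁆ ∈ N) (x y : G) :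
    ⁅x, y⁆ ∈ N := by
  let f := QuotientGroup.mk' N
  have hf : ∀ x y : G, ⁅x, y⁆ ∈ N ↔ Commute (f x) (f y) := by
    intro x y
    rw [← commutatorElement_eq_one_iff_commute, ← map_commutatorElement]
    exact (QuotientGroup.eq_one_iff _).symm
  have hfab := (hf a b).1 hN
  have hcomap : ∀ L : Subgroup (G ⧸ N), Subgroup.center (G ⧸ N) ≤ L → f a ∈ L → f b ∈ L →
      L.comap f = ⊤ := by
    intro L hL ha hb
    refine eq_top_of_center_le_of_not_commute hp hcard hZ hab (fun z hz => hL ?_) ha hb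
    refine Subgroup.mem_center_iff.2 fun q => ?_
    obtain ⟨g, rfl⟩ := QuotientGroup.mk'_surjective N q
    change f g * f z = f z * f g
    rw [← map_mul, ← map_mul, Subgroup.mem_center_iff.1 hz g]
  have hcenter : ∀ u : G, Commute (f a) (f u) → Commute (f b) (f u) →
      f u ∈ Subgroup.center (G ⧸ N) := by
    intro u hua hub
    have h := hcomap (Subgroup.centralizer {f u}) (Subgroup.center_le_centralizer _)
      (Subgroup.mem_centralizer_singleton_iff.2 hua) (Subgroup.mem_centralizer_singleton_iff.2 hub)
    refine Subgroup.mem_center_iff.2 fun q => ?_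
    obtain ⟨g, rfl⟩ := QuotientGroup.mk'_surjective N q
    have hg : g ∈ (Subgroup.centralizer {f u}).comap f := h ▸ Subgroup.mem_top g
    exact Subgroup.mem_centralizer_singleton_iff.1 hg
  have htop := hcomap _ le_rfl (hcenter a (Commute.refl _) hfab.symm) (hcenter b hfab (Commute.refl _))
  have hx : x ∈ (Subgroup.center (G ⧸ N)).comap f := htop ▸ Subgroup.mem_top x
  exact (hf x y).2 (Subgroup.mem_center_iff.1 hx (f y)).symm

/-- If a subgroup `H₁` containing all commutators is adjacent to a central subgroup `H₂`,
then `H₂` contains all commutators as well. -/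
theorem TransisoAdj.commutatorElement_mem {G : Type*} [Group G] {H₁ H₂ : Subgroup G}
    (h : TransisoAdj H₁ H₂) (h₁ : ∀ x y : G, ⁅x, y⁆ ∈ H₁) (h₂ : H₂ ≤ Subgroup.center G)
    (x y : G) : ⁅x, y⁆ ∈ H₂ := by
  obtain ⟨S₁, S₂, hS₁, hS₂, φ, hφ, hmul⟩ := h
  have hcomm : ∀ s ∈ S₂, ∀ t ∈ S₂, ⁅s, t⁆ ∈ H₂ := by
    intro s hs t ht
    obtain ⟨u, hu, rfl⟩ := hφ.surjOn hs
    obtain ⟨v, hv, rfl⟩ := hφ.surjOn ht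
    obtain ⟨z, ⟨hz, k, hk, hvu⟩, -⟩ := hS₁.2 (v * u)
    have huv : u * v = ⁅u, v⁆ * k * z := by
      rw [mul_assoc, ← hvu, commutatorElement_def]
      group
    obtain ⟨m, hm, hm'⟩ := hmul u hu v hv z hz ⟨_, mul_mem (h₁ u v) hk, huv⟩
    obtain ⟨n, hn, hn'⟩ := hmul v hv u hu z hz ⟨k, hk, hvu⟩
    have hmn : ⁅φ u, φ v⁆ = m * n⁻¹ := by
      calc ⁅φ u, φ v⁆ = (φ u * φ v) * (φ v * φ u)⁻¹ := by
            rw [commutatorElement_def]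
            group
        _ = m * n⁻¹ := by
            rw [hm', hn']
            group
    rw [hmn]
    exact mul_mem hm (inv_mem hn)
  obtain ⟨s, ⟨hs, k, hk, rfl⟩, -⟩ := hS₂.2 x
  obtain ⟨t, ⟨ht, m, hm, rfl⟩, -⟩ := hS₂.2 y
  have hk' := Subgroup.mem_center_iff.1 (h₂ hk)
  have hm' := Subgroup.mem_center_iff.1 (h₂ hm)
  have hst : ⁅k * s, m * t⁆ = ⁅s, t⁆ := by
    have e₁ : k * s * (m * t) = k * m * (s * t) := by
      rw [mul_assoc, ← mul_assoc s, hm' s, mul_assoc m, ← mul_assoc]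
    have e₂ : m * t * (k * s) = k * m * (t * s) := by
      rw [mul_assoc, ← mul_assoc t, hk' t, mul_assoc k, ← mul_assoc, hk' m]
    calc ⁅k * s, m * t⁆ = k * s * (m * t) * (m * t * (k * s))⁻¹ := by
          rw [commutatorElement_def]
          group
      _ = k * m * ⁅s, t⁆ * (k * m)⁻¹ := by
          rw [e₁, e₂, commutatorElement_def]
          group
      _ = ⁅s, t⁆ := by
          rw [← Subgroup.mem_center_iff.1 (mul_mem (h₂ hk) (h₂ hm)) ⁅s, t⁆, mul_inv_cancel_right]
  rw [hst]
  exact hcomm s hs t ht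

theorem stmt_15 {G : Type*} [Group G] (p : ℕ) (hp : p.Prime) (hodd : Odd p)
    (hcard : Nat.card G = p ^ 4)
    (hnc : ∃ H : Subgroup G, Nat.card H = p ∧ ¬ H ≤ Subgroup.center G)
    (hΦZ : frattini G = Subgroup.center G)
    (hZ : Nonempty ((Subgroup.center G) ≃*
      (Multiplicative (ZMod p) × Multiplicative (ZMod p)))) :
    ¬ TransisoComplete G p := by
  have : Fact p.Prime := ⟨hp⟩
  have : Finite G := Nat.finite_of_card_ne_zero (by rw [hcard]; exact pow_ne_zero _ hp.ne_zero)
  obtain ⟨e⟩ := hZ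
  have hZcard : Nat.card (Subgroup.center G) = p ^ 2 := by
    rw [Nat.card_congr e.toEquiv, Nat.card_prod, Nat.card_congr Multiplicative.toAdd, Nat.card_zmod,
      sq]
  have hexp : ∀ z ∈ Subgroup.center G, z ^ p = 1 := by
    intro z hz
    have hpow : (⟨z, hz⟩ : Subgroup.center G) ^ p = 1 := by
      apply e.injective
      rw [map_pow, map_one]
      ext <;> simp [toAdd_pow]
    simpa using congrArg Subtype.val hpow
  have hzp : ∀ z ∈ Subgroup.center G, z ≠ 1 → Nat.card (Subgroup.zpowers z) = p :=
    fun z hz h1 => (Nat.card_zpowers z).trans (orderOf_eq_prime (hexp z hz) h1)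
  obtain ⟨a, b, hab⟩ : ∃ a b : G, ¬ Commute a b := by
    by_contra! h
    have htop : Subgroup.center G = ⊤ :=
      eq_top_iff.2 fun x _ => Subgroup.mem_center_iff.2 fun y => h y x
    rw [htop, Subgroup.card_top, hcard] at hZcard
    exact absurd (Nat.pow_right_injective hp.two_le hZcard) (by norm_num)
  have hc1 : ⁅a, b⁆ ≠ 1 := fun h => hab (commutatorElement_eq_one_iff_commute.1 h)
  have hcZ : ⁅a, b⁆ ∈ Subgroup.center G := by
    have hQ : Nat.card (G ⧸ Subgroup.center G) = p ^ 2 := by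
      have h := Subgroup.card_eq_card_quotient_mul_card_subgroup (Subgroup.center G)
      rw [hcard, hZcard] at h
      exact Nat.eq_of_mul_eq_mul_right (pow_pos hp.pos 2) (by rw [← h, ← pow_add])
    rw [← QuotientGroup.eq_one_iff, ← QuotientGroup.mk'_apply, map_commutatorElement,
      commutatorElement_eq_one_iff_commute]
    exact (IsPGroup.isMulCommutative_of_card_eq_prime_sq hQ).is_comm.comm _ _
  have hN₁ := hzp _ hcZ hc1
  obtain ⟨d, hdZ, hd⟩ : ∃ d ∈ Subgroup.center G, d ∉ Subgroup.zpowers ⁅a, b⁆ := by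
    by_contra! h
    have hle := Nat.le_of_dvd Nat.card_pos (Subgroup.card_dvd_of_le h)
    rw [hZcard, hN₁] at hle
    nlinarith [hp.two_le]
  have hd1 : d ≠ 1 := fun h => hd (h ▸ one_mem _)
  have hN₂ := hzp d hdZ hd1
  have hne : Subgroup.zpowers ⁅a, b⁆ ≠ Subgroup.zpowers d :=
    fun h => hd (h ▸ Subgroup.mem_zpowers d)
  have : (Subgroup.zpowers ⁅a, b⁆).Normal :=
    ⟨fun n hn g => by
      rwa [Subgroup.mem_center_iff.1 (Subgroup.zpowers_le.2 hcZ hn) g, mul_inv_cancel_right]⟩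
  intro hcomplete
  have hmem := (hcomplete _ _ hN₁ hN₂ hne).commutatorElement_mem
    (commutatorElement_mem_of_not_commute hp hcard hZcard hab (Subgroup.mem_zpowers _))
    (Subgroup.zpowers_le.2 hdZ) a b
  exact hne (Subgroup.eq_of_le_of_card_ge (Subgroup.zpowers_le.2 hmem) (by rw [hN₁, hN₂]))
end

section
/- Let p be an odd prime and G a group of order p⁴ having a subgroup of order p not contained in the center Z(G). Then the transiso graph Γ_p(G) is not complete, i.e., there exist two distinct subgroups of G of order p that admit no pair of isomorphic NRTs. -/
open scoped commutatorElement

/-- An isomorphism from an NRT of a normal subgroup `H₁` to an NRT of `H₂` extends to a map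
`F : G → G`, constant on the cosets of `H₁`, whose image is the second NRT. -/
theorem TransisoAdj.exists_lift {G : Type*} [Group G] {H₁ H₂ : Subgroup G} [H₁.Normal]
    (hadj : TransisoAdj H₁ H₂) :
    ∃ F : G → G, F 1 = 1 ∧ (∀ x, F x = 1 ↔ x ∈ H₁) ∧
      (∀ x y, ∃ h ∈ H₂, F x * F y = h * F (x * y)) ∧
      (∀ g, ∃ x, ∃ h ∈ H₂, g = h * F x) ∧
      (∀ x, F x ∈ H₂ → F x = 1) ∧ ∀ x y, y * x⁻¹ ∈ H₁ → F x = F y := by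
  obtain ⟨S₁, S₂, ⟨h1S₁, hS₁⟩, ⟨h1S₂, hS₂⟩, φ, hφ, hmul⟩ := hadj
  choose r hr hru using hS₁
  have hrS : ∀ x, r x ∈ S₁ := fun x => (hr x).1
  have hr' : ∀ x, x * (r x)⁻¹ ∈ H₁ := by
    intro x
    obtain ⟨h, hh, e⟩ := (hr x).2
    have : x * (r x)⁻¹ = h := by rw [mul_inv_eq_iff_eq_mul]; exact e
    rwa [this]
  have hruniq : ∀ x s, s ∈ S₁ → x * s⁻¹ ∈ H₁ → s = r x := fun x s hs hx =>
    hru x s ⟨hs, _, hx, by group⟩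
  have hr1 : r 1 = 1 := (hruniq 1 1 h1S₁ (by simp)).symm
  have hone : ∀ s ∈ S₂, s ∈ H₂ → s = 1 := fun s hs hsH =>
    (hS₂ s).unique ⟨hs, 1, H₂.one_mem, by simp⟩ ⟨h1S₂, s, hsH, by simp⟩
  have hφ1 : φ 1 = 1 := by
    obtain ⟨h, hh, e⟩ := hmul 1 h1S₁ 1 h1S₁ 1 h1S₁ ⟨1, H₁.one_mem, by simp⟩
    exact hone _ (hφ.mapsTo h1S₁) (by rw [mul_right_cancel e]; exact hh)
  refine ⟨fun x => φ (r x), by simp [hr1, hφ1], ?_, ?_, ?_, ?_, ?_⟩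
  · intro x
    constructor
    · intro h
      have : r x = 1 := hφ.injOn (hrS x) h1S₁ (h.trans hφ1.symm)
      simpa [this] using hr' x
    · intro h
      have : (1 : G) = r x := hruniq x 1 h1S₁ (by simpa using h)
      simp [← this, hφ1]
  · intro x y
    refine hmul _ (hrS x) _ (hrS y) _ (hrS _) ⟨r x * r y * (r (x * y))⁻¹, ?_, by group⟩
    have hx : ((r x : G) : G ⧸ H₁) = x := by
      have := hr' x
      rw [← QuotientGroup.eq_one_iff, QuotientGroup.mk_mul, QuotientGroup.mk_inv,
        mul_inv_eq_one] at this
      exact this.symm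
    have hy : ((r y : G) : G ⧸ H₁) = y := by
      have := hr' y
      rw [← QuotientGroup.eq_one_iff, QuotientGroup.mk_mul, QuotientGroup.mk_inv,
        mul_inv_eq_one] at this
      exact this.symm
    have hxy := hr' (x * y)
    rw [← QuotientGroup.eq_one_iff] at hxy ⊢
    simpa [hx, hy] using hxy
  · intro g
    obtain ⟨s, ⟨hs, h, hh, e⟩, -⟩ := hS₂ g
    obtain ⟨t, ht, rfl⟩ := hφ.surjOn hs
    refine ⟨t, h, hh, ?_⟩
    have : t = r t := hruniq t t ht (by simp)
    rw [e]
    exact congrArg (fun u => h * φ u) this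
  · exact fun x hx => hone _ (hφ.mapsTo (hrS x)) hx
  · intro x y hyx
    have : r x = r y := hruniq y (r x) (hrS x) (by
      have := H₁.mul_mem hyx (hr' x)
      simpa [mul_assoc] using this)
    exact congrArg φ this

/-- If `H₁` is normal, `H₂` has trivial normal core, and both are adjacent, then `H₂` has
a complement isomorphic to `G ⧸ H₁`. -/
theorem TransisoAdj.exists_hom {G : Type*} [Group G] {H₁ H₂ : Subgroup G} [H₁.Normal]
    (hcore : H₂.normalCore = ⊥) (hadj : TransisoAdj H₁ H₂) :
    ∃ f : G →* G, f.ker = H₁ ∧ Disjoint H₂ f.range := by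
  obtain ⟨F, h1, hker, hmul, hsurj, hone, -⟩ := hadj.exists_lift
  have hFmul : ∀ x y, F (x * y) = F x * F y := by
    intro x y
    obtain ⟨c, hc, e⟩ := hmul x y
    have hconj : ∀ q, F q * c * (F q)⁻¹ ∈ H₂ := by
      intro q
      obtain ⟨a, ha, ea⟩ := hmul q x
      obtain ⟨b, hb, eb⟩ := hmul (q * x) y
      obtain ⟨d, hd, ed⟩ := hmul q (x * y)
      have : F q * c * (F q)⁻¹ = a * b * d⁻¹ := by
        have h2 : F q * c = a * b * F (q * x * y) * (F (x * y))⁻¹ := by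
          rw [eq_mul_inv_iff_mul_eq, mul_assoc, ← e, ← mul_assoc, ea, mul_assoc, eb, ← mul_assoc]
        have h3 : F (q * x * y) = d⁻¹ * (F q * F (x * y)) := by
          rw [ed, mul_assoc q]; group
        rw [h2, h3]; group
      rw [this]
      exact H₂.mul_mem (H₂.mul_mem ha hb) (H₂.inv_mem hd)
    have hcc : c ∈ H₂.normalCore := by
      intro g
      obtain ⟨q, h, hh, rfl⟩ := hsurj g
      have : h * F q * c * (h * F q)⁻¹ = h * (F q * c * (F q)⁻¹) * h⁻¹ := by group
      rw [this]
      exact H₂.mul_mem (H₂.mul_mem hh (hconj q)) (H₂.inv_mem hh)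
    rw [hcore, Subgroup.mem_bot] at hcc
    rw [e, hcc, one_mul]
  refine ⟨⟨⟨F, h1⟩, hFmul⟩, ?_, ?_⟩
  · ext x
    exact hker x
  · rw [Subgroup.disjoint_def]
    rintro _ hx ⟨x, rfl⟩
    exact hone x hx

/-- If two central subgroups are adjacent and one contains all commutators, so does the other. -/
theorem TransisoAdj.commutator_mem {G : Type*} [Group G] {H₁ H₂ : Subgroup G} [H₁.Normal]
    (h₂ : H₂ ≤ Subgroup.center G) (hadj : TransisoAdj H₁ H₂)
    (hcomm : ∀ x y : G, ⁅x, y⁆ ∈ H₁) (x y : G) : ⁅x, y⁆ ∈ H₂ := by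
  obtain ⟨F, h1, hker, hmul, hsurj, hone, hcon⟩ := hadj.exists_lift
  obtain ⟨a, s, hs, rfl⟩ := hsurj x
  obtain ⟨b, t, ht, rfl⟩ := hsurj y
  obtain ⟨c, hc, ec⟩ := hmul a b
  obtain ⟨d, hd, ed⟩ := hmul b a
  have hab : F (b * a) = F (a * b) := hcon _ _ (by
    have := hcomm a b
    rw [commutatorElement_def] at this
    simpa [mul_assoc] using this)
  have cen : ∀ u ∈ H₂, ∀ v, Commute u v := fun u hu v =>
    ((Subgroup.mem_center_iff.1 (h₂ hu)) v).symm
  have key : ⁅s * F a, t * F b⁆ = c * d⁻¹ := by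
    rw [commutatorElement_def, mul_inv_eq_iff_eq_mul, mul_inv_eq_iff_eq_mul]
    have e1 : s * F a * (t * F b) = s * t * (c * F (a * b)) := by
      rw [← ec, mul_assoc, ← mul_assoc (F a), ← (cen t ht (F a)).eq]; group
    have e2 : t * F b * (s * F a) = s * t * (d * F (a * b)) := by
      rw [← hab, ← ed, mul_assoc t, ← mul_assoc (F b), ← (cen s hs (F b)).eq,
        (cen s hs t).eq]; group
    rw [e1, mul_assoc (c * d⁻¹), e2, ← mul_assoc (c * d⁻¹),
      ((cen (c * d⁻¹) (H₂.mul_mem hc (H₂.inv_mem hd)) (s * t))).eq]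
    group
  rw [key]
  exact H₂.mul_mem hc (H₂.inv_mem hd)

namespace Subgroup

variable {G : Type*} [Group G]

theorem commute_of_mem_of_le_center {Z : Subgroup G} (hZ : Z ≤ center G) {z : G} (hz : z ∈ Z)
    (g : G) : Commute z g :=
  ((mem_center_iff.1 (hZ hz)) g).symm

theorem pow_eq_one_of_card_eq {Z : Subgroup G} {n : ℕ} (hZ : Nat.card Z = n) {z : G}
    (hz : z ∈ Z) : z ^ n = 1 := by
  have : (⟨z, hz⟩ : Z) ^ Nat.card Z = 1 := pow_card_eq_one'
  rw [hZ] at this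
  simpa using congrArg Subtype.val this

theorem commute_pow_of_commutator_mem {Z : Subgroup G} {p : ℕ} (hZ : Z ≤ center G)
    (hcard : Nat.card Z = p) {x y : G} (h : ⁅y, x⁆ ∈ Z) : Commute y (x ^ p) := by
  have e : y * x * y⁻¹ = ⁅y, x⁆ * x := by rw [commutatorElement_def]; group
  have : y * x ^ p * y⁻¹ = x ^ p := by
    rw [← conj_pow, e, (commute_of_mem_of_le_center hZ h x).mul_pow,
      pow_eq_one_of_card_eq hcard h, one_mul]
  exact mul_inv_eq_iff_eq_mul.1 this

theorem mul_pow_of_commutator_mem {Z : Subgroup G} {p : ℕ} (hp : p.Prime) (hodd : Odd p)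
    (hZ : Z ≤ center G) (hcard : Nat.card Z = p) {x y : G} (h : ⁅y, x⁆ ∈ Z) :
    (x * y) ^ p = x ^ p * y ^ p := by
  set c := ⁅y, x⁆ with hc
  have cen : ∀ n g, Commute (c ^ n) g := fun n g =>
    commute_of_mem_of_le_center hZ (Z.pow_mem h n) g
  have hyx : y * x = c * x * y := by rw [hc, commutatorElement_def]; group
  have hynx : ∀ n : ℕ, y ^ n * x = c ^ n * x * y ^ n := by
    intro n
    induction n with
    | zero => simp
    | succ n ih =>
      rw [pow_succ' y, mul_assoc, ih, ← mul_assoc, ← mul_assoc, ← (cen n y).eq, mul_assoc (c ^ n),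
        hyx, pow_succ]
      group
  have key : ∀ n : ℕ, (x * y) ^ n = c ^ (n.choose 2) * (x ^ n * y ^ n) := by
    intro n
    induction n with
    | zero => simp
    | succ n ih =>
      have h2 : (n + 1).choose 2 = n.choose 2 + n := by
        rw [Nat.choose_succ_succ' n 1, Nat.choose_one_right, add_comm]
      calc (x * y) ^ (n + 1) = c ^ (n.choose 2) * x ^ n * (y ^ n * x) * y := by
            rw [pow_succ, ih]; simp only [mul_assoc]
        _ = c ^ (n.choose 2) * (x ^ n * c ^ n) * x * y ^ n * y := by
            rw [hynx]; simp only [mul_assoc]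
        _ = c ^ ((n + 1).choose 2) * (x ^ (n + 1) * y ^ (n + 1)) := by
            rw [← (cen n (x ^ n)).eq, h2, pow_add, pow_succ, pow_succ]; simp only [mul_assoc]
  have hp2 : 2 < p := lt_of_le_of_ne hp.two_le fun h =>
    absurd (h ▸ hodd : Odd 2) (by decide)
  obtain ⟨m, hm⟩ := hp.dvd_choose_self two_ne_zero hp2
  rw [key, hm, pow_mul, pow_eq_one_of_card_eq hcard h, one_pow, one_mul]

theorem eq_zpowers_of_card_prime {Z : Subgroup G} {p : ℕ} [Fact p.Prime]
    (hZ : Nat.card Z = p) {z : G} (hz : z ∈ Z) (hz1 : z ≠ 1) : zpowers z = Z := by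
  have : Finite Z := Nat.finite_of_card_ne_zero (hZ ▸ (Fact.out : p.Prime).ne_zero)
  refine eq_of_le_of_card_ge (zpowers_le.2 hz) ?_
  rw [hZ, Nat.card_zpowers, orderOf_eq_prime (pow_eq_one_of_card_eq hZ hz) hz1]

theorem le_center_of_normal_of_card_prime {Z : Subgroup G} [Z.Normal] {p : ℕ} [Fact p.Prime]
    (hG : IsPGroup p G) (hZ : Nat.card Z = p) : Z ≤ center G := by
  have : Finite Z := Nat.finite_of_card_ne_zero (hZ ▸ (Fact.out : p.Prime).ne_zero)
  obtain ⟨b, hb, h1⟩ := (hG.of_equiv ConjAct.toConjAct)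
    |>.exists_fixed_point_of_prime_dvd_card_of_fixed_point Z (hZ ▸ dvd_rfl) (a := 1)
      (fun g => smul_one g)
  have hb1 : (b : G) ≠ 1 := fun h => h1 (Subtype.ext h.symm)
  rw [← eq_zpowers_of_card_prime hZ b.2 hb1, zpowers_le, mem_center_iff]
  intro g
  have := congrArg Subtype.val (hb (ConjAct.toConjAct g))
  rw [ConjAct.Subgroup.val_conj_smul, ConjAct.smul_def, ConjAct.ofConjAct_toConjAct] at this
  exact mul_inv_eq_iff_eq_mul.1 this

theorem commutator_mem_of_index_prime {K : Subgroup G} [K.Normal] {p : ℕ} [Fact p.Prime]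
    (hK : K.index = p) (x y : G) : ⁅x, y⁆ ∈ K := by
  have : IsCyclic (G ⧸ K) := isCyclic_of_prime_card (p := p) hK
  have hc : IsMulCommutative (G ⧸ K) := inferInstance
  rw [← QuotientGroup.eq_one_iff]
  change QuotientGroup.mk' K ⁅x, y⁆ = 1
  rw [map_commutatorElement, commutatorElement_eq_one_iff_mul_comm]
  exact hc.is_comm.comm _ _

theorem card_center_of_card_prime_pow_three {p : ℕ} [Fact p.Prime] (hG : Nat.card G = p ^ 3)
    (hnc : ¬ ∀ x y : G, x * y = y * x) : Nat.card (center G) = p := by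
  have hp : p.Prime := Fact.out
  obtain ⟨k, hk0, hk⟩ := IsPGroup.card_center_eq_prime_pow hG (by norm_num)
  have hmul := (center G).card_mul_index
  have hk3 : k ≤ 3 := by
    rw [← Nat.pow_dvd_pow_iff_le_right hp.one_lt, ← hk, ← hG]
    exact card_subgroup_dvd_card _
  have hcyc : ¬ IsCyclic (G ⧸ center G) := fun h => hnc fun x y =>
    (isMulCommutative_of_isCyclic_quotient_center_self G).is_comm.comm x y
  have hind : ¬ (center G).index ∣ p := fun h => hcyc (isCyclic_of_card_dvd_prime (p := p) h)
  rw [hk, hG] at hmul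
  interval_cases k
  · simpa using hk
  · exact absurd (Nat.eq_of_mul_eq_mul_left (pow_pos hp.pos 2)
      (hmul.trans (pow_succ p 2))).dvd hind
  · exact absurd ((Nat.eq_of_mul_eq_mul_left (pow_pos hp.pos 3)
      (hmul.trans (mul_one _).symm)) ▸ one_dvd p) hind

end Subgroup

section PrimePowFour

open Subgroup

variable {G : Type*} [Group G] {p : ℕ} [Fact p.Prime]

theorem MonoidHom.index_range_of_card_ker (hG : Nat.card G = p ^ 4) {f : G →* G}
    (hf : Nat.card f.ker = p) : Nat.card f.range = p ^ 3 ∧ f.range.index = p := by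
  have hp : p.Prime := Fact.out
  have h1 := f.ker.card_mul_index
  rw [Subgroup.index_ker, hf, hG, pow_succ' p 3] at h1
  have h2 : Nat.card f.range = p ^ 3 := Nat.eq_of_mul_eq_mul_left hp.pos h1
  refine ⟨h2, ?_⟩
  have h3 := f.range.card_mul_index
  rw [h2, hG, pow_succ p 3] at h3
  exact Nat.eq_of_mul_eq_mul_left (pow_pos hp.pos 3) h3

theorem Subgroup.normal_of_index_eq_of_card (hG : Nat.card G = p ^ 4) {K : Subgroup G}
    (hK : K.index = p) : K.Normal := by
  have hp : p.Prime := Fact.out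
  exact normal_of_index_eq_minFac_card (by rw [hG, hp.pow_minFac (by norm_num), hK])

/-- If every non-central subgroup of order `p` has, for each central `Z` of order `p`,
a complement isomorphic to `G ⧸ Z`, then the groups `G ⧸ Z` are not all abelian. -/
theorem exists_commutator_notMem_of_exists_hom (hodd : Odd p) (hG : Nat.card G = p ^ 4)
    (hA : ∀ Z H : Subgroup G, Nat.card Z = p → Nat.card H = p → Z ≤ center G →
      ¬ H ≤ center G → ∃ f : G →* G, f.ker = Z ∧ Disjoint H f.range)
    {Z H : Subgroup G} (hZ : Z ≤ center G) (hZp : Nat.card Z = p)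
    (hHp : Nat.card H = p) (hH : ¬ H ≤ center G) :
    ∃ Z : Subgroup G, Z ≤ center G ∧ Nat.card Z = p ∧ ∃ x y : G, ⁅x, y⁆ ∉ Z := by
  have hp : p.Prime := Fact.out
  have hfin : Finite G := Nat.finite_of_card_ne_zero (hG ▸ pow_ne_zero 4 hp.ne_zero)
  by_contra! hab
  have hmulpow : ∀ x y : G, (x * y) ^ p = x ^ p * y ^ p := fun x y =>
    mul_pow_of_commutator_mem hp hodd hZ hZp (hab Z hZ hZp _ _)
  have hpowcen : ∀ x : G, x ^ p ∈ center G := fun x => mem_center_iff.2 fun g =>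
    commute_pow_of_commutator_mem hZ hZp (hab Z hZ hZp g x)
  have hprod : ∀ {K : Subgroup G}, K.index = p → Disjoint H K → ∀ g, ∃ h ∈ H, ∃ k ∈ K,
      h * k = g := by
    intro K hK hd g
    have hcard : Nat.card H * Nat.card K = Nat.card G := by
      rw [← K.card_mul_index, hHp, hK, mul_comm]
    obtain ⟨⟨h, k⟩, e⟩ := (isComplement'_of_card_mul_and_disjoint hcard hd).surjective g
    exact ⟨h, h.2, k, k.2, e⟩
  have hexp : ∀ x : G, x ^ p = 1 := by
    by_contra! ⟨x, hx⟩
    have hpd : p ∣ orderOf x := by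
      obtain ⟨k, -, hk⟩ := (Nat.dvd_prime_pow hp).1 (hG ▸ orderOf_dvd_natCard x)
      rcases k with _ | k
      · rw [pow_zero, orderOf_eq_one_iff] at hk
        exact absurd (by rw [hk, one_pow]) hx
      · exact hk ▸ dvd_pow_self p k.succ_ne_zero
    obtain ⟨m, hm⟩ := hpd
    have hm0 : m ≠ 0 := by
      rintro rfl
      exact (orderOf_pos x).ne' (by simpa using hm)
    have hpm : p ∣ m := by
      obtain ⟨k, -, hk⟩ := (Nat.dvd_prime_pow hp).1 (hG ▸ orderOf_dvd_natCard x)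
      rcases k with _ | _ | k
      · rw [pow_zero, orderOf_eq_one_iff] at hk
        exact absurd (by rw [hk, one_pow]) hx
      · rw [zero_add, pow_one] at hk
        exact absurd (by rw [← hk]; exact pow_orderOf_eq_one x) hx
      · refine ⟨p ^ k, Nat.eq_of_mul_eq_mul_left hp.pos ?_⟩
        rw [← hm, hk]; ring
    obtain ⟨n, rfl⟩ := hpm
    have hzo : orderOf ((x ^ n) ^ p) = p := by
      rw [← pow_mul, mul_comm, orderOf_pow_of_dvd hm0 ⟨p, by rw [hm, mul_comm]⟩, hm,
        Nat.mul_div_cancel _ (Nat.pos_of_ne_zero hm0)]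
    set z := (x ^ n) ^ p with hz
    have hW : zpowers z ≤ center G := zpowers_le.2 (hpowcen _)
    have hWp : Nat.card (zpowers z) = p := by rw [Nat.card_zpowers, hzo]
    obtain ⟨f, hker, hd⟩ := hA _ H hWp hHp hW hH
    obtain ⟨-, hind⟩ := MonoidHom.index_range_of_card_ker hG (hker ▸ hWp)
    have himage : f '' Set.range (fun g : G => g ^ p) = Set.range (fun g : G => g ^ p) := by
      ext y
      constructor
      · rintro ⟨_, ⟨g, rfl⟩, rfl⟩
        exact ⟨f g, (map_pow f g p).symm⟩
      · rintro ⟨g, rfl⟩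
        obtain ⟨h, hh, _, ⟨k, rfl⟩, rfl⟩ := hprod hind hd g
        refine ⟨k ^ p, ⟨k, rfl⟩, ?_⟩
        change f (k ^ p) = (h * f k) ^ p
        rw [hmulpow, pow_eq_one_of_card_eq hHp hh, one_mul, map_pow]
    have hinj : Set.InjOn f (Set.range (fun g : G => g ^ p)) :=
      Set.injOn_of_ncard_image_eq (by rw [himage]) (Set.toFinite _)
    have hz1 : z = 1 := hinj ⟨x ^ n, rfl⟩ ⟨1, one_pow p⟩ (by
      rw [map_one, ← MonoidHom.mem_ker, hker]; exact mem_zpowers z)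
    rw [hz1, orderOf_one] at hzo
    exact hp.one_lt.ne hzo
  obtain ⟨f, hker, hd⟩ := hA Z H hZp hHp hZ hH
  obtain ⟨hKp, hind⟩ := MonoidHom.index_range_of_card_ker hG (hker ▸ hZp)
  have hKab : ∀ x ∈ f.range, ∀ y ∈ f.range, Commute x y := by
    rintro _ ⟨x, rfl⟩ _ ⟨y, rfl⟩
    rw [← commutatorElement_eq_one_iff_commute, ← map_commutatorElement, ← MonoidHom.mem_ker,
      hker]
    exact hab Z hZ hZp x y
  obtain ⟨h, hhH, hhc⟩ := SetLike.not_le_iff_exists.1 hH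
  have hh1 : h ≠ 1 := fun e => hhc (e ▸ one_mem _)
  have hHz : zpowers h = H := eq_zpowers_of_card_prime hHp hhH hh1
  have hcomm : ∀ x y g : G, ⁅x * y, g⁆ = ⁅x, g⁆ * ⁅y, g⁆ := by
    intro x y g
    have := (commute_of_mem_of_le_center hZ (hab Z hZ hZp y g) x).eq
    calc ⁅x * y, g⁆ = x * ⁅y, g⁆ * x⁻¹ * ⁅x, g⁆ := by
          simp only [commutatorElement_def]; group
      _ = ⁅y, g⁆ * ⁅x, g⁆ := by rw [← this]; group
      _ = _ := commute_of_mem_of_le_center hZ (hab Z hZ hZp y g) _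
  let κ : f.range →* Z :=
    { toFun := fun k => ⟨⁅(k : G), h⁆, hab Z hZ hZp _ _⟩
      map_one' := by simp
      map_mul' := fun x y => Subtype.ext (hcomm x y h) }
  have hkercen : ∀ k ∈ κ.ker, (k : G) ∈ center G := by
    intro k hk
    have hkh : Commute (k : G) h := commutatorElement_eq_one_iff_commute.1
      (congrArg Subtype.val hk)
    refine mem_center_iff.2 fun g => ?_
    obtain ⟨a, ha, b, hb, rfl⟩ := hprod hind hd g
    rw [← hHz] at ha
    obtain ⟨n, rfl⟩ := mem_zpowers_iff.1 ha
    exact ((hkh.zpow_right n).mul_right (hKab k k.2 b hb)).eq.symm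
  obtain ⟨g, hg⟩ : ∃ g, g * h ≠ h * g := by
    by_contra! hg
    exact hhc (mem_center_iff.2 hg)
  have hc1 : ⁅g, h⁆ ≠ 1 := fun e => hg (commutatorElement_eq_one_iff_mul_comm.1 e)
  have hkerle : κ.ker.map f.range.subtype ≤ Z := by
    rintro _ ⟨k, hk, rfl⟩
    change (k : G) ∈ Z
    by_cases hk1 : (k : G) = 1
    · rw [hk1]; exact one_mem _
    have hWp : Nat.card (zpowers (k : G)) = p := by
      rw [Nat.card_zpowers, orderOf_eq_prime (hexp _) hk1]
    have hmem := hab _ (zpowers_le.2 (hkercen k hk)) hWp g h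
    rw [← eq_zpowers_of_card_prime hZp (hab Z hZ hZp g h) hc1,
      eq_zpowers_of_card_prime hWp hmem hc1]
    exact mem_zpowers _
  have hle1 : Nat.card κ.ker ≤ p := by
    have hcardmap : Nat.card (κ.ker.map f.range.subtype) = Nat.card κ.ker :=
      card_map_of_injective f.range.subtype_injective
    rw [← hZp, ← hcardmap]
    exact card_le_of_le hkerle
  have hle2 : Nat.card κ.range ≤ p := hZp ▸ card_le_card_group _
  have hmul := κ.ker.card_mul_index
  rw [index_ker, hKp] at hmul
  have : p ^ 3 ≤ p * p := hmul ▸ Nat.mul_le_mul hle1 hle2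
  rw [← sq] at this
  exact absurd (Nat.pow_lt_pow_right hp.one_lt (by norm_num : 2 < 3)) (not_lt.2 this)

/-- If every non-central subgroup of order `p` has, for each central `Z` of order `p`,
a complement isomorphic to `G ⧸ Z`, then some of the groups `G ⧸ Z` are abelian. -/
theorem exists_commutator_mem_of_exists_hom (hodd : Odd p) (hG : Nat.card G = p ^ 4)
    (hA : ∀ Z H : Subgroup G, Nat.card Z = p → Nat.card H = p → Z ≤ center G →
      ¬ H ≤ center G → ∃ f : G →* G, f.ker = Z ∧ Disjoint H f.range)
    {Z H : Subgroup G} (hZ : Z ≤ center G) (hZp : Nat.card Z = p)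
    (hHp : Nat.card H = p) (hH : ¬ H ≤ center G) :
    ∃ Z : Subgroup G, Z ≤ center G ∧ Nat.card Z = p ∧ ∀ x y : G, ⁅x, y⁆ ∈ Z := by
  have hp : p.Prime := Fact.out
  have hfin : Finite G := Nat.finite_of_card_ne_zero (hG ▸ pow_ne_zero 4 hp.ne_zero)
  by_contra! hnab
  obtain ⟨f, hker, hd⟩ := hA Z H hZp hHp hZ hH
  obtain ⟨hKp, hind⟩ := MonoidHom.index_range_of_card_ker hG (hker ▸ hZp)
  have hKn : f.range.Normal := normal_of_index_eq_of_card hG hind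
  have hKnc : ¬ ∀ x y : f.range, x * y = y * x := by
    intro hK
    obtain ⟨x, y, hxy⟩ := hnab Z hZ hZp
    refine hxy ?_
    rw [← hker, MonoidHom.mem_ker, map_commutatorElement, commutatorElement_eq_one_iff_mul_comm]
    exact congrArg Subtype.val (hK ⟨f x, x, rfl⟩ ⟨f y, y, rfl⟩)
  have hcp := card_center_of_card_prime_pow_three hKp hKnc
  set W := (center f.range).map f.range.subtype with hW
  have hWp : Nat.card W = p := by
    rw [hW, card_map_of_injective f.range.subtype_injective, hcp]
  have hWn : W.Normal := inferInstance
  have hWc : W ≤ center G := le_center_of_normal_of_card_prime (IsPGroup.of_card hG) hWp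
  have hmemW : ∀ k ∈ f.range, (∀ l ∈ f.range, l * k = k * l) → k ∈ W := fun k hk hl =>
    ⟨⟨k, hk⟩, mem_center_iff.2 fun l => Subtype.ext (hl l l.2), rfl⟩
  have hKW : ∀ x ∈ f.range, ∀ y ∈ f.range, ⁅x, y⁆ ∈ W := by
    intro x hx y hy
    have hq : Nat.card (f.range ⧸ center f.range) = p ^ 2 := by
      have := (center f.range).card_mul_index
      rw [hcp, hKp, pow_succ' p 2] at this
      exact Nat.eq_of_mul_eq_mul_left hp.pos this
    have hcomm := (IsPGroup.isMulCommutative_of_card_eq_prime_sq hq).is_comm.comm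
    refine ⟨⁅(⟨x, hx⟩ : f.range), (⟨y, hy⟩ : f.range)⁆, ?_, rfl⟩
    change _ ∈ center f.range
    rw [← QuotientGroup.eq_one_iff]
    change QuotientGroup.mk' _ ⁅_, _⁆ = 1
    rw [map_commutatorElement, commutatorElement_eq_one_iff_mul_comm]
    exact hcomm _ _
  have hpow : ∀ k ∈ f.range, k ^ p ∈ W := fun k hk =>
    hmemW _ (pow_mem hk p) fun l hl => commute_pow_of_commutator_mem hWc hWp (hKW l hl k hk)
  obtain ⟨k, hk, g, hkg⟩ : ∃ k ∈ f.range, ∃ g, ⁅k, g⁆ ∉ W := by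
    by_contra! hKG
    obtain ⟨x, y, hxy⟩ := hnab W hWc hWp
    have hq : ∀ x y : G, ⁅x, y⁆ ∈ W ↔ Commute (x : G ⧸ W) y := by
      intro x y
      rw [← QuotientGroup.eq_one_iff, ← commutatorElement_eq_one_iff_commute]
      exact Iff.of_eq (congrArg (· = 1) (map_commutatorElement (QuotientGroup.mk' W) x y))
    have hcard : Nat.card H * Nat.card f.range = Nat.card G := by
      rw [← f.range.card_mul_index, hHp, hind, mul_comm]
    have hsurj := (isComplement'_of_card_mul_and_disjoint hcard hd).surjective
    obtain ⟨⟨a, k⟩, rfl⟩ := hsurj x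
    obtain ⟨⟨b, l⟩, rfl⟩ := hsurj y
    refine hxy ?_
    have hcyc : IsCyclic H := isCyclic_of_prime_card hHp
    have hab : Commute (a : G) b := congrArg Subtype.val
      ((inferInstance : IsMulCommutative H).is_comm.comm a b)
    have hkc : ∀ g : G, Commute ((k : G) : G ⧸ W) g := fun g => (hq _ _).1 (hKG k k.2 g)
    have hlc : ∀ g : G, Commute ((l : G) : G ⧸ W) g := fun g => (hq _ _).1 (hKG l l.2 g)
    refine (hq (a * k : G) (b * l : G)).2 ?_
    rw [QuotientGroup.mk_mul, QuotientGroup.mk_mul]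
    refine Commute.mul_left (Commute.mul_right ?_ (hlc _).symm)
      (by rw [← QuotientGroup.mk_mul]; exact hkc _)
    exact (hq _ _).1 (by rw [commutatorElement_eq_one_iff_commute.2 hab]; exact one_mem _)
  have hcK : ⁅k, g⁆ ∈ f.range := by
    have := mul_mem hk (hKn.conj_mem _ (inv_mem hk) g)
    rwa [show k * (g * k⁻¹ * g⁻¹) = ⁅k, g⁆ by rw [commutatorElement_def]; group] at this
  have hcnc : ⁅k, g⁆ ∉ center G := fun h => hkg
    (hmemW _ hcK fun l _ => mem_center_iff.1 h l)
  have hcp : ⁅k, g⁆ ^ p = 1 := by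
    have e : k⁻¹ * ⁅k, g⁆ = g * k⁻¹ * g⁻¹ := by rw [commutatorElement_def]; group
    have e2 : (k⁻¹ * ⁅k, g⁆) ^ p = (g * k⁻¹ * g⁻¹) ^ p := by rw [e]
    rw [mul_pow_of_commutator_mem hp hodd hWc hWp (hKW _ hcK _ (inv_mem hk)), conj_pow,
      ← (commute_of_mem_of_le_center hWc (hpow _ (inv_mem hk)) g).eq, mul_inv_cancel_right] at e2
    exact mul_eq_left.1 e2
  have hc1 : ⁅k, g⁆ ≠ 1 := fun h => hcnc (h ▸ one_mem _)
  obtain ⟨f₂, hker₂, hd₂⟩ := hA W (zpowers ⁅k, g⁆) hWp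
    (by rw [Nat.card_zpowers, orderOf_eq_prime hcp hc1]) hWc
    (fun h => hcnc (h (mem_zpowers _)))
  obtain ⟨-, hind₂⟩ := MonoidHom.index_range_of_card_ker hG (hker₂ ▸ hWp)
  have hKn₂ : f₂.range.Normal := normal_of_index_eq_of_card hG hind₂
  exact hc1 (Subgroup.disjoint_def.1 hd₂ (mem_zpowers _) (commutator_mem_of_index_prime hind₂ k g))

end PrimePowFour

theorem stmt_16 {G : Type*} [Group G] (p : ℕ) (hp : p.Prime) (hodd : Odd p)
    (hcard : Nat.card G = p ^ 4)
    (hnc : ∃ H : Subgroup G, Nat.card H = p ∧ ¬ H ≤ Subgroup.center G) :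
    ¬ TransisoComplete G p := by
  have := Fact.mk hp
  have hfin : Finite G := Nat.finite_of_card_ne_zero (hcard ▸ pow_ne_zero 4 hp.ne_zero)
  have hPG : IsPGroup p G := IsPGroup.of_card hcard
  intro hcomplete
  have hnormal : ∀ Z : Subgroup G, Z ≤ Subgroup.center G → Z.Normal := fun Z hZ =>
    ⟨fun z hz g => by
      rwa [← (Subgroup.commute_of_mem_of_le_center hZ hz g).eq, mul_inv_cancel_right]⟩
  have hA : ∀ Z H : Subgroup G, Nat.card Z = p → Nat.card H = p → Z ≤ Subgroup.center G →
      ¬ H ≤ Subgroup.center G → ∃ f : G →* G, f.ker = Z ∧ Disjoint H f.range := by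
    intro Z H hZ hH hZc hHc
    have := hnormal Z hZc
    refine (hcomplete Z H hZ hH fun h => hHc (h ▸ hZc)).exists_hom ?_
    by_contra hne
    obtain ⟨c, hc, hc1⟩ := H.normalCore.bot_or_exists_ne_one.resolve_left hne
    have hcore : H.normalCore = H := by
      refine le_antisymm H.normalCore_le ?_
      rw [← Subgroup.eq_zpowers_of_card_prime hH (H.normalCore_le hc) hc1, Subgroup.zpowers_le]
      rwa [Subgroup.eq_zpowers_of_card_prime hH (H.normalCore_le hc) hc1]
    have : H.Normal := hcore ▸ H.normalCore_normal
    exact hHc (Subgroup.le_center_of_normal_of_card_prime hPG hH)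
  obtain ⟨H, hH, hHc⟩ := hnc
  have : Nontrivial G := by
    rw [← Finite.one_lt_card_iff_nontrivial, hcard]
    exact Nat.one_lt_pow (by norm_num) hp.one_lt
  have hZnt : Nontrivial (Subgroup.center G) := hPG.center_nontrivial
  obtain ⟨k, hk0, hk⟩ := (hPG.to_subgroup (Subgroup.center G)).nontrivial_iff_card.1 hZnt
  obtain ⟨z, hz⟩ := exists_prime_orderOf_dvd_card' (G := Subgroup.center G) p
    (hk ▸ dvd_pow_self p hk0.ne')
  have hZ : Subgroup.zpowers (z : G) ≤ Subgroup.center G := Subgroup.zpowers_le.2 z.2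
  have hZp : Nat.card (Subgroup.zpowers (z : G)) = p := by
    rw [Nat.card_zpowers, Subgroup.orderOf_coe, hz]
  obtain ⟨Z₁, hZ₁, hZ₁p, hab⟩ := exists_commutator_mem_of_exists_hom hodd hcard hA hZ hZp hH hHc
  obtain ⟨Z₂, hZ₂, hZ₂p, x, y, hxy⟩ :=
    exists_commutator_notMem_of_exists_hom hodd hcard hA hZ hZp hH hHc
  have := hnormal Z₁ hZ₁
  have hne : Z₁ ≠ Z₂ := fun h => hxy (h ▸ hab x y)
  exact hxy ((hcomplete Z₁ Z₂ hZ₁p hZ₂p hne).commutator_mem hZ₂ hab x y)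
end
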